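/- Let κ > 0 and let u be a global classical solution on [0,∞) × ℝ of the Degasperis–Procesi equation ∂_t u + ∂_x( ½u² + p * ( (3/2)u² + 2κu ) ) = 0 (p(x) = ½e^{−|x|}, * convolution in x), with u(t,·) ∈ C² ∩ L²(ℝ) for each t, such that the initial momentum density w₀(x) = u₀(x) − u₀''(x) + (2/3)κ is nonnegative for all x, where u₀ = u(0,·). Then: (1) for all (t,x) ∈ [0,∞) × ℝ, |∂_x u(t,x)| ≤ |u(t,x) + (2/3)κ|; and (2) for all t ∈ [0,∞), ‖u(t,·)‖_{L^∞(ℝ)} ≤ 2(1 + √2) ‖u₀‖_{L²(ℝ)} + (4/3)κ. -/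

import Mathlib

open MeasureTheory Real Filter Finset
open scoped ENNReal

noncomputable section

/-- The kernel `p(x) = ½ e^{-|x|}` of `(1 - ∂ₓ²)⁻¹` on `ℝ`. -/
def pker (x : ℝ) : ℝ := (1/2) * Real.exp (-|x|)

/-- The kernel `q(x) = ¼ e^{-2|x|}` of `(4 - ∂ₓ²)⁻¹` on `ℝ`. -/
def qker (x : ℝ) : ℝ := (1/4) * Real.exp (-(2*|x|))

/-- Convolution of two functions on `ℝ`. -/
def convol (f g : ℝ → ℝ) (x : ℝ) : ℝ := ∫ y, f (x - y) * g y

/-- `u` is a pointwise classical solution of the Degasperis-Procesi equation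
`∂ₜ u + ∂ₓ(½u² + p*((3/2)u² + 2κu)) = 0` for times `t ∈ T`. -/
def IsDPSolution (κ : ℝ) (T : Set ℝ) (u : ℝ → ℝ → ℝ) : Prop :=
  ∀ t ∈ T, ∀ x : ℝ,
    HasDerivAt (fun s => u s x)
      (-(deriv (fun y => (1/2) * (u t y)^2
          + convol pker (fun z => (3/2) * (u t z)^2 + 2*κ*(u t z)) y) x)) t

/-- The `c`-speed smooth solitary-wave profile of the DP equation:  even, smooth,
positive, strictly decreasing on `(0,∞)`, decaying at `±∞` and satisfying the
first-integral equation. -/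
structure IsSoliton (κ c : ℝ) (φ : ℝ → ℝ) : Prop where
  smooth : ContDiff ℝ (⊤ : ℕ∞) φ
  even : ∀ x, φ (-x) = φ x
  pos : ∀ x, 0 < φ x
  anti : StrictAntiOn φ (Set.Ioi 0)
  decay_top : Tendsto φ atTop (nhds 0)
  decay_bot : Tendsto φ atBot (nhds 0)
  eqn : ∀ x, (1/2)*(c - φ x)^2 * (deriv φ x)^2
      = (φ x)^2 * ((1/2)*(φ x)^2 - c * φ x + (2/3)*κ*(φ x) + (1/2)*c^2 - κ*c)



/-! ### Part 1: exponential kernels -/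

/-- left half of the kernel operator -/
def KA (l : ℝ) (h : ℝ → ℝ) (x : ℝ) : ℝ := ∫ y in Set.Iic x, Real.exp (l * (y - x)) * h y

/-- right half of the kernel operator -/
def KB (l : ℝ) (h : ℝ → ℝ) (x : ℝ) : ℝ := ∫ y in Set.Ioi x, Real.exp (l * (x - y)) * h y

/-- full kernel operator -/
def KP (l : ℝ) (h : ℝ → ℝ) (x : ℝ) : ℝ := ∫ y, Real.exp (-(l * |x - y|)) * h y

/-- derivative of the full kernel operator -/
def KD (l : ℝ) (h : ℝ → ℝ) (x : ℝ) : ℝ := l * (KB l h x - KA l h x)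

/-- integrability against the kernel -/
def KI (l : ℝ) (h : ℝ → ℝ) : Prop := ∀ x, Integrable (fun y => Real.exp (-(l * |x - y|)) * h y)

lemma KI.iic {l : ℝ} {h : ℝ → ℝ} (hh : KI l h) (x : ℝ) :
    IntegrableOn (fun y => Real.exp (l * (y - x)) * h y) (Set.Iic x) := by
  refine ((hh x).integrableOn (s := Set.Iic x)).congr_fun ?_ measurableSet_Iic
  intro y hy
  have : |x - y| = x - y := abs_of_nonneg (by simpa using hy)
  simp only [this]
  congr 2; ring

lemma KI.ioi {l : ℝ} {h : ℝ → ℝ} (hh : KI l h) (x : ℝ) :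
    IntegrableOn (fun y => Real.exp (l * (x - y)) * h y) (Set.Ioi x) := by
  refine ((hh x).integrableOn (s := Set.Ioi x)).congr_fun ?_ measurableSet_Ioi
  intro y hy
  have : |x - y| = y - x := by
    rw [abs_of_nonpos]; · ring
    have : x < y := hy
    linarith
  simp only [this]
  congr 2; ring

lemma KP_eq {l : ℝ} {h : ℝ → ℝ} (hh : KI l h) (x : ℝ) : KP l h x = KA l h x + KB l h x := by
  unfold KP KA KB
  rw [← integral_add_compl (measurableSet_Iic (a := x)) (hh x)]
  congr 1
  · apply setIntegral_congr_fun measurableSet_Iic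
    intro y hy
    have : |x - y| = x - y := abs_of_nonneg (by simpa using hy)
    simp only [this]
    congr 2; ring
  · rw [Set.compl_Iic]
    apply setIntegral_congr_fun measurableSet_Ioi
    intro y hy
    have : |x - y| = y - x := by
      rw [abs_of_nonpos]; · ring
      have : x < y := hy
      linarith
    simp only [this]
    congr 2; ring

lemma KI.abs {l : ℝ} {h : ℝ → ℝ} (hh : KI l h) : KI l (fun y => |h y|) := by
  intro x
  refine (hh x).abs.congr (Filter.Eventually.of_forall ?_)
  intro y
  simp [abs_mul]

lemma KA_abs_le {l : ℝ} {h : ℝ → ℝ} (x : ℝ) :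
    |KA l h x| ≤ KA l (fun y => |h y|) x := by
  unfold KA
  refine (abs_integral_le_integral_abs).trans (le_of_eq ?_)
  congr 1; ext y; simp [abs_mul]

lemma KB_abs_le {l : ℝ} {h : ℝ → ℝ} (x : ℝ) :
    |KB l h x| ≤ KB l (fun y => |h y|) x := by
  unfold KB
  refine (abs_integral_le_integral_abs).trans (le_of_eq ?_)
  congr 1; ext y; simp [abs_mul]

lemma KP_abs_le {l : ℝ} {h : ℝ → ℝ} (x : ℝ) :
    |KP l h x| ≤ KP l (fun y => |h y|) x := by
  unfold KP
  refine (abs_integral_le_integral_abs).trans (le_of_eq ?_)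
  congr 1; ext y; simp [abs_mul]

lemma KD_abs_le {l : ℝ} (hl : 0 ≤ l) {h : ℝ → ℝ} (hh : KI l h) (x : ℝ) :
    |KD l h x| ≤ l * KP l (fun y => |h y|) x := by
  rw [KP_eq hh.abs, KD, abs_mul, abs_of_nonneg hl]
  gcongr
  have h1 := KA_abs_le (l := l) (h := h) x
  have h2 := KB_abs_le (l := l) (h := h) x
  have := abs_sub (KB l h x) (KA l h x)
  linarith

lemma KP_mono {l : ℝ} {h k : ℝ → ℝ} (hh : KI l h) (hk : KI l k) (hle : ∀ y, h y ≤ k y) (x : ℝ) :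
    KP l h x ≤ KP l k x := by
  unfold KP
  refine integral_mono (hh x) (hk x) ?_
  intro y
  exact mul_le_mul_of_nonneg_left (hle y) (Real.exp_pos _).le

lemma KP_nonneg {l : ℝ} {h : ℝ → ℝ} (hle : ∀ y, 0 ≤ h y) (x : ℝ) : 0 ≤ KP l h x :=
  integral_nonneg fun y => mul_nonneg (Real.exp_pos _).le (hle y)

lemma hasDerivAt_KA {l : ℝ} {h : ℝ → ℝ} (hc : Continuous h) (hh : KI l h) (x : ℝ) :
    HasDerivAt (KA l h) (h x - l * KA l h x) x := by
  have hF : ∀ z, KA l h z = Real.exp (-(l * z)) *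
      ((∫ y in Set.Iic x, Real.exp (l * y) * h y) + ∫ y in x..z, Real.exp (l * y) * h y) := by
    intro z
    have hintg : ∀ w, IntegrableOn (fun y => Real.exp (l * y) * h y) (Set.Iic w) := by
      intro w
      have := (hh.iic w).const_mul (Real.exp (l * w))
      refine IntegrableOn.congr_fun this ?_ measurableSet_Iic
      intro y _
      simp only [← mul_assoc, ← Real.exp_add]
      congr 2; ring
    rw [← intervalIntegral.integral_Iic_sub_Iic (hintg x) (hintg z)]
    unfold KA
    rw [add_sub_cancel, ← integral_const_mul]
    apply setIntegral_congr_fun measurableSet_Iic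
    intro y _
    simp only [← mul_assoc, ← Real.exp_add]
    congr 2; ring
  have hcc : Continuous (fun y => Real.exp (l * y) * h y) := by fun_prop
  have h1 : HasDerivAt (fun z => (∫ y in Set.Iic x, Real.exp (l * y) * h y)
      + ∫ y in x..z, Real.exp (l * y) * h y) (Real.exp (l * x) * h x) x :=
    (intervalIntegral.integral_hasDerivAt_right (hcc.intervalIntegrable _ _)
      (hcc.stronglyMeasurableAtFilter _ _) hcc.continuousAt).const_add _
  have h2 : HasDerivAt (fun z => Real.exp (-(l * z))) (Real.exp (-(l * x)) * (-(l * 1))) x :=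
    (((hasDerivAt_id x).const_mul l).neg).exp
  have h3 := h2.mul h1
  have h4 : KA l h = fun z => Real.exp (-(l * z)) *
      ((∫ y in Set.Iic x, Real.exp (l * y) * h y) + ∫ y in x..z, Real.exp (l * y) * h y) :=
    funext hF
  have hx := hF x
  rw [h4]
  refine h3.congr_deriv ?_
  beta_reduce
  rw [← hx, hx, intervalIntegral.integral_same, add_zero, ← mul_assoc, ← Real.exp_add]
  simp
  ring

lemma hasDerivAt_KB {l : ℝ} {h : ℝ → ℝ} (hc : Continuous h) (hh : KI l h) (x : ℝ) :
    HasDerivAt (KB l h) (-h x + l * KB l h x) x := by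
  have hF : ∀ z, KB l h z = Real.exp (l * z) *
      ((∫ y in Set.Ioi x, Real.exp (-(l * y)) * h y) - ∫ y in x..z, Real.exp (-(l * y)) * h y) := by
    intro z
    have hintg : ∀ w, IntegrableOn (fun y => Real.exp (-(l * y)) * h y) (Set.Ioi w) := by
      intro w
      have := (hh.ioi w).const_mul (Real.exp (-(l * w)))
      refine IntegrableOn.congr_fun this ?_ measurableSet_Ioi
      intro y _
      simp only [← mul_assoc, ← Real.exp_add]
      congr 2; ring
    rw [← intervalIntegral.integral_Ioi_sub_Ioi' (hintg x) (hintg z)]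
    unfold KB
    rw [sub_sub_cancel, ← integral_const_mul]
    apply setIntegral_congr_fun measurableSet_Ioi
    intro y _
    simp only [← mul_assoc, ← Real.exp_add]
    congr 2; ring
  have hcc : Continuous (fun y => Real.exp (-(l * y)) * h y) := by fun_prop
  have h1 : HasDerivAt (fun z => (∫ y in Set.Ioi x, Real.exp (-(l * y)) * h y)
      - ∫ y in x..z, Real.exp (-(l * y)) * h y) (-(Real.exp (-(l * x)) * h x)) x :=
    (intervalIntegral.integral_hasDerivAt_right (hcc.intervalIntegrable _ _)
      (hcc.stronglyMeasurableAtFilter _ _) hcc.continuousAt).const_sub _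
  have h2 : HasDerivAt (fun z => Real.exp (l * z)) (Real.exp (l * x) * (l * 1)) x :=
    ((hasDerivAt_id x).const_mul l).exp
  have h3 := h2.mul h1
  have h4 : KB l h = fun z => Real.exp (l * z) *
      ((∫ y in Set.Ioi x, Real.exp (-(l * y)) * h y) - ∫ y in x..z, Real.exp (-(l * y)) * h y) :=
    funext hF
  have hx := hF x
  rw [h4]
  refine h3.congr_deriv ?_
  beta_reduce
  have e1 : Real.exp (l * x) * Real.exp (-(l * x)) = 1 := by rw [← Real.exp_add]; simp
  rw [intervalIntegral.integral_same, sub_zero]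
  linear_combination (-h x) * e1

lemma hasDerivAt_KP {l : ℝ} {h : ℝ → ℝ} (hc : Continuous h) (hh : KI l h) (x : ℝ) :
    HasDerivAt (KP l h) (KD l h x) x := by
  have : KP l h = fun z => KA l h z + KB l h z := funext fun z => KP_eq hh z
  rw [this]
  refine ((hasDerivAt_KA hc hh x).add (hasDerivAt_KB hc hh x)).congr_deriv ?_
  unfold KD; ring

lemma hasDerivAt_KD {l : ℝ} {h : ℝ → ℝ} (hc : Continuous h) (hh : KI l h) (x : ℝ) :
    HasDerivAt (KD l h) (l ^ 2 * KP l h x - 2 * l * h x) x := by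
  unfold KD
  refine (((hasDerivAt_KB hc hh x).sub (hasDerivAt_KA hc hh x)).const_mul l).congr_deriv ?_
  rw [KP_eq hh]; ring

lemma continuous_KP {l : ℝ} {h : ℝ → ℝ} (hc : Continuous h) (hh : KI l h) : Continuous (KP l h) :=
  continuous_iff_continuousAt.2 fun x => (hasDerivAt_KP hc hh x).continuousAt

lemma continuous_KD {l : ℝ} {h : ℝ → ℝ} (hc : Continuous h) (hh : KI l h) : Continuous (KD l h) :=
  continuous_iff_continuousAt.2 fun x => (hasDerivAt_KD hc hh x).continuousAt

lemma integrable_ker0 {l : ℝ} (hl : 0 < l) : Integrable (fun y : ℝ => Real.exp (-(l * |y|))) := by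
  rw [← integrableOn_univ, ← Set.Iic_union_Ioi (a := (0:ℝ))]
  refine IntegrableOn.union ?_ ?_
  · refine IntegrableOn.congr_fun (integrableOn_exp_mul_Iic hl 0) ?_ measurableSet_Iic
    intro y hy
    have : |y| = -y := abs_of_nonpos hy
    simp [this]
  · refine IntegrableOn.congr_fun (integrableOn_exp_mul_Ioi (a := -l) (by linarith) 0) ?_
      measurableSet_Ioi
    intro y hy
    have : |y| = y := abs_of_pos hy
    simp [this]

lemma integral_ker0 {l : ℝ} (hl : 0 < l) : ∫ y : ℝ, Real.exp (-(l * |y|)) = 2 / l := by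
  rw [integral_comp_abs (f := fun y => Real.exp (-(l * y)))]
  have := integral_exp_mul_Ioi (a := -l) (by linarith) 0
  simp only [neg_mul] at this
  rw [this]; field_simp; simp

lemma KI_one {l : ℝ} (hl : 0 < l) : KI l (fun _ => 1) := by
  intro x
  have := (integrable_ker0 hl).comp_sub_left x
  simpa using this

lemma KP_one {l : ℝ} (hl : 0 < l) (x : ℝ) : KP l (fun _ => 1) x = 2 / l := by
  unfold KP
  simp only [mul_one]
  rw [integral_sub_left_eq_self (fun y => Real.exp (-(l * |y|))) volume x, integral_ker0 hl]

lemma ker_le_one {l : ℝ} (hl : 0 < l) (x y : ℝ) : Real.exp (-(l * |x - y|)) ≤ 1 := by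
  rw [Real.exp_le_one_iff]
  have := abs_nonneg (x - y)
  nlinarith

lemma KI_of_integrable {l : ℝ} (hl : 0 < l) {h : ℝ → ℝ} (hh : Integrable h) : KI l h := by
  intro x
  refine hh.bdd_mul (c := 1) ?_ ?_
  · exact (by fun_prop : Continuous fun y => Real.exp (-(l * |x - y|))).aestronglyMeasurable
  · refine Filter.Eventually.of_forall fun y => ?_
    rw [Real.norm_eq_abs, abs_of_pos (Real.exp_pos _)]
    exact ker_le_one hl x y

lemma KI.add {l : ℝ} {h k : ℝ → ℝ} (hh : KI l h) (hk : KI l k) : KI l (fun y => h y + k y) := by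
  intro x
  refine ((hh x).add (hk x)).congr (Filter.Eventually.of_forall fun y => ?_)
  simp only [Pi.add_apply]; ring

lemma KI.const_mul {l : ℝ} {h : ℝ → ℝ} (hh : KI l h) (c : ℝ) : KI l (fun y => c * h y) := by
  intro x
  refine ((hh x).const_mul c).congr (Filter.Eventually.of_forall fun y => ?_)
  simp only; ring

lemma KP_add {l : ℝ} {h k : ℝ → ℝ} (hh : KI l h) (hk : KI l k) (x : ℝ) :
    KP l (fun y => h y + k y) x = KP l h x + KP l k x := by
  unfold KP
  rw [← integral_add (hh x) (hk x)]
  simp [mul_add]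

lemma KP_const_mul {l : ℝ} {h : ℝ → ℝ} (c x : ℝ) :
    KP l (fun y => c * h y) x = c * KP l h x := by
  unfold KP
  rw [← integral_const_mul]
  congr 1; ext y; ring

/-- domination criterion -/
lemma KI_of_le {l : ℝ} {h k : ℝ → ℝ} (hc : Continuous h) (hk : KI l k) (hle : ∀ y, |h y| ≤ k y) :
    KI l h := by
  intro x
  refine (hk x).mono' ?_ ?_
  · exact (by fun_prop : Continuous fun y => Real.exp (-(l * |x - y|)) * h y).aestronglyMeasurable
  · refine Filter.Eventually.of_forall fun y => ?_
    rw [Real.norm_eq_abs, abs_mul, abs_of_pos (Real.exp_pos _)]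
    exact mul_le_mul_of_nonneg_left (hle y) (Real.exp_pos _).le

lemma KP_le_integral {l : ℝ} (hl : 0 < l) {h : ℝ → ℝ} (hh : Integrable h) (h0 : ∀ y, 0 ≤ h y)
    (x : ℝ) : KP l h x ≤ ∫ y, h y := by
  unfold KP
  refine integral_mono (KI_of_integrable hl hh x) hh ?_
  intro y
  have := ker_le_one hl x y
  have := h0 y
  simp only
  nlinarith

lemma integrable_KP {l : ℝ} (hl : 0 < l) {h : ℝ → ℝ} (hh : Integrable h) :
    Integrable (KP l h) ∧ ∫ x, KP l h x = (2 / l) * ∫ y, h y := by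
  have hk := integrable_ker0 hl
  have e : KP l h = MeasureTheory.convolution h (fun y : ℝ => Real.exp (-(l * |y|)))
      (ContinuousLinearMap.mul ℝ ℝ) volume := by
    ext x
    unfold KP MeasureTheory.convolution
    congr 1; ext y; simp [mul_comm]
  constructor
  · rw [e]
    exact hh.integrable_convolution _ hk
  · rw [e, integral_convolution _ hh hk, integral_ker0 hl]
    simp [mul_comm]

/-- Cauchy-Schwarz for the kernel operator -/
lemma KP_sq_le {l : ℝ} (hl : 0 < l) {h : ℝ → ℝ} (hc : Continuous h)
    (h2 : Integrable (fun y => h y ^ 2)) (x : ℝ) :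
    (KP l (fun y => |h y|) x) ^ 2 ≤ (2 / l) * KP l (fun y => h y ^ 2) x := by
  have hi2 := KI_of_integrable hl h2
  set X := KP l (fun y => |h y|) x with hX
  have hX0 : 0 ≤ X := KP_nonneg (fun y => abs_nonneg _) x
  have hY0 : 0 ≤ KP l (fun y => h y ^ 2) x := KP_nonneg (fun y => sq_nonneg _) x
  have hiabs : KI l (fun y => |h y|) := by
    refine KI_of_le (by fun_prop) ((KI_one hl).add hi2) fun y => ?_
    rw [abs_abs]
    nlinarith [sq_nonneg (|h y| - 1), sq_abs (h y), abs_nonneg (h y)]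
  rcases hX0.eq_or_lt with h0 | h0
  · rw [← h0]
    have : 0 ≤ 2 / l := by positivity
    have := mul_nonneg this hY0
    simpa using this
  set s := l * X / 2 with hs
  have hs0 : 0 < s := by positivity
  have key : X ≤ (s / 2) * (2 / l) + (1 / (2 * s)) * KP l (fun y => h y ^ 2) x := by
    rw [← KP_one hl x, ← KP_const_mul, ← KP_const_mul, ← KP_add]
    · refine KP_mono hiabs (((KI_one hl).const_mul _).add (hi2.const_mul _)) (fun y => ?_) x
      have : (s / 2 * 1 + 1 / (2 * s) * h y ^ 2) - |h y| = (|h y| - s) ^ 2 / (2 * s) := by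
        rw [← sq_abs (h y)]
        field_simp
        ring
      have h3 : 0 ≤ (|h y| - s) ^ 2 / (2 * s) := by positivity
      linarith
    · exact (KI_one hl).const_mul _
    · exact hi2.const_mul _
  have e1 : (s / 2) * (2 / l) = X / 2 := by rw [hs]; field_simp
  have e2 : (1 / (2 * s)) = 1 / (l * X) := by rw [hs]; field_simp
  rw [e1, e2] at key
  have : X / 2 * (2 * X) ≤ (1 / (l * X) * KP l (fun y => h y ^ 2) x) * (2 * X) := by
    gcongr; linarith
  have e3 : (1 / (l * X) * KP l (fun y => h y ^ 2) x) * (2 * X)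
      = (2 / l) * KP l (fun y => h y ^ 2) x := by field_simp
  rw [e3] at this
  linarith


/-! ### Part 2: static facts -/

/-- nonlocal nonlinearity -/
def gg (κ : ℝ) (w : ℝ → ℝ) (z : ℝ) : ℝ := (3/2) * (w z)^2 + 2*κ*(w z)

/-- pressure -/
def PP (κ : ℝ) (w : ℝ → ℝ) (x : ℝ) : ℝ := (1/2) * KP 1 (gg κ w) x

/-- pressure gradient -/
def ff (κ : ℝ) (w : ℝ → ℝ) (x : ℝ) : ℝ := (1/2) * KD 1 (gg κ w) x

/-- the auxiliary potential -/
def vv (w : ℝ → ℝ) (x : ℝ) : ℝ := (1/4) * KP 2 w x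

/-- derivative of the auxiliary potential -/
def vd (w : ℝ → ℝ) (x : ℝ) : ℝ := (1/4) * KD 2 w x

/-- the conserved quadratic form -/
def QQ (w : ℝ → ℝ) : ℝ := (∫ x, w x ^ 2) - 3 * ∫ x, w x * vv w x

/-- uniform bound constant -/
def CC (κ N : ℝ) : ℝ := (3/4) * N + κ * (1 + N)

lemma CC_nonneg {κ N : ℝ} (hκ : 0 ≤ κ) (hN : 0 ≤ N) : 0 ≤ CC κ N := by
  unfold CC; positivity

lemma integrable_mul_of_sq {f g : ℝ → ℝ} (hf : Continuous f) (hg : Continuous g)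
    (hf2 : Integrable (fun x => f x ^ 2)) (hg2 : Integrable (fun x => g x ^ 2)) :
    Integrable (fun x => f x * g x) := by
  refine (hf2.add hg2).mono' (by fun_prop : Continuous _).aestronglyMeasurable ?_
  refine Filter.Eventually.of_forall fun x => ?_
  rw [Real.norm_eq_abs, abs_mul]
  simp only [Pi.add_apply]
  nlinarith [sq_nonneg (|f x| - |g x|), sq_abs (f x), sq_abs (g x), abs_nonneg (f x),
    abs_nonneg (g x)]

lemma KI_abs_of_sq {l : ℝ} (hl : 0 < l) {w : ℝ → ℝ} (hc : Continuous w)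
    (h2 : Integrable (fun y => w y ^ 2)) : KI l (fun y => |w y|) := by
  refine KI_of_le (by fun_prop) ((KI_one hl).add (KI_of_integrable hl h2)) fun y => ?_
  rw [abs_abs]
  nlinarith [sq_nonneg (|w y| - 1), sq_abs (w y), abs_nonneg (w y)]

lemma KI_of_sq {l : ℝ} (hl : 0 < l) {w : ℝ → ℝ} (hc : Continuous w)
    (h2 : Integrable (fun y => w y ^ 2)) : KI l w :=
  KI_of_le hc (KI_abs_of_sq hl hc h2) fun _ => le_rfl

lemma continuous_gg {κ : ℝ} {w : ℝ → ℝ} (hc : Continuous w) : Continuous (gg κ w) := by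
  unfold gg; fun_prop

lemma KI_gg {κ : ℝ} {w : ℝ → ℝ} (hc : Continuous w)
    (h2 : Integrable (fun y => w y ^ 2)) : KI 1 (gg κ w) :=
  ((KI_of_integrable one_pos h2).const_mul _).add ((KI_of_sq one_pos hc h2).const_mul _)

lemma convol_pker_eq (κ : ℝ) (w : ℝ → ℝ) :
    convol pker (fun z => (3/2) * (w z)^2 + 2*κ*(w z)) = PP κ w := by
  ext x
  unfold convol PP KP gg pker
  rw [← integral_const_mul]
  congr 1; ext y
  rw [one_mul]; ring

lemma hasDerivAt_PP {κ : ℝ} {w : ℝ → ℝ} (hc : Continuous w)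
    (h2 : Integrable (fun y => w y ^ 2)) (x : ℝ) : HasDerivAt (PP κ w) (ff κ w x) x :=
  (hasDerivAt_KP (continuous_gg hc) (KI_gg hc h2) x).const_mul _

lemma hasDerivAt_ff {κ : ℝ} {w : ℝ → ℝ} (hc : Continuous w)
    (h2 : Integrable (fun y => w y ^ 2)) (x : ℝ) :
    HasDerivAt (ff κ w) (PP κ w x - gg κ w x) x := by
  refine ((hasDerivAt_KD (continuous_gg hc) (KI_gg hc h2) x).const_mul (1/2)).congr_deriv ?_
  unfold PP; ring

lemma continuous_PP {κ : ℝ} {w : ℝ → ℝ} (hc : Continuous w)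
    (h2 : Integrable (fun y => w y ^ 2)) : Continuous (PP κ w) :=
  continuous_iff_continuousAt.2 fun x => (hasDerivAt_PP hc h2 x).continuousAt

lemma continuous_ff {κ : ℝ} {w : ℝ → ℝ} (hc : Continuous w)
    (h2 : Integrable (fun y => w y ^ 2)) : Continuous (ff κ w) :=
  continuous_iff_continuousAt.2 fun x => (hasDerivAt_ff hc h2 x).continuousAt

lemma hasDerivAt_vv {w : ℝ → ℝ} (hc : Continuous w)
    (h2 : Integrable (fun y => w y ^ 2)) (x : ℝ) : HasDerivAt (vv w) (vd w x) x :=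
  (hasDerivAt_KP hc (KI_of_sq two_pos hc h2) x).const_mul _

lemma hasDerivAt_vd {w : ℝ → ℝ} (hc : Continuous w)
    (h2 : Integrable (fun y => w y ^ 2)) (x : ℝ) : HasDerivAt (vd w) (4 * vv w x - w x) x := by
  refine ((hasDerivAt_KD hc (KI_of_sq two_pos hc h2) x).const_mul (1/4)).congr_deriv ?_
  unfold vv; ring

lemma continuous_vv {w : ℝ → ℝ} (hc : Continuous w)
    (h2 : Integrable (fun y => w y ^ 2)) : Continuous (vv w) :=
  continuous_iff_continuousAt.2 fun x => (hasDerivAt_vv hc h2 x).continuousAt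

lemma continuous_vd {w : ℝ → ℝ} (hc : Continuous w)
    (h2 : Integrable (fun y => w y ^ 2)) : Continuous (vd w) :=
  continuous_iff_continuousAt.2 fun x => (hasDerivAt_vd hc h2 x).continuousAt

/-- sup bound of the kernel of `|w|` -/
lemma KP_abs_bound {l : ℝ} (hl : 1 ≤ l) {w : ℝ → ℝ} (hc : Continuous w)
    (h2 : Integrable (fun y => w y ^ 2)) {N : ℝ} (hN : ∫ y, w y ^ 2 ≤ N) (x : ℝ) :
    KP l (fun y => |w y|) x ≤ 1 + N := by
  have hl0 : 0 < l := by linarith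
  have h1 := KP_sq_le hl0 hc h2 x
  have h3 := KP_le_integral hl0 h2 (fun y => sq_nonneg _) x
  have h4 : 0 ≤ KP l (fun y => w y ^ 2) x := KP_nonneg (fun y => sq_nonneg _) x
  have h5 : 2 / l ≤ 2 := by rw [div_le_iff₀ hl0]; linarith
  have h6 : (2 / l) * KP l (fun y => w y ^ 2) x ≤ 2 * KP l (fun y => w y ^ 2) x := by gcongr
  nlinarith

lemma KP_gg_le {κ : ℝ} (hκ : 0 ≤ κ) {w : ℝ → ℝ} (hc : Continuous w)
    (h2 : Integrable (fun y => w y ^ 2)) (x : ℝ) :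
    KP 1 (fun y => |gg κ w y|) x ≤
      (3/2) * KP 1 (fun y => w y ^ 2) x + 2 * κ * KP 1 (fun y => |w y|) x := by
  rw [← KP_const_mul, ← KP_const_mul, ← KP_add]
  · refine KP_mono (KI_gg hc h2).abs (((KI_of_integrable one_pos h2).const_mul _).add
      ((KI_abs_of_sq one_pos hc h2).const_mul _)) (fun y => ?_) x
    unfold gg
    refine (abs_add_le _ _).trans (le_of_eq ?_)
    rw [abs_mul, abs_mul, abs_of_nonneg (by positivity : 0 ≤ w y ^ 2),
      abs_of_nonneg (by positivity : 0 ≤ 2 * κ), abs_of_pos (by norm_num : (0:ℝ) < 3/2)]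
  · exact (KI_of_integrable one_pos h2).const_mul _
  · exact (KI_abs_of_sq one_pos hc h2).const_mul _

lemma KP_gg_bound {κ : ℝ} (hκ : 0 ≤ κ) {w : ℝ → ℝ} (hc : Continuous w)
    (h2 : Integrable (fun y => w y ^ 2)) {N : ℝ} (hN : ∫ y, w y ^ 2 ≤ N) (x : ℝ) :
    (1/2) * KP 1 (fun y => |gg κ w y|) x ≤ CC κ N := by
  have h1 := KP_gg_le hκ hc h2 x
  have h3 := KP_abs_bound le_rfl hc h2 hN x
  have h4 := (KP_le_integral one_pos h2 (fun y => sq_nonneg _) x).trans hN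
  unfold CC
  have := mul_le_mul_of_nonneg_left h3 hκ
  nlinarith

lemma PP_abs_le {κ : ℝ} (w : ℝ → ℝ) (x : ℝ) :
    |PP κ w x| ≤ (1/2) * KP 1 (fun y => |gg κ w y|) x := by
  unfold PP
  rw [abs_mul, abs_of_pos (by norm_num : (0:ℝ) < 1/2)]
  have := KP_abs_le (l := 1) (h := gg κ w) x
  linarith

lemma ff_abs_le {κ : ℝ} {w : ℝ → ℝ} (hc : Continuous w)
    (h2 : Integrable (fun y => w y ^ 2)) (x : ℝ) :
    |ff κ w x| ≤ (1/2) * KP 1 (fun y => |gg κ w y|) x := by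
  unfold ff
  rw [abs_mul, abs_of_pos (by norm_num : (0:ℝ) < 1/2)]
  have := KD_abs_le (zero_le_one) (KI_gg (κ := κ) hc h2) x
  linarith

lemma PP_bound {κ : ℝ} (hκ : 0 ≤ κ) {w : ℝ → ℝ} (hc : Continuous w)
    (h2 : Integrable (fun y => w y ^ 2)) {N : ℝ} (hN : ∫ y, w y ^ 2 ≤ N) (x : ℝ) :
    |PP κ w x| ≤ CC κ N := (PP_abs_le w x).trans (KP_gg_bound hκ hc h2 hN x)

lemma ff_bound {κ : ℝ} (hκ : 0 ≤ κ) {w : ℝ → ℝ} (hc : Continuous w)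
    (h2 : Integrable (fun y => w y ^ 2)) {N : ℝ} (hN : ∫ y, w y ^ 2 ≤ N) (x : ℝ) :
    |ff κ w x| ≤ CC κ N := (ff_abs_le hc h2 x).trans (KP_gg_bound hκ hc h2 hN x)

/-- L² domination constant -/
def C2 (κ N : ℝ) : ℝ := (9/2) * N + 16 * κ ^ 2

lemma KP_gg_sq_le {κ : ℝ} (hκ : 0 ≤ κ) {w : ℝ → ℝ} (hc : Continuous w)
    (h2 : Integrable (fun y => w y ^ 2)) {N : ℝ} (hN : ∫ y, w y ^ 2 ≤ N) (x : ℝ) :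
    (KP 1 (fun y => |gg κ w y|) x) ^ 2 ≤ C2 κ N * KP 1 (fun y => w y ^ 2) x := by
  have h1 := KP_gg_le hκ hc h2 x
  have h4 := (KP_le_integral one_pos h2 (fun y => sq_nonneg _) x).trans hN
  have h3 := KP_sq_le one_pos hc h2 x
  have h0 : 0 ≤ KP 1 (fun y => |gg κ w y|) x := KP_nonneg (fun y => abs_nonneg _) x
  set a := KP 1 (fun y => w y ^ 2) x
  set b := KP 1 (fun y => |w y|) x
  set c := KP 1 (fun y => |gg κ w y|) x
  have ha : 0 ≤ a := KP_nonneg (fun y => sq_nonneg _) x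
  have hb : 0 ≤ b := KP_nonneg (fun y => abs_nonneg _) x
  have h5 : c ^ 2 ≤ ((3/2) * a + 2 * κ * b) ^ 2 := by gcongr
  have h6 : ((3/2) * a + 2 * κ * b) ^ 2 ≤ 2 * ((3/2)*a)^2 + 2 * (2*κ*b)^2 := by
    nlinarith [sq_nonneg ((3/2) * a - 2 * κ * b)]
  have h7 : κ ^ 2 * b ^ 2 ≤ κ ^ 2 * (2 / 1 * a) := by gcongr
  have h8 : a * a ≤ N * a := by gcongr
  unfold C2
  nlinarith

lemma integrable_sq_of_le {f k : ℝ → ℝ} (hf : Continuous f) (hk : Integrable k)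
    (hle : ∀ x, f x ^ 2 ≤ k x) : Integrable (fun x => f x ^ 2) := by
  refine hk.mono' (by fun_prop : Continuous _).aestronglyMeasurable ?_
  refine Filter.Eventually.of_forall fun x => ?_
  rw [Real.norm_eq_abs, abs_of_nonneg (sq_nonneg _)]
  exact hle x

lemma sq_le_of_abs_le {a b : ℝ} (h : |a| ≤ b) : a ^ 2 ≤ b ^ 2 := by
  rw [← sq_abs]
  exact pow_le_pow_left₀ (abs_nonneg _) h 2

lemma PP_sq_int {κ : ℝ} (hκ : 0 ≤ κ) {w : ℝ → ℝ} (hc : Continuous w)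
    (h2 : Integrable (fun y => w y ^ 2)) : Integrable (fun x => PP κ w x ^ 2) := by
  refine integrable_sq_of_le (continuous_PP hc h2)
    ((integrable_KP one_pos h2).1.const_mul (C2 κ (∫ y, w y ^ 2))) fun x => ?_
  have h1 := sq_le_of_abs_le (PP_abs_le (κ := κ) w x)
  have h3 := KP_gg_sq_le hκ hc h2 le_rfl x
  nlinarith [sq_nonneg (KP 1 (fun y => |gg κ w y|) x)]

lemma ff_sq_int {κ : ℝ} (hκ : 0 ≤ κ) {w : ℝ → ℝ} (hc : Continuous w)
    (h2 : Integrable (fun y => w y ^ 2)) : Integrable (fun x => ff κ w x ^ 2) := by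
  refine integrable_sq_of_le (continuous_ff hc h2)
    ((integrable_KP one_pos h2).1.const_mul (C2 κ (∫ y, w y ^ 2))) fun x => ?_
  have h1 := sq_le_of_abs_le (ff_abs_le (κ := κ) hc h2 x)
  have h3 := KP_gg_sq_le hκ hc h2 le_rfl x
  nlinarith [sq_nonneg (KP 1 (fun y => |gg κ w y|) x)]

lemma vv_abs_le (w : ℝ → ℝ) (x : ℝ) : |vv w x| ≤ (1/2) * KP 2 (fun y => |w y|) x := by
  unfold vv
  rw [abs_mul, abs_of_pos (by norm_num : (0:ℝ) < 1/4)]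
  have := KP_abs_le (l := 2) (h := w) x
  have h0 : 0 ≤ KP 2 (fun y => |w y|) x := KP_nonneg (fun y => abs_nonneg _) x
  linarith

lemma vd_abs_le {w : ℝ → ℝ} (hw : KI 2 w) (x : ℝ) :
    |vd w x| ≤ (1/2) * KP 2 (fun y => |w y|) x := by
  unfold vd
  rw [abs_mul, abs_of_pos (by norm_num : (0:ℝ) < 1/4)]
  have := KD_abs_le zero_le_two hw x
  linarith

/-- dominating function for the potential and its derivative -/
def bb (w : ℝ → ℝ) (x : ℝ) : ℝ := (1/2) * KP 2 (fun y => |w y|) x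

lemma bb_nonneg (w : ℝ → ℝ) (x : ℝ) : 0 ≤ bb w x :=
  mul_nonneg (by norm_num) (KP_nonneg (fun y => abs_nonneg _) x)

lemma bb_sq_le {w : ℝ → ℝ} (hc : Continuous w)
    (h2 : Integrable (fun y => w y ^ 2)) (x : ℝ) :
    bb w x ^ 2 ≤ (1/4) * KP 2 (fun y => w y ^ 2) x := by
  have := KP_sq_le two_pos hc h2 x
  unfold bb
  nlinarith

lemma continuous_bb {w : ℝ → ℝ} (hc : Continuous w)
    (h2 : Integrable (fun y => w y ^ 2)) : Continuous (bb w) :=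
  (continuous_KP (by fun_prop) (KI_abs_of_sq two_pos hc h2)).const_mul _

lemma bb_sq_int {w : ℝ → ℝ} (hc : Continuous w)
    (h2 : Integrable (fun y => w y ^ 2)) : Integrable (fun x => bb w x ^ 2) :=
  integrable_sq_of_le (continuous_bb hc h2)
    ((integrable_KP two_pos h2).1.const_mul _) (bb_sq_le hc h2)

lemma bb_sq_integral_le {w : ℝ → ℝ} (hc : Continuous w)
    (h2 : Integrable (fun y => w y ^ 2)) : ∫ x, bb w x ^ 2 ≤ ∫ x, w x ^ 2 := by
  have h1 : ∫ x, bb w x ^ 2 ≤ ∫ x, (1/4) * KP 2 (fun y => w y ^ 2) x :=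
    integral_mono (bb_sq_int hc h2) ((integrable_KP two_pos h2).1.const_mul _) (bb_sq_le hc h2)
  rw [integral_const_mul, (integrable_KP two_pos h2).2] at h1
  have h3 : 0 ≤ ∫ x, w x ^ 2 := integral_nonneg fun x => sq_nonneg _
  linarith

lemma bb_le {w : ℝ → ℝ} (hc : Continuous w)
    (h2 : Integrable (fun y => w y ^ 2)) {N : ℝ} (hN : ∫ y, w y ^ 2 ≤ N) (x : ℝ) :
    bb w x ≤ 1 + N := by
  have := KP_abs_bound one_le_two hc h2 hN x
  have h0 := bb_nonneg w x
  unfold bb at *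
  linarith

lemma pi_sq_integral_le {κ : ℝ} (hκ : 0 ≤ κ) {w : ℝ → ℝ} (hc : Continuous w)
    (h2 : Integrable (fun y => w y ^ 2)) {N : ℝ} (hN : ∫ y, w y ^ 2 ≤ N) :
    Integrable (fun x => ((1/2) * KP 1 (fun y => |gg κ w y|) x) ^ 2) ∧
    ∫ x, ((1/2) * KP 1 (fun y => |gg κ w y|) x) ^ 2 ≤ C2 κ N * N := by
  have hcon : Continuous (fun x => (1/2) * KP 1 (fun y => |gg κ w y|) x) :=
    (continuous_KP (by have := continuous_gg (κ := κ) hc; fun_prop)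
      (KI_gg hc h2).abs).const_mul _
  have hle : ∀ x, ((1/2) * KP 1 (fun y => |gg κ w y|) x) ^ 2 ≤
      (1/4 * C2 κ N) * KP 1 (fun y => w y ^ 2) x := fun x => by
    have := KP_gg_sq_le hκ hc h2 hN x
    nlinarith
  have hi := integrable_sq_of_le hcon ((integrable_KP one_pos h2).1.const_mul _) hle
  refine ⟨hi, ?_⟩
  have h1 := integral_mono hi ((integrable_KP one_pos h2).1.const_mul (1/4 * C2 κ N)) hle
  rw [integral_const_mul, (integrable_KP one_pos h2).2] at h1
  have h3 : 0 ≤ ∫ x, w x ^ 2 := integral_nonneg fun x => sq_nonneg _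
  have h4 : 0 ≤ C2 κ N := by unfold C2; have := h3.trans hN; positivity
  have h5 := mul_le_mul_of_nonneg_left hN h4
  have h6 := mul_nonneg h4 h3
  nlinarith

lemma vv_sq_int {w : ℝ → ℝ} (hc : Continuous w)
    (h2 : Integrable (fun y => w y ^ 2)) : Integrable (fun x => vv w x ^ 2) :=
  integrable_sq_of_le (continuous_vv hc h2) (bb_sq_int hc h2)
    fun x => sq_le_of_abs_le (vv_abs_le w x)

lemma vd_sq_int {w : ℝ → ℝ} (hc : Continuous w)
    (h2 : Integrable (fun y => w y ^ 2)) : Integrable (fun x => vd w x ^ 2) :=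
  integrable_sq_of_le (continuous_vd hc h2) (bb_sq_int hc h2)
    fun x => sq_le_of_abs_le (vd_abs_le (KI_of_sq two_pos hc h2) x)

lemma sq_mul_vd_int {w : ℝ → ℝ} (hc : Continuous w)
    (h2 : Integrable (fun y => w y ^ 2)) : Integrable (fun x => w x ^ 2 * vd w x) := by
  refine (h2.mul_const (1 + ∫ y, w y ^ 2)).mono' ?_ ?_
  · have := continuous_vd hc h2
    exact (by fun_prop : Continuous _).aestronglyMeasurable
  · refine Filter.Eventually.of_forall fun x => ?_
    rw [Real.norm_eq_abs, abs_mul, abs_of_nonneg (sq_nonneg (w x))]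
    gcongr
    exact (vd_abs_le (KI_of_sq two_pos hc h2) x).trans (bb_le hc h2 le_rfl x)

/-- the static identity behind conservation of `QQ` -/
lemma static_identity {κ : ℝ} (hκ : 0 ≤ κ) {w : ℝ → ℝ} (hc : Continuous w)
    (h2 : Integrable (fun y => w y ^ 2)) :
    ∫ x, (-(2 * (w x * ff κ w x)) - 6 * ((w x ^ 2 / 2 + PP κ w x) * vd w x)) = 0 := by
  have cP := continuous_PP (κ := κ) hc h2
  have cf := continuous_ff (κ := κ) hc h2
  have cv := continuous_vv hc h2
  have cd := continuous_vd hc h2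
  have iP := PP_sq_int hκ hc h2
  have jf := ff_sq_int hκ hc h2
  have iv := vv_sq_int hc h2
  have idd := vd_sq_int hc h2
  refine integral_eq_zero_of_hasDerivAt_of_integrable
    (f := fun x => -(2 * (4 * (vv w x * PP κ w x) - vd w x * ff κ w x))
      + 4 * κ * (2 * vv w x ^ 2 - vd w x ^ 2 / 2)) ?_ ?_ ?_
  · intro x
    have d1 := hasDerivAt_vv hc h2 x
    have d2 := hasDerivAt_vd hc h2 x
    have d3 := hasDerivAt_PP (κ := κ) hc h2 x
    have d4 := hasDerivAt_ff (κ := κ) hc h2 x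
    refine (((((d1.mul d3).const_mul 4).sub (d2.mul d4)).const_mul 2).neg.add
      (((d1.pow 2).const_mul 2).sub ((d2.pow 2).div_const 2) |>.const_mul (4 * κ))).congr_deriv ?_
    unfold gg
    push_cast
    ring
  · have i1 := integrable_mul_of_sq hc cf h2 jf
    have i2 := sq_mul_vd_int hc h2
    have i3 := integrable_mul_of_sq cP cd iP idd
    refine ((i1.const_mul (-2)).add ((i2.const_mul (-3)).add (i3.const_mul (-6)))).congr
      (Filter.Eventually.of_forall fun x => ?_)
    simp only [Pi.add_apply]; ring
  · have i1 := integrable_mul_of_sq cv cP iv iP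
    have i2 := integrable_mul_of_sq cd cf idd jf
    refine ((i1.const_mul (-8)).add ((i2.const_mul 2).add ((iv.const_mul (8*κ)).add
      (idd.const_mul (-2*κ))))).congr (Filter.Eventually.of_forall fun x => ?_)
    simp only [Pi.add_apply]; ring

lemma integral_w_vv {w : ℝ → ℝ} (hc : Continuous w)
    (h2 : Integrable (fun y => w y ^ 2)) :
    ∫ x, w x * vv w x = 4 * (∫ x, vv w x ^ 2) + ∫ x, vd w x ^ 2 := by
  have cv := continuous_vv hc h2
  have cd := continuous_vd hc h2
  have iv := vv_sq_int hc h2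
  have idd := vd_sq_int hc h2
  have i1 := integrable_mul_of_sq hc cv h2 iv
  have hz : ∫ x, (vd w x ^ 2 + (4 * vv w x ^ 2 - w x * vv w x)) = 0 := by
    refine integral_eq_zero_of_hasDerivAt_of_integrable (f := fun x => vd w x * vv w x) ?_ ?_ ?_
    · intro x
      refine ((hasDerivAt_vd hc h2 x).mul (hasDerivAt_vv hc h2 x)).congr_deriv ?_
      ring
    · exact idd.add ((iv.const_mul 4).sub i1)
    · exact integrable_mul_of_sq cd cv idd iv
  have i3 : Integrable (fun x => 4 * vv w x ^ 2 - w x * vv w x) := (iv.const_mul 4).sub i1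
  rw [integral_add idd i3, integral_sub (iv.const_mul 4) i1,
    integral_const_mul] at hz
  linarith

lemma QQ_le {w : ℝ → ℝ} (hc : Continuous w)
    (h2 : Integrable (fun y => w y ^ 2)) : QQ w ≤ ∫ x, w x ^ 2 := by
  unfold QQ
  rw [integral_w_vv hc h2]
  have h3 : 0 ≤ ∫ x, vv w x ^ 2 := integral_nonneg fun x => sq_nonneg _
  have h4 : 0 ≤ ∫ x, vd w x ^ 2 := integral_nonneg fun x => sq_nonneg _
  linarith

lemma QQ_ge {w : ℝ → ℝ} (hc : Continuous w)
    (h2 : Integrable (fun y => w y ^ 2)) : ∫ x, w x ^ 2 ≤ 4 * QQ w := by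
  have h := integral_w_vv hc h2
  have iv := vv_sq_int hc h2
  have cv := continuous_vv hc h2
  have h4 : 0 ≤ ∫ x, vd w x ^ 2 := integral_nonneg fun x => sq_nonneg _
  have h5 : ∫ x, w x * vv w x ≤ ∫ x, ((1/8) * w x ^ 2 + 2 * vv w x ^ 2) := by
    refine integral_mono (integrable_mul_of_sq hc cv h2 iv)
      ((h2.const_mul _).add (iv.const_mul _)) fun x => ?_
    simp only
    nlinarith [sq_nonneg (w x - 4 * vv w x)]
  rw [integral_add (h2.const_mul _) (iv.const_mul _), integral_const_mul, integral_const_mul] at h5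
  unfold QQ
  linarith


/-! ### Part 3: maximum principles for the transport equation -/

lemma left_deriv_nonneg {f : ℝ → ℝ} {f' t s0 : ℝ} (hs : s0 < t) (hf : HasDerivAt f f' t)
    (hle : ∀ s ∈ Set.Icc s0 t, f s ≤ f t) : 0 ≤ f' := by
  have h1 := (hasDerivAt_iff_tendsto_slope.1 hf).mono_left
    (nhdsWithin_mono t (fun s (hs : s < t) => ne_of_lt hs) :
      nhdsWithin t (Set.Iio t) ≤ nhdsWithin t {t}ᶜ)
  refine ge_of_tendsto h1 ?_
  have : ∀ᶠ s in nhdsWithin t (Set.Iio t), s ∈ Set.Ioo s0 t := Ioo_mem_nhdsLT hs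
  filter_upwards [this] with s hs
  rw [slope_def_field]
  have := hle s ⟨hs.1.le, hs.2.le⟩
  exact div_nonneg_of_nonpos (by linarith) (by linarith [hs.2])

/-- space-time maximum principle -/
lemma MP {E : Type*} [TopologicalSpace E] {K : Set E} (hK : IsCompact K) {s0 b μ : ℝ}
    {φ φ' : ℝ → E → ℝ}
    (hcont : ContinuousOn (fun p : ℝ × E => φ p.1 p.2) (Set.Icc s0 b ×ˢ K))
    (hder : ∀ t ∈ Set.Ioc s0 b, ∀ p ∈ K, HasDerivAt (fun s => φ s p) (φ' t p) t)
    (hinit : ∀ p ∈ K, φ s0 p ≤ μ)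
    (hmax : ∀ t ∈ Set.Ioc s0 b, ∀ p ∈ K, (∀ q ∈ K, φ t q ≤ φ t p) → μ < φ t p → φ' t p ≤ 0) :
    ∀ t ∈ Set.Icc s0 b, ∀ p ∈ K, φ t p ≤ μ := by
  intro t1 ht1 p1 hp1
  by_contra hcon
  push Not at hcon
  obtain ⟨ε, hε, hε2⟩ : ∃ ε > 0, μ < φ t1 p1 - ε * (t1 - s0) := by
    refine ⟨(φ t1 p1 - μ) / (2 * (t1 - s0 + 1)), ?_, ?_⟩
    · have := ht1.1
      apply div_pos <;> linarith
    · have h1 := ht1.1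
      have h2 : (φ t1 p1 - μ) / (2 * (t1 - s0 + 1)) * (t1 - s0) < φ t1 p1 - μ := by
        rw [div_mul_eq_mul_div, div_lt_iff₀ (by linarith)]
        nlinarith
      linarith
  obtain ⟨⟨t, p⟩, htp, hm⟩ := (isCompact_Icc.prod hK).exists_isMaxOn
    (f := fun q : ℝ × E => φ q.1 q.2 - ε * (q.1 - s0)) ⟨(t1, p1), ht1, hp1⟩
    (hcont.sub (by fun_prop))
  have ht : t ∈ Set.Icc s0 b := htp.1
  have hp : p ∈ K := htp.2
  have hm2 : ∀ s ∈ Set.Icc s0 b, ∀ q ∈ K, φ s q - ε * (s - s0) ≤ φ t p - ε * (t - s0) :=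
    fun s hs q hq => hm (show (s, q) ∈ _ from ⟨hs, hq⟩)
  have h1 := hm2 t1 ht1 p1 hp1
  have hts : s0 < t := by
    rcases ht.1.eq_or_lt with h | h
    · exfalso
      have := hinit p hp
      rw [← h] at h1
      simp only [sub_self, mul_zero, sub_zero] at h1
      linarith
    · exact h
  have h2 := hmax t ⟨hts, ht.2⟩ p hp (fun q hq => by have := hm2 t ht q hq; linarith) (by
    nlinarith)
  have h3 : HasDerivAt (fun s => φ s p - ε * (s - s0)) (φ' t p - ε * 1) t :=
    (hder t ⟨hts, ht.2⟩ p hp).sub (((hasDerivAt_id t).sub_const s0).const_mul ε)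
  have h4 := left_deriv_nonneg hts h3 (fun s hs => hm2 s ⟨hs.1, hs.2.trans ht.2⟩ p hp)
  linarith

/-- abstract transport equation with forcing -/
structure Sol (u f : ℝ → ℝ → ℝ) (I : Set ℝ) (C : ℝ) (L : ℝ → ℝ) : Prop where
  diff : ∀ t ∈ I, ContDiff ℝ 1 (u t)
  eq : ∀ t ∈ I, ∀ x, HasDerivAt (fun s => u s x) (-(u t x * deriv (u t) x) - f t x) t
  fb : ∀ t ∈ I, ∀ x, |f t x| ≤ C
  fl : ∀ t ∈ I, ∀ B, 0 ≤ B → ∀ p q, p ≤ q → (∀ z ∈ Set.Icc p q, |u t z| ≤ B) →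
    |f t q - f t p| ≤ L B * (q - p)
  Cnn : 0 ≤ C
  Lnn : ∀ B, 0 ≤ B → 0 ≤ L B

lemma Sol.mono {u f : ℝ → ℝ → ℝ} {I J : Set ℝ} {C : ℝ} {L : ℝ → ℝ} (h : Sol u f I C L)
    (hJ : J ⊆ I) : Sol u f J C L :=
  ⟨fun t ht => h.diff t (hJ ht), fun t ht => h.eq t (hJ ht), fun t ht => h.fb t (hJ ht),
    fun t ht => h.fl t (hJ ht), h.Cnn, h.Lnn⟩

lemma Sol.rev {u f : ℝ → ℝ → ℝ} {I : Set ℝ} {C : ℝ} {L : ℝ → ℝ} (h : Sol u f I C L) :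
    Sol (fun t x => u (-t) (-x)) (fun t x => -f (-t) (-x)) (Neg.neg ⁻¹' I) C L := by
  refine ⟨fun t ht => ?_, fun t ht x => ?_, fun t ht x => ?_, fun t ht B hB p q hpq hz => ?_,
    h.Cnn, h.Lnn⟩
  · exact (h.diff (-t) ht).comp contDiff_neg
  · have h1 := (h.eq (-t) ht (-x))
    have h2 : HasDerivAt (fun s => u (-s) (-x))
        ((-(u (-t) (-x) * deriv (u (-t)) (-x)) - f (-t) (-x)) * (-1)) t :=
      HasDerivAt.comp t h1 (hasDerivAt_neg t)
    refine h2.congr_deriv ?_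
    rw [deriv_comp_neg]
    ring
  · rw [abs_neg]; exact h.fb _ ht _
  · have := h.fl (-t) ht B hB (-q) (-p) (by linarith) (fun z hz' => by
      have := hz (-z) ⟨by linarith [hz'.2], by linarith [hz'.1]⟩
      simpa using this)
    calc |-f (-t) (-q) - -f (-t) (-p)| = |f (-t) (-p) - f (-t) (-q)| := by congr 1; ring
      _ ≤ _ := this
      _ = _ := by ring

lemma Sol.hasDerivAt_x {u f : ℝ → ℝ → ℝ} {I : Set ℝ} {C : ℝ} {L : ℝ → ℝ} (h : Sol u f I C L)
    {t : ℝ} (ht : t ∈ I) (x : ℝ) : HasDerivAt (u t) (deriv (u t) x) x :=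
  ((h.diff t ht).differentiable one_ne_zero x).hasDerivAt

/-- one-sided sup bound -/
lemma BL_aux {u f : ℝ → ℝ → ℝ} {C : ℝ} {L : ℝ → ℝ} {s0 b p q M σ : ℝ}
    (h : Sol u f (Set.Icc s0 b) C L) (hσ : σ = 1 ∨ σ = -1)
    (hcont : ContinuousOn (fun z : ℝ × ℝ => u z.1 z.2) (Set.Icc s0 b ×ˢ Set.Icc p q))
    (hinit : ∀ x ∈ Set.Icc p q, |u s0 x| ≤ M)
    (hp : ∀ t ∈ Set.Icc s0 b, |u t p| ≤ M) (hq : ∀ t ∈ Set.Icc s0 b, |u t q| ≤ M) :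
    ∀ t ∈ Set.Icc s0 b, ∀ x ∈ Set.Icc p q, σ * u t x - C * (t - s0) ≤ M := by
  have hσu : ∀ z, σ * z ≤ |z| := by
    intro z
    rcases hσ with rfl | rfl
    · simpa using le_abs_self z
    · simpa using neg_le_abs z
  refine MP (φ' := fun t x => σ * (-(u t x * deriv (u t) x) - f t x) - C) isCompact_Icc ?_ ?_ ?_ ?_
  · exact (hcont.const_mul σ |>.sub (by fun_prop))
  · intro t ht x _
    have := ((h.eq t (Set.Ioc_subset_Icc_self ht) x).const_mul σ).sub
      (((hasDerivAt_id t).sub_const s0).const_mul C)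
    refine this.congr_deriv ?_
    ring
  · intro x hx
    have := hσu (u s0 x)
    have := hinit x hx
    simp only [sub_self, mul_zero, sub_zero]
    linarith
  · intro t ht x hx hmx hgt
    have ht' := Set.Ioc_subset_Icc_self ht
    have hC : 0 ≤ C * (t - s0) := mul_nonneg h.Cnn (by linarith [ht.1])
    have hxp : p < x := by
      rcases hx.1.eq_or_lt with e | e
      · exfalso
        have h1 := hp t ht'
        have h2 := hσu (u t x)
        rw [← e] at hgt h2; linarith
      · exact e
    have hxq : x < q := by
      rcases hx.2.eq_or_lt with e | e
      · exfalso
        have h1 := hq t ht'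
        have h2 := hσu (u t x)
        rw [e] at hgt h2; linarith
      · exact e
    have hloc : IsLocalMax (fun y => σ * u t y) x := by
      filter_upwards [Icc_mem_nhds hxp hxq] with y hy
      have := hmx y hy
      linarith
    have h0 := hloc.hasDerivAt_eq_zero ((h.hasDerivAt_x ht' x).const_mul σ)
    have hf := hσu (-f t x)
    rw [abs_neg] at hf
    have hf2 := h.fb t ht' x
    have : σ * (-(u t x * deriv (u t) x) - f t x) - C
        = -(u t x) * (σ * deriv (u t) x) + σ * (-f t x) - C := by ring
    rw [this, h0]; linarith

lemma BL {u f : ℝ → ℝ → ℝ} {C : ℝ} {L : ℝ → ℝ} {s0 b p q M : ℝ}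
    (h : Sol u f (Set.Icc s0 b) C L)
    (hcont : ContinuousOn (fun z : ℝ × ℝ => u z.1 z.2) (Set.Icc s0 b ×ˢ Set.Icc p q))
    (hinit : ∀ x ∈ Set.Icc p q, |u s0 x| ≤ M)
    (hp : ∀ t ∈ Set.Icc s0 b, |u t p| ≤ M) (hq : ∀ t ∈ Set.Icc s0 b, |u t q| ≤ M) :
    ∀ t ∈ Set.Icc s0 b, ∀ x ∈ Set.Icc p q, |u t x| ≤ M + C * (t - s0) := by
  intro t ht x hx
  have h1 := BL_aux h (Or.inl rfl) hcont hinit hp hq t ht x hx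
  have h2 := BL_aux h (Or.inr rfl) hcont hinit hp hq t ht x hx
  rw [abs_le]; constructor <;> linarith

/-- squared positive part -/
def th (s : ℝ) : ℝ := (max s 0) ^ 2

lemma th_nonneg (s : ℝ) : 0 ≤ th s := sq_nonneg _

lemma th_of_nonpos {s : ℝ} (h : s ≤ 0) : th s = 0 := by simp [th, max_eq_right h]

lemma th_of_nonneg {s : ℝ} (h : 0 ≤ s) : th s = s ^ 2 := by simp [th, max_eq_left h]

lemma hasDerivAt_th (s : ℝ) : HasDerivAt th (2 * max s 0) s := by
  rcases lt_trichotomy s 0 with h | h | h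
  · rw [max_eq_right h.le, mul_zero]
    refine (hasDerivAt_const s (0:ℝ)).congr_of_eventuallyEq ?_
    filter_upwards [Iio_mem_nhds h] with z hz
    exact th_of_nonpos (le_of_lt hz)
  · subst h
    rw [max_self, mul_zero, hasDerivAt_iff_isLittleO]
    simp only [sub_zero, smul_zero, th_of_nonpos le_rfl]
    refine Asymptotics.IsLittleO.of_bound fun c hc => ?_
    filter_upwards [Metric.ball_mem_nhds (0:ℝ) hc] with z hz
    rw [Metric.mem_ball, dist_zero_right, Real.norm_eq_abs] at hz
    rw [Real.norm_eq_abs, abs_of_nonneg (th_nonneg z), Real.norm_eq_abs]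
    have h1 : th z ≤ |z| ^ 2 := by
      unfold th
      have : max z 0 ≤ |z| := max_le (le_abs_self z) (abs_nonneg z)
      exact pow_le_pow_left₀ (le_max_right _ _) this 2
    nlinarith [abs_nonneg z]
  · rw [max_eq_left h.le]
    have : HasDerivAt (fun z : ℝ => z ^ 2) (2 * s) s := by simpa using hasDerivAt_pow 2 s
    refine this.congr_of_eventuallyEq ?_
    filter_upwards [Ioi_mem_nhds h] with z hz
    exact th_of_nonneg (le_of_lt hz)

lemma continuous_th : Continuous th := by unfold th; fun_prop


/-! ### Part 4: doubling of variables -/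

/-- doubling function -/
def dbl (u : ℝ → ℝ → ℝ) (σ s0 x0 ρ B lam N0 N1 k : ℝ) (t : ℝ) (p : ℝ × ℝ) : ℝ :=
  Real.exp (-(lam * (t - s0))) * (σ * (u t p.2 - u t p.1) - (N0 + N1 * (t - s0)) * (p.2 - p.1))
    - k * th (x0 - ρ + B * (t - s0) - p.1) - k * th (p.2 - (x0 + ρ - B * (t - s0)))

/-- time derivative of the doubling function -/
def dblt (u f : ℝ → ℝ → ℝ) (σ s0 x0 ρ B lam N0 N1 k : ℝ) (t : ℝ) (p : ℝ × ℝ) : ℝ :=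
  Real.exp (-(lam * (t - s0))) * (-lam) *
      (σ * (u t p.2 - u t p.1) - (N0 + N1 * (t - s0)) * (p.2 - p.1))
    + Real.exp (-(lam * (t - s0))) *
      (σ * ((-(u t p.2 * deriv (u t) p.2) - f t p.2) - (-(u t p.1 * deriv (u t) p.1) - f t p.1))
        - N1 * (p.2 - p.1))
    - k * (2 * max (x0 - ρ + B * (t - s0) - p.1) 0 * B)
    - k * (2 * max (p.2 - (x0 + ρ - B * (t - s0))) 0 * B)

lemma hasDerivAt_dbl {u f : ℝ → ℝ → ℝ} {C : ℝ} {L : ℝ → ℝ} {I : Set ℝ} (h : Sol u f I C L)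
    (σ s0 x0 ρ B lam N0 N1 k : ℝ) {t : ℝ} (ht : t ∈ I) (p : ℝ × ℝ) :
    HasDerivAt (fun s => dbl u σ s0 x0 ρ B lam N0 N1 k s p)
      (dblt u f σ s0 x0 ρ B lam N0 N1 k t p) t := by
  have hτ : HasDerivAt (fun s : ℝ => s - s0) 1 t := (hasDerivAt_id t).sub_const s0
  have h1 : HasDerivAt (fun s : ℝ => Real.exp (-(lam * (s - s0))))
      (Real.exp (-(lam * (t - s0))) * (-(lam * 1))) t := ((hτ.const_mul lam).neg).exp
  have h2 : HasDerivAt (fun s : ℝ => σ * (u s p.2 - u s p.1)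
      - (N0 + N1 * (s - s0)) * (p.2 - p.1)) _ t :=
    ((((h.eq t ht p.2).sub (h.eq t ht p.1)).const_mul σ).sub
      (((hτ.const_mul N1).const_add N0).mul_const (p.2 - p.1)))
  have h3 : HasDerivAt (fun s : ℝ => x0 - ρ + B * (s - s0) - p.1) (B * 1) t :=
    ((hτ.const_mul B).const_add (x0 - ρ)).sub_const p.1
  have h4 : HasDerivAt (fun s : ℝ => p.2 - (x0 + ρ - B * (s - s0))) (-(-(B * 1))) t :=
    ((hτ.const_mul B).const_sub (x0 + ρ)).const_sub p.2
  have h5 : HasDerivAt (fun s : ℝ => th (x0 - ρ + B * (s - s0) - p.1)) _ t :=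
    HasDerivAt.comp t (hasDerivAt_th _) h3
  have h6 : HasDerivAt (fun s : ℝ => th (p.2 - (x0 + ρ - B * (s - s0)))) _ t :=
    HasDerivAt.comp t (hasDerivAt_th _) h4
  have h7 := ((h1.mul h2).sub (h5.const_mul k)).sub (h6.const_mul k)
  refine h7.congr_deriv ?_
  unfold dblt
  simp only [mul_one, neg_neg]

/-- doubling lemma -/
lemma DL {u f : ℝ → ℝ → ℝ} {C : ℝ} {L : ℝ → ℝ} {s0 b x0 r ρ B Lf lam N0 N1 μ σ : ℝ}
    (h : Sol u f (Set.Icc s0 b) C L) (hσ : σ = 1 ∨ σ = -1)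
    (hρr : ρ < r) (hρ0 : 0 < ρ) (hB0 : 0 ≤ B)
    (hcont : ContinuousOn (fun z : ℝ × ℝ => u z.1 z.2)
      (Set.Icc s0 b ×ˢ Set.Icc (x0 - r) (x0 + r)))
    (hB : ∀ t ∈ Set.Icc s0 b, ∀ x ∈ Set.Icc (x0 - r) (x0 + r), |u t x| ≤ B)
    (hLf : L B ≤ Lf) (hlam : 0 ≤ lam) (hN0 : 0 ≤ N0) (hN1 : 0 ≤ N1) (hμ : 0 ≤ μ)
    (hinit : ∀ x ∈ Set.Icc (x0 - r) (x0 + r), ∀ y ∈ Set.Icc (x0 - r) (x0 + r), x ≤ y →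
      σ * (u s0 y - u s0 x) ≤ N0 * (y - x) + μ)
    (hH : ∀ t ∈ Set.Icc s0 b, ∀ D > 0, ∀ Ψ > 0,
      -(lam * Ψ) - (N0 + N1 * (t - s0)) * (σ * (Ψ + (N0 + N1 * (t - s0)) * D))
        + (Lf - N1) * D ≤ 0) :
    ∀ t ∈ Set.Icc s0 b, ∀ x y, x ≤ y → x0 - ρ + B * (t - s0) ≤ x →
      y ≤ x0 + ρ - B * (t - s0) →
      σ * (u t y - u t x) ≤ (N0 + N1 * (t - s0)) * (y - x) + Real.exp (lam * (t - s0)) * μ := by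
  have hσu : ∀ z, σ * z ≤ |z| := by
    intro z
    rcases hσ with rfl | rfl
    · simpa using le_abs_self z
    · simpa using neg_le_abs z
  have hσσ : σ * σ = 1 := by rcases hσ with rfl | rfl <;> norm_num
  set k := 2 * B / (r - ρ) ^ 2 with hk
  have hrρ : 0 < r - ρ := by linarith
  have hk0 : 0 ≤ k := by positivity
  have hkr : k * (r - ρ) ^ 2 = 2 * B := by rw [hk]; field_simp
  set K : Set (ℝ × ℝ) := (Set.Icc (x0 - r) (x0 + r) ×ˢ Set.Icc (x0 - r) (x0 + r)) ∩
    {p | p.1 ≤ p.2} with hKdef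
  have hK : IsCompact K :=
    (isCompact_Icc.prod isCompact_Icc).inter_right (isClosed_le continuous_fst continuous_snd)
  have main : ∀ t ∈ Set.Icc s0 b, ∀ p ∈ K, dbl u σ s0 x0 ρ B lam N0 N1 k t p ≤ μ := by
    refine MP (φ' := dblt u f σ s0 x0 ρ B lam N0 N1 k) hK ?_ ?_ ?_ ?_
    · unfold dbl
      have c1 : ContinuousOn (fun z : ℝ × (ℝ × ℝ) => u z.1 z.2.1) (Set.Icc s0 b ×ˢ K) :=
        hcont.comp (f := fun z : ℝ × (ℝ × ℝ) => (z.1, z.2.1)) (by fun_prop)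
          (fun z hz => ⟨hz.1, hz.2.1.1⟩)
      have c2 : ContinuousOn (fun z : ℝ × (ℝ × ℝ) => u z.1 z.2.2) (Set.Icc s0 b ×ˢ K) :=
        hcont.comp (f := fun z : ℝ × (ℝ × ℝ) => (z.1, z.2.2)) (by fun_prop)
          (fun z hz => ⟨hz.1, hz.2.1.2⟩)
      have c3 := continuous_th
      have c4 : ContinuousOn (fun z : ℝ × (ℝ × ℝ) => σ * (u z.1 z.2.2 - u z.1 z.2.1))
          (Set.Icc s0 b ×ˢ K) := (c2.sub c1).const_mul σ
      refine ((ContinuousOn.mul (Continuous.continuousOn (by fun_prop)) (c4.sub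
        (Continuous.continuousOn (by fun_prop)))).sub (Continuous.continuousOn (by fun_prop))).sub
        (Continuous.continuousOn (by fun_prop))
    · intro t ht p _
      exact hasDerivAt_dbl h σ s0 x0 ρ B lam N0 N1 k (Set.Ioc_subset_Icc_self ht) p
    · intro p hp
      have h1 := hinit p.1 hp.1.1 p.2 hp.1.2 hp.2
      unfold dbl
      have h2 := mul_nonneg hk0 (th_nonneg (x0 - ρ + B * (s0 - s0) - p.1))
      have h3 := mul_nonneg hk0 (th_nonneg (p.2 - (x0 + ρ - B * (s0 - s0))))
      have h4 : Real.exp (-(lam * (s0 - s0))) = 1 := by simp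
      rw [h4]
      simp only [sub_self, mul_zero, add_zero] at *
      linarith
    · rintro t ht ⟨x, y⟩ hp hmx hgt
      have ht' := Set.Ioc_subset_Icc_self ht
      have hx : x ∈ Set.Icc (x0 - r) (x0 + r) := hp.1.1
      have hy : y ∈ Set.Icc (x0 - r) (x0 + r) := hp.1.2
      have hxy : x ≤ y := hp.2
      have hτ : 0 < t - s0 := by linarith [ht.1]
      set N := N0 + N1 * (t - s0) with hN
      have hN' : 0 ≤ N := by positivity
      set e := Real.exp (-(lam * (t - s0))) with he
      have he0 : 0 < e := Real.exp_pos _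
      have he1 : e ≤ 1 := by
        rw [he, Real.exp_le_one_iff]
        have := mul_nonneg hlam hτ.le
        linarith
      set Ψ := σ * (u t y - u t x) - N * (y - x) with hΨ
      have hform : dbl u σ s0 x0 ρ B lam N0 N1 k t (x, y) = e * Ψ
        - k * th (x0 - ρ + B * (t - s0) - x) - k * th (y - (x0 + ρ - B * (t - s0))) := rfl
      have hth1 := mul_nonneg hk0 (th_nonneg (x0 - ρ + B * (t - s0) - x))
      have hth2 := mul_nonneg hk0 (th_nonneg (y - (x0 + ρ - B * (t - s0))))
      rw [hform] at hgt
      have hΨ0 : 0 < Ψ := by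
        by_contra hc
        push Not at hc
        have := mul_nonpos_of_nonneg_of_nonpos he0.le hc
        linarith
      have hΨB : e * Ψ ≤ 2 * B := by
        have h1 := hσu (u t y - u t x)
        have h2 := abs_sub (u t y) (u t x)
        have h3 := hB t ht' y hy
        have h4 := hB t ht' x hx
        have h5 := mul_nonneg hN' (sub_nonneg.2 hxy)
        have h6 : Ψ ≤ 2 * B := by linarith
        nlinarith
      have hBτ : 0 ≤ B * (t - s0) := by positivity
      have hxl : x0 - r < x := by
        rcases hx.1.eq_or_lt with h1 | h1
        · exfalso
          have h2 : r - ρ ≤ x0 - ρ + B * (t - s0) - x := by rw [← h1]; linarith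
          have h3 : (r - ρ) ^ 2 ≤ th (x0 - ρ + B * (t - s0) - x) := by
            rw [th_of_nonneg (by linarith)]
            exact pow_le_pow_left₀ hrρ.le h2 2
          have h4 := mul_le_mul_of_nonneg_left h3 hk0
          linarith
        · exact h1
      have hyr : y < x0 + r := by
        rcases hy.2.eq_or_lt with h1 | h1
        · exfalso
          have h2 : r - ρ ≤ y - (x0 + ρ - B * (t - s0)) := by rw [h1]; linarith
          have h3 : (r - ρ) ^ 2 ≤ th (y - (x0 + ρ - B * (t - s0))) := by
            rw [th_of_nonneg (by linarith)]
            exact pow_le_pow_left₀ hrρ.le h2 2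
          have h4 := mul_le_mul_of_nonneg_left h3 hk0
          linarith
        · exact h1
      have hxy' : x < y := by
        rcases hxy.eq_or_lt with h1 | h1
        · exfalso
          rw [hΨ, h1] at hΨ0
          simp at hΨ0
        · exact h1
      have dx := h.hasDerivAt_x ht' x
      have dy := h.hasDerivAt_x ht' y
      -- first order conditions
      have fx : e * (σ * (-(deriv (u t) x)) - N * (-1))
          - k * (2 * max (x0 - ρ + B * (t - s0) - x) 0 * (-1)) = 0 := by
        have hloc : IsLocalMax (fun z => dbl u σ s0 x0 ρ B lam N0 N1 k t (z, y)) x := by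
          filter_upwards [Icc_mem_nhds hxl hxy'] with z hz
          exact hmx (z, y) ⟨⟨⟨hz.1, hz.2.trans hy.2⟩, hy⟩, hz.2⟩
        refine hloc.hasDerivAt_eq_zero ?_
        have d1 : HasDerivAt (fun z => x0 - ρ + B * (t - s0) - z) (-1) x :=
          (hasDerivAt_id x).const_sub _
        have d2 : HasDerivAt (fun z => th (x0 - ρ + B * (t - s0) - z)) _ x :=
          HasDerivAt.comp x (hasDerivAt_th _) d1
        have d3 : HasDerivAt (fun z => y - z) (-1) x := (hasDerivAt_id x).const_sub _
        exact ((((((dx.const_sub (u t y)).const_mul σ).sub (d3.const_mul N)).const_mul e).sub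
          (d2.const_mul k)).sub_const (k * th (y - (x0 + ρ - B * (t - s0)))))
      have fy : e * (σ * (deriv (u t) y) - N * 1)
          - k * (2 * max (y - (x0 + ρ - B * (t - s0))) 0 * 1) = 0 := by
        have hloc : IsLocalMax (fun z => dbl u σ s0 x0 ρ B lam N0 N1 k t (x, z)) y := by
          filter_upwards [Icc_mem_nhds hxy' hyr] with z hz
          exact hmx (x, z) ⟨⟨hx, ⟨hx.1.trans hz.1, hz.2⟩⟩, hz.1⟩
        refine hloc.hasDerivAt_eq_zero ?_
        have d1 : HasDerivAt (fun z => z - (x0 + ρ - B * (t - s0))) 1 y :=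
          (hasDerivAt_id y).sub_const _
        have d2 : HasDerivAt (fun z => th (z - (x0 + ρ - B * (t - s0)))) _ y :=
          HasDerivAt.comp y (hasDerivAt_th _) d1
        have d3 : HasDerivAt (fun z => z - x) 1 y := (hasDerivAt_id y).sub_const _
        exact (((((dy.sub_const (u t x)).const_mul σ).sub (d3.const_mul N)).const_mul e).sub_const
          (k * th (x0 - ρ + B * (t - s0) - x))).sub (d2.const_mul k)
      set m1 := max (x0 - ρ + B * (t - s0) - x) 0 with hm1
      set m2 := max (y - (x0 + ρ - B * (t - s0))) 0 with hm2
      have hm1' : 0 ≤ m1 := le_max_right _ _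
      have hm2' : 0 ≤ m2 := le_max_right _ _
      have hHH := hH t ht' (y - x) (by linarith) Ψ hΨ0
      have hfl := h.fl t ht' B hB0 x y hxy (fun z hz => hB t ht' z
        ⟨hx.1.trans hz.1, hz.2.trans hy.2⟩)
      have hfl2 : -(σ * (f t y - f t x)) ≤ Lf * (y - x) := by
        have h1 := hσu (-(f t y - f t x))
        rw [abs_neg] at h1
        have h2 := mul_le_mul_of_nonneg_right hLf (sub_nonneg.2 hxy)
        linarith
      have hux := hB t ht' x hx
      have huy := hB t ht' y hy
      have form2 : dblt u f σ s0 x0 ρ B lam N0 N1 k t (x, y) =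
          e * (-(lam * Ψ) - N * (u t y - u t x) - σ * (f t y - f t x) - N1 * (y - x))
          - k * 2 * m2 * (B + u t y) - k * 2 * m1 * (B - u t x) := by
        unfold dblt
        simp only
        rw [← he, ← hm1, ← hm2, ← hN, ← hΨ]
        linear_combination (-u t y) * fy - (u t x) * fx
      rw [form2]
      have g1 : 0 ≤ k * 2 * m2 * (B + u t y) := by
        have : 0 ≤ B + u t y := by linarith [(abs_le.1 huy).1]
        positivity
      have g2 : 0 ≤ k * 2 * m1 * (B - u t x) := by
        have : 0 ≤ B - u t x := by linarith [(abs_le.1 hux).2]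
        positivity
      have g3 : u t y - u t x = σ * (Ψ + N * (y - x)) := by
        rw [hΨ]; linear_combination (-(u t y - u t x)) * hσσ
      have g4 : -(lam * Ψ) - N * (u t y - u t x) - σ * (f t y - f t x) - N1 * (y - x) ≤ 0 := by
        rw [g3]; linarith
      have g5 := mul_nonpos_of_nonneg_of_nonpos he0.le g4
      linarith
  intro t ht x y hxy hx hy
  have hτ : 0 ≤ t - s0 := by linarith [ht.1]
  have hBτ : 0 ≤ B * (t - s0) := by positivity
  have h1 := main t ht (x, y) ⟨⟨⟨by linarith, by linarith⟩, ⟨by linarith, by linarith⟩⟩, hxy⟩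
  unfold dbl at h1
  simp only at h1
  rw [th_of_nonpos (by linarith), th_of_nonpos (by linarith)] at h1
  simp only [mul_zero, sub_zero] at h1
  have h2 := mul_le_mul_of_nonneg_left h1 (Real.exp_pos (lam * (t - s0))).le
  rw [← mul_assoc, ← Real.exp_add] at h2
  simp only [add_neg_cancel, Real.exp_zero, one_mul] at h2
  linarith


/-! ### Part 5: local propagation of Lipschitz bounds -/

lemma unif_conv {p q N0 N : ℝ} (hpq : p < q) (hN0 : 0 ≤ N0) (hN : 0 ≤ N) {l : Filter ℝ}
    {v : ℝ → ℝ → ℝ} {w : ℝ → ℝ}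
    (h1 : ∀ᶠ s in l, ∀ x ∈ Set.Icc p q, ∀ y ∈ Set.Icc p q, x ≤ y → v s x - v s y ≤ N0 * (y - x))
    (h2 : ∀ x ∈ Set.Icc p q, Tendsto (fun s => v s x) l (nhds (w x)))
    (h3 : ∀ x ∈ Set.Icc p q, ∀ y ∈ Set.Icc p q, |w y - w x| ≤ N * |y - x|) :
    ∀ ε > 0, ∀ᶠ s in l, ∀ x ∈ Set.Icc p q, |v s x - w x| ≤ ε := by
  intro ε hε
  obtain ⟨n, hn⟩ := exists_nat_gt ((N0 + N) * (q - p) / (ε / 2))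
  have hpos : 0 < q - p := by linarith
  set h := (q - p) / (n + 1) with hh
  have hn1 : (0:ℝ) < n + 1 := by positivity
  have hh0 : 0 < h := by positivity
  have hnh : (n + 1) * h = q - p := by rw [hh]; field_simp
  have hhε : (N0 + N) * h ≤ ε / 2 := by
    rw [div_lt_iff₀ (by linarith)] at hn
    rw [hh, mul_div_assoc', div_le_iff₀ hn1]
    nlinarith
  have hgrid : ∀ i ∈ Finset.range (n + 2), p + i * h ∈ Set.Icc p q := by
    intro i hi
    rw [Finset.mem_range] at hi
    have hi' : (i:ℝ) ≤ n + 1 := by exact_mod_cast Nat.lt_succ_iff.1 hi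
    constructor
    · have : 0 ≤ (i:ℝ) * h := by positivity
      linarith
    · have : (i:ℝ) * h ≤ (n + 1) * h := by gcongr
      linarith
  have h4 : ∀ᶠ s in l, ∀ i ∈ Finset.range (n + 2), |v s (p + i * h) - w (p + i * h)| ≤ ε / 2 := by
    rw [Filter.eventually_all_finset]
    intro i hi
    have := (Metric.tendsto_nhds.1 (h2 _ (hgrid i hi))) (ε / 2) (by linarith)
    filter_upwards [this] with s hs
    rw [Real.dist_eq] at hs
    exact hs.le
  filter_upwards [h1, h4] with s hs1 hs4
  intro x hx
  have hxp : 0 ≤ (x - p) / h := div_nonneg (by linarith [hx.1]) hh0.le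
  have hxq : (x - p) / h ≤ (n + 1 : ℕ) := by
    rw [div_le_iff₀ hh0]; push_cast; linarith [hx.2]
  -- lower grid point
  set i := ⌊(x - p) / h⌋₊ with hi
  set j := ⌈(x - p) / h⌉₊ with hj
  have hj1 : j ≤ n + 1 := Nat.ceil_le.2 hxq
  have hi1 : i ≤ n + 1 := (Nat.floor_le_ceil _).trans hj1
  have a1 : (i:ℝ) * h ≤ x - p := by
    rw [← le_div_iff₀ hh0]; exact Nat.floor_le hxp
  have a2 : x - p ≤ (j:ℝ) * h := by
    rw [← div_le_iff₀ hh0]; exact Nat.le_ceil _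
  have a3 : x - p ≤ (i:ℝ) * h + h := by
    have := (Nat.lt_floor_add_one ((x - p) / h)).le
    rw [div_le_iff₀ hh0] at this
    linarith
  have a4 : (j:ℝ) * h ≤ x - p + h := by
    have := (Nat.ceil_lt_add_one hxp).le
    have := mul_le_mul_of_nonneg_right this hh0.le
    rw [add_mul, div_mul_cancel₀ _ hh0.ne'] at this
    linarith
  have mi : i ∈ Finset.range (n + 2) := Finset.mem_range.2 (by omega)
  have mj : j ∈ Finset.range (n + 2) := Finset.mem_range.2 (by omega)
  have gi := hgrid i mi
  have gj := hgrid j mj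
  have b1 := hs1 _ gi x hx (by linarith)
  have b2 := hs1 x hx _ gj (by linarith)
  have b3 := abs_le.1 (hs4 i mi)
  have b4 := abs_le.1 (hs4 j mj)
  have b5 := abs_le.1 (h3 _ gi x hx)
  have b6 := abs_le.1 (h3 x hx _ gj)
  have e1 : |x - (p + i * h)| ≤ h := by rw [abs_le]; constructor <;> linarith
  have e2 : |p + j * h - x| ≤ h := by rw [abs_le]; constructor <;> linarith
  have e3 := mul_le_mul_of_nonneg_left e1 hN
  have e4 := mul_le_mul_of_nonneg_left e2 hN
  have e5 : N0 * (x - (p + i * h)) ≤ N0 * h := by gcongr; linarith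
  have e6 : N0 * (p + j * h - x) ≤ N0 * h := by gcongr; linarith
  rw [abs_le]
  constructor <;> nlinarith

lemma exists_abs_bound {f : ℝ → ℝ} {p q : ℝ} (hf : ContinuousOn f (Set.Icc p q)) :
    ∃ M, 0 ≤ M ∧ ∀ x ∈ Set.Icc p q, |f x| ≤ M := by
  obtain ⟨M, hM⟩ := isCompact_Icc.exists_bound_of_continuousOn hf
  exact ⟨max M 0, le_max_right _ _, fun x hx => (hM x hx).trans (le_max_left _ _)⟩

lemma lip_of_C1 {f : ℝ → ℝ} (hf : ContDiff ℝ 1 f) (p q : ℝ) :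
    ∃ K, 0 ≤ K ∧ ∀ x ∈ Set.Icc p q, ∀ y ∈ Set.Icc p q, |f y - f x| ≤ K * |y - x| := by
  obtain ⟨K, hK0, hK⟩ := exists_abs_bound (p := p) (q := q)
    (hf.continuous_deriv le_rfl).continuousOn
  refine ⟨K, hK0, fun x hx y hy => ?_⟩
  exact Convex.norm_image_sub_le_of_norm_deriv_le
    (fun z _ => hf.differentiable one_ne_zero z) (fun z hz => hK z hz)
    (convex_Icc p q) hx hy

set_option maxHeartbeats 1600000 in
/-- local Lipschitz propagation from the left end point -/
lemma LL {u f : ℝ → ℝ → ℝ} {C : ℝ} {L : ℝ → ℝ} {a b x0 r N B1 : ℝ}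
    (hab : a < b) (hr : 0 < r) (hN : 0 ≤ N) (hB1 : 0 ≤ B1)
    (h : Sol u f (Set.Icc a b) C L)
    (hcont : ContinuousOn (fun z : ℝ × ℝ => u z.1 z.2)
      (Set.Ioc a b ×ˢ Set.Icc (x0 - r) (x0 + r)))
    (hlip : ∀ x ∈ Set.Icc (x0 - r) (x0 + r), ∀ y ∈ Set.Icc (x0 - r) (x0 + r),
      |u a y - u a x| ≤ N * |y - x|)
    (ha : ∀ x ∈ Set.Icc (x0 - r) (x0 + r), |u a x| ≤ B1)
    (hl : ∀ t ∈ Set.Icc a b, |u t (x0 - r/2)| ≤ B1)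
    (hrr : ∀ t ∈ Set.Icc a b, |u t (x0 + r/2)| ≤ B1)
    (hτ1 : C * (b - a) ≤ 1/2) (hτ2 : (B1 + 1) * (b - a) ≤ r / 8)
    (hτ3 : (4 * (N + L (B1 + 1) + 1) ^ 2 + L (B1 + 1)) * (b - a) ≤ N + L (B1 + 1) + 1) :
    ∀ x ∈ Set.Icc (x0 - r/4) (x0 + r/4), ∀ y ∈ Set.Icc (x0 - r/4) (x0 + r/4),
      |u b y - u b x| ≤ 2 * (N + L (B1 + 1) + 1) * |y - x| := by
  have hba : 0 < b - a := by linarith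
  have hCnn := h.Cnn
  have tcont : ∀ x, ContinuousOn (fun t => u t x) (Set.Icc a b) :=
    fun x t ht => (h.eq t ht x).continuousAt.continuousWithinAt
  have hbmem : b ∈ Set.Icc a b := ⟨hab.le, le_rfl⟩
  -- step (i)
  obtain ⟨B, hB0, hB⟩ : ∃ B, 0 ≤ B ∧ ∀ t ∈ Set.Ioc a b, ∀ x ∈ Set.Icc (x0 - r) (x0 + r),
      |u t x| ≤ B := by
    obtain ⟨M1, hM1, hM1'⟩ := exists_abs_bound (p := x0 - r) (q := x0 + r)
      (h.diff b hbmem).continuous.continuousOn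
    obtain ⟨M2, hM2, hM2'⟩ := exists_abs_bound (tcont (x0 - r))
    obtain ⟨M3, hM3, hM3'⟩ := exists_abs_bound (tcont (x0 + r))
    refine ⟨M1 + M2 + M3 + C * (b - a), by positivity, fun t ht x hx => ?_⟩
    have hR := (h.rev).mono (J := Set.Icc (-b) (-t)) (fun s hs => by
      simp only [Set.mem_preimage, Set.mem_Icc]
      constructor <;> linarith [hs.1, hs.2, ht.1])
    have hBL := BL (p := -x0 - r) (q := -x0 + r) (M := M1 + M2 + M3) hR ?_ ?_ ?_ ?_ (-t)
      ⟨by linarith [ht.2], le_rfl⟩ (-x) ⟨by linarith [hx.2], by linarith [hx.1]⟩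
    · simp only [neg_neg] at hBL
      have : C * (-t + b) ≤ C * (b - a) := by
        gcongr; linarith [ht.1]
      have e : -t - -b = -t + b := by ring
      rw [e] at hBL
      linarith
    · refine hcont.comp (f := fun z : ℝ × ℝ => (-z.1, -z.2)) (by fun_prop) ?_
      rintro ⟨s, y⟩ ⟨hs, hy⟩
      simp only [Set.mem_Icc] at hs hy
      refine ⟨⟨?_, ?_⟩, ⟨?_, ?_⟩⟩ <;> simp only <;> linarith [ht.1]
    · intro y hy
      simp only [neg_neg]
      have := hM1' (-y) ⟨by linarith [hy.2], by linarith [hy.1]⟩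
      linarith
    · intro s hs
      have := hM3' (-s) ⟨by linarith [hs.2, ht.1], by linarith [hs.1]⟩
      have e : -(-x0 - r) = x0 + r := by ring
      simp only [e]; linarith
    · intro s hs
      have := hM2' (-s) ⟨by linarith [hs.2, ht.1], by linarith [hs.1]⟩
      have e : -(-x0 + r) = x0 - r := by ring
      simp only [e]; linarith
  -- step (ii)
  obtain ⟨b', hb'a, hb'b, hb'B⟩ : ∃ b', a < b' ∧ b' ≤ b ∧ B * (b' - a) ≤ r / 4 := by
    refine ⟨min b (a + r / (4 * (B + 1))), ?_, min_le_left _ _, ?_⟩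
    · refine lt_min hab ?_
      have : 0 < r / (4 * (B + 1)) := by positivity
      linarith
    · have h1 : min b (a + r / (4 * (B + 1))) - a ≤ r / (4 * (B + 1)) := by
        have := min_le_right b (a + r / (4 * (B + 1))); linarith
      have h2 : B * (min b (a + r / (4 * (B + 1))) - a) ≤ B * (r / (4 * (B + 1))) := by gcongr
      refine h2.trans ?_
      rw [mul_div_assoc', div_le_div_iff₀ (by positivity) (by positivity)]
      nlinarith
  obtain ⟨K, hK0, hK⟩ := lip_of_C1 (h.diff b' ⟨hb'a.le, hb'b⟩) (x0 - r) (x0 + r)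
  have hLB := h.Lnn B hB0
  have hone : ∀ᶠ s in nhdsWithin a (Set.Ioi a), ∀ x ∈ Set.Icc (x0 - r/2) (x0 + r/2),
      ∀ y ∈ Set.Icc (x0 - r/2) (x0 + r/2), x ≤ y → u s x - u s y ≤ (K + L B + 1) * (y - x) := by
    filter_upwards [Ioo_mem_nhdsGT hb'a] with s hs
    have hR := (h.rev).mono (J := Set.Icc (-b') (-s)) (fun t ht => by
      simp only [Set.mem_preimage, Set.mem_Icc]
      constructor <;> linarith [hs.1, ht.1, ht.2])
    have hD := DL (x0 := -x0) (r := r) (ρ := 3 * r / 4) (B := B) (Lf := L B) (lam := 0)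
      (N0 := K + L B + 1) (N1 := 0) (μ := 0) (σ := 1) hR (Or.inl rfl) (by linarith) (by linarith)
      hB0 ?_ ?_ le_rfl le_rfl (by positivity) le_rfl le_rfl ?_ ?_ (-s) ⟨by linarith [hs.2], le_rfl⟩
    · intro x hx y hy hxy
      have hBs : B * (-s - -b') ≤ r / 4 := by
        exact le_trans (mul_le_mul_of_nonneg_left (by linarith [hs.1]) hB0) hb'B
      have := hD (-y) (-x) (by linarith) (by linarith [hy.2]) (by linarith [hx.1])
      simp only [neg_neg] at this
      nlinarith
    · refine hcont.comp (f := fun z : ℝ × ℝ => (-z.1, -z.2)) (by fun_prop) ?_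
      rintro ⟨t, y⟩ ⟨ht, hy⟩
      simp only [Set.mem_Icc] at ht hy
      refine ⟨⟨?_, ?_⟩, ⟨?_, ?_⟩⟩ <;> simp only <;> linarith [hs.1]
    · intro t ht y hy
      exact hB (-t) ⟨by linarith [ht.2, hs.1], by linarith [ht.1]⟩ (-y)
        ⟨by linarith [hy.2], by linarith [hy.1]⟩
    · intro x hx y hy hxy
      have := hK (-x) ⟨by linarith [hx.2], by linarith [hx.1]⟩ (-y)
        ⟨by linarith [hy.2], by linarith [hy.1]⟩
      have e : |(-y) - (-x)| = y - x := by
        rw [abs_of_nonpos (by linarith)]; ring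
      rw [e] at this
      have h2 := le_abs_self (u b' (-y) - u b' (-x))
      simp only [neg_neg]
      nlinarith
    · intro t _ D hD Ψ hΨ
      have h1 : L B ≤ (K + L B + 1) * (K + L B + 1) := by nlinarith
      have h2 := mul_le_mul_of_nonneg_right h1 hD.le
      have h3 : 0 ≤ (K + L B + 1) * Ψ := by positivity
      nlinarith
  -- step (iii)
  have hsub : Set.Icc (x0 - r/2) (x0 + r/2) ⊆ Set.Icc (x0 - r) (x0 + r) :=
    Set.Icc_subset_Icc (by linarith) (by linarith)
  have hunif := unif_conv (by linarith : x0 - r/2 < x0 + r/2) (by positivity) hN hone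
    (w := u a) (fun x _ => ((h.eq a ⟨le_rfl, hab.le⟩ x).continuousAt.tendsto.mono_left
      nhdsWithin_le_nhds)) (fun x hx y hy => hlip x (hsub hx) y (hsub hy))
  -- steps (iv), (v)
  set LB := L (B1 + 1) with hLBdef
  have hLB1 : 0 ≤ LB := h.Lnn _ (by linarith)
  set N0 := N + LB + 1 with hN0def
  have hN01 : 1 ≤ N0 := by linarith
  have key : ∀ σ : ℝ, (σ = 1 ∨ σ = -1) → ∀ x ∈ Set.Icc (x0 - r/4) (x0 + r/4),
      ∀ y ∈ Set.Icc (x0 - r/4) (x0 + r/4), x ≤ y → σ * (u b y - u b x) ≤ 2 * N0 * (y - x) := by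
    intro σ hσ x hx y hy hxy
    have hσu : ∀ z, σ * z ≤ |z| := by
      intro z
      rcases hσ with rfl | rfl
      · simpa using le_abs_self z
      · simpa using neg_le_abs z
    have hε : ∀ ε > 0, ε ≤ 1/2 → σ * (u b y - u b x) ≤ 2 * N0 * (y - x)
        + Real.exp (2 * N0 * (b - a)) * (2 * ε) := by
      intro ε hε hε2
      obtain ⟨s0, hs0, hs0'⟩ := ((hunif ε hε).and (Ioo_mem_nhdsGT hab)).exists
      have hS : Sol u f (Set.Icc s0 b) C L := h.mono (Set.Icc_subset_Icc hs0'.1.le le_rfl)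
      have hc2 : ContinuousOn (fun z : ℝ × ℝ => u z.1 z.2)
          (Set.Icc s0 b ×ˢ Set.Icc (x0 - r/2) (x0 + r/2)) :=
        hcont.mono (Set.prod_mono (fun t ht => ⟨lt_of_lt_of_le hs0'.1 ht.1, ht.2⟩) hsub)
      have hsb : C * (b - s0) ≤ 1/2 := by
        refine le_trans ?_ hτ1
        gcongr; exact hs0'.1.le
      have hbd : ∀ t ∈ Set.Icc s0 b, ∀ z ∈ Set.Icc (x0 - r/2) (x0 + r/2), |u t z| ≤ B1 + 1 := by
        intro t ht z hz
        have := BL (M := B1 + 1/2) hS hc2 (fun z hz => by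
            have h1 := hs0 z hz
            have h2 := ha z (hsub hz)
            have h3 := abs_sub_abs_le_abs_sub (u s0 z) (u a z)
            linarith)
          (fun t ht => by have := hl t ⟨hs0'.1.le.trans ht.1, ht.2⟩; linarith)
          (fun t ht => by have := hrr t ⟨hs0'.1.le.trans ht.1, ht.2⟩; linarith) t ht z hz
        have h2 : C * (t - s0) ≤ C * (b - s0) := by gcongr; exact ht.2
        linarith
      have hinit : ∀ x ∈ Set.Icc (x0 - r/2) (x0 + r/2), ∀ y ∈ Set.Icc (x0 - r/2) (x0 + r/2),
          x ≤ y → σ * (u s0 y - u s0 x) ≤ N0 * (y - x) + 2 * ε := by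
        intro x hx y hy hxy
        have h1 := abs_le.1 (hs0 x hx)
        have h2 := abs_le.1 (hs0 y hy)
        have h3 := hlip x (hsub hx) y (hsub hy)
        rw [abs_of_nonneg (sub_nonneg.2 hxy)] at h3
        have h3' := abs_le.1 h3
        have h4 := hσu (u s0 y - u s0 x)
        have h5 : |u s0 y - u s0 x| ≤ N * (y - x) + 2 * ε := by
          rw [abs_le]; constructor <;> linarith
        have h6 : N * (y - x) ≤ N0 * (y - x) := by
          gcongr; linarith
        linarith
      have hτs : b - s0 ≤ b - a := by linarith [hs0'.1]
      have hBs : (B1 + 1) * (b - s0) ≤ r / 8 := by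
        refine le_trans ?_ hτ2
        gcongr
      have hexp : Real.exp (2 * N0 * (b - s0)) ≤ Real.exp (2 * N0 * (b - a)) := by
        gcongr
      have hxx : x0 - 3 * r / 8 + (B1 + 1) * (b - s0) ≤ x := by linarith [hx.1]
      have hyy : y ≤ x0 + 3 * r / 8 - (B1 + 1) * (b - s0) := by linarith [hy.2]
      have hbm : b ∈ Set.Icc s0 b := ⟨hs0'.2.le, le_rfl⟩
      have hyx : 0 ≤ y - x := by linarith
      rcases hσ with rfl | rfl
      · have := DL (x0 := x0) (r := r/2) (ρ := 3 * r / 8) (B := B1 + 1) (Lf := LB)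
          (lam := 2 * N0) (N0 := N0) (N1 := 0) (μ := 2 * ε) (σ := 1) hS (Or.inl rfl)
          (by linarith) (by linarith) (by linarith) hc2 hbd le_rfl (by linarith) (by linarith)
          le_rfl (by linarith) hinit (by
            intro t _ D hD Ψ hΨ
            have h1 : LB ≤ N0 * N0 := by nlinarith
            have h2 := mul_le_mul_of_nonneg_right h1 hD.le
            have h3 : 0 ≤ N0 * Ψ := by positivity
            nlinarith) b hbm x y hxy hxx hyy
        have h5 := mul_le_mul_of_nonneg_right hexp (by linarith : 0 ≤ 2 * ε)
        have h6 : 0 ≤ N0 * (y - x) := by positivity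
        linarith
      · have hN1 : (4 * N0 ^ 2 + LB) * (b - s0) ≤ N0 := by
          refine le_trans ?_ hτ3
          gcongr
        have := DL (x0 := x0) (r := r/2) (ρ := 3 * r / 8) (B := B1 + 1) (Lf := LB)
          (lam := 2 * N0) (N0 := N0) (N1 := 4 * N0 ^ 2 + LB) (μ := 2 * ε) (σ := -1) hS (Or.inr rfl)
          (by linarith) (by linarith) (by linarith) hc2 hbd le_rfl (by linarith) (by linarith)
          (by positivity) (by linarith) hinit (by
            intro t ht D hD Ψ hΨ
            have hn1 : (4 * N0 ^ 2 + LB) * (t - s0) ≤ N0 := by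
              refine le_trans ?_ hN1
              gcongr; exact ht.2
            have hn0 : 0 ≤ (4 * N0 ^ 2 + LB) * (t - s0) :=
              mul_nonneg (by positivity) (by linarith [ht.1])
            set n := N0 + (4 * N0 ^ 2 + LB) * (t - s0) with hn
            have h1 : n ≤ 2 * N0 := by linarith
            have h0 : 0 ≤ n := by linarith
            have h2 := mul_le_mul_of_nonneg_right h1 hΨ.le
            have h3 : n * n ≤ (2 * N0) * (2 * N0) := by gcongr
            have h4 := mul_le_mul_of_nonneg_right h3 hD.le
            nlinarith) b hbm x y hxy hxx hyy
        have h5 := mul_le_mul_of_nonneg_right hexp (by linarith : 0 ≤ 2 * ε)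
        have h6 : (N0 + (4 * N0 ^ 2 + LB) * (b - s0)) * (y - x) ≤ 2 * N0 * (y - x) := by
          gcongr; linarith
        linarith
    refine le_of_forall_pos_le_add fun η hη => ?_
    set E := Real.exp (2 * N0 * (b - a)) with hE
    have hE0 : 0 < E := Real.exp_pos _
    have h1 := hε (min (1/2) (η / (2 * E))) (lt_min (by norm_num) (by positivity)) (min_le_left _ _)
    have h2 : E * (2 * min (1/2) (η / (2 * E))) ≤ E * (2 * (η / (2 * E))) := by
      gcongr; exact min_le_right _ _
    have h3 : E * (2 * (η / (2 * E))) = η := by field_simp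
    linarith
  have key2 : ∀ x ∈ Set.Icc (x0 - r/4) (x0 + r/4),
      ∀ y ∈ Set.Icc (x0 - r/4) (x0 + r/4), x ≤ y → |u b y - u b x| ≤ 2 * N0 * (y - x) := by
    intro x hx y hy hxy
    have h1 := key 1 (Or.inl rfl) x hx y hy hxy
    have h2 := key (-1) (Or.inr rfl) x hx y hy hxy
    rw [abs_le]; constructor <;> linarith
  intro x hx y hy
  rcases le_total x y with hxy | hxy
  · rw [abs_of_nonneg (sub_nonneg.2 hxy)]
    exact key2 x hx y hy hxy
  · rw [abs_sub_comm, abs_sub_comm y x, abs_of_nonneg (sub_nonneg.2 hxy)]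
    exact key2 y hy x hx hxy


/-! ### Part 6: local uniform Lipschitz regularity (Baire argument) -/

/-- local uniform Lipschitz regularity at a space-time point -/
def Reg (u : ℝ → ℝ → ℝ) (S : Set ℝ) (t0 x0 : ℝ) : Prop :=
  ∃ δ > 0, ∃ K, 0 ≤ K ∧ ∀ t ∈ S, |t - t0| < δ → ∀ x y, |x - x0| < δ → |y - x0| < δ →
    |u t y - u t x| ≤ K * |y - x|

lemma Reg.nearby {u : ℝ → ℝ → ℝ} {S : Set ℝ} {t0 x0 : ℝ} (h : Reg u S t0 x0) :
    ∃ ε > 0, ∀ t x, |t - t0| < ε → |x - x0| < ε → Reg u S t x := by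
  obtain ⟨δ, hδ, K, hK, H⟩ := h
  refine ⟨δ / 2, by linarith, fun t x ht hx => ⟨δ / 2, by linarith, K, hK, ?_⟩⟩
  intro s hs hst p q hp hq
  refine H s hs ?_ p q ?_ ?_
  · have := abs_sub_le s t t0; linarith
  · have := abs_sub_le p x x0; linarith
  · have := abs_sub_le q x x0; linarith

lemma Reg.continuousWithinAt {u : ℝ → ℝ → ℝ} {S : Set ℝ} {t0 x0 : ℝ} (h : Reg u S t0 x0)
    (hc : ContinuousWithinAt (fun t => u t x0) S t0) :
    ContinuousWithinAt (fun z : ℝ × ℝ => u z.1 z.2) (S ×ˢ Set.univ) (t0, x0) := by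
  obtain ⟨δ, hδ, K, hK, H⟩ := h
  rw [Metric.continuousWithinAt_iff] at hc ⊢
  intro ε hε
  obtain ⟨d, hd, hd'⟩ := hc (ε / 2) (by linarith)
  refine ⟨min (min d δ) (ε / (2 * (K + 1))), by positivity, ?_⟩
  rintro ⟨t, x⟩ ⟨ht, -⟩ hdist
  rw [Prod.dist_eq, max_lt_iff] at hdist
  simp only [Real.dist_eq] at hdist hd' ⊢
  obtain ⟨h1, h2⟩ := hdist
  have h3 := hd' ht (h1.trans_le ((min_le_left _ _).trans (min_le_left _ _)))
  have h4 := H t ht (h1.trans_le ((min_le_left _ _).trans (min_le_right _ _))) x0 x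
    (by simpa using hδ) (h2.trans_le ((min_le_left _ _).trans (min_le_right _ _)))
  have h5 : K * |x - x0| ≤ K * (ε / (2 * (K + 1))) := by
    gcongr; exact (h2.trans_le (min_le_right _ _)).le
  have h6 : K * (ε / (2 * (K + 1))) ≤ ε / 2 := by
    rw [mul_div_assoc', div_le_div_iff₀ (by positivity) (by positivity)]
    nlinarith
  have := abs_sub_le (u t x) (u t x0) (u t0 x0)
  linarith

lemma Sol.tcont {u f : ℝ → ℝ → ℝ} {I : Set ℝ} {C : ℝ} {L : ℝ → ℝ} (h : Sol u f I C L) (x : ℝ) :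
    ContinuousOn (fun t => u t x) I :=
  fun t ht => (h.eq t ht x).continuousAt.continuousWithinAt

lemma small_time {C B1 r N0 LB : ℝ} (hr : 0 < r) (hC : 0 ≤ C) (hB : 0 ≤ B1) (hN : 0 < N0)
    (hL : 0 ≤ LB) : ∃ d > 0, ∀ s, 0 ≤ s → s ≤ d → C * s ≤ 1/2 ∧ (B1 + 1) * s ≤ r / 8 ∧
      (4 * N0 ^ 2 + LB) * s ≤ N0 := by
  have e1 : 0 < 1 / (2 * (C + 1)) := by positivity
  have e2 : 0 < r / (8 * (B1 + 1)) := by positivity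
  have e3 : 0 < N0 / (4 * N0 ^ 2 + LB) := by positivity
  refine ⟨min (min (1 / (2 * (C + 1))) (r / (8 * (B1 + 1)))) (N0 / (4 * N0 ^ 2 + LB)),
    by positivity, fun s hs hsd => ⟨?_, ?_, ?_⟩⟩
  · have h1 : s ≤ 1 / (2 * (C + 1)) := hsd.trans ((min_le_left _ _).trans (min_le_left _ _))
    rw [le_div_iff₀ (by positivity)] at h1
    nlinarith
  · have h1 : s ≤ r / (8 * (B1 + 1)) := hsd.trans ((min_le_left _ _).trans (min_le_right _ _))
    rw [le_div_iff₀ (by positivity)] at h1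
    linarith
  · have h1 : s ≤ N0 / (4 * N0 ^ 2 + LB) := hsd.trans (min_le_right _ _)
    rw [le_div_iff₀ (by positivity)] at h1
    linarith

/-- Baire category: irregular points have a uniformly Lipschitz portion -/
lemma baire_portion {u f : ℝ → ℝ → ℝ} {C : ℝ} {L : ℝ → ℝ} {S : Set ℝ}
    (h : Sol u f S C L) {F : Set (ℝ × ℝ)} (hF : IsClosed F) (hFS : ∀ z ∈ F, z.1 ∈ S)
    (hne : F.Nonempty) :
    ∃ z0 ∈ F, ∃ n : ℕ, ∃ ε > 0, ∀ z ∈ F, |z.1 - z0.1| < ε → |z.2 - z0.2| < ε →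
      ∀ p q, |p - z.2| < 1 / (n + 1) → |q - z.2| < 1 / (n + 1) →
        |u z.1 q - u z.1 p| ≤ n * |q - p| := by
  haveI : CompleteSpace F := hF.completeSpace_coe
  haveI : Nonempty F := hne.to_subtype
  set A : ℕ → Set F := fun n => {z : F | ∀ p q, |p - z.1.2| < 1 / ((n:ℝ) + 1) →
    |q - z.1.2| < 1 / ((n:ℝ) + 1) → |u z.1.1 q - u z.1.1 p| ≤ n * |q - p|} with hA
  have hAc : ∀ n, IsClosed (A n) := by
    intro n
    have : A n = ⋂ p : ℝ, ⋂ q : ℝ, ({z : F | 1 / ((n:ℝ) + 1) ≤ |p - z.1.2|} ∪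
        ({z : F | 1 / ((n:ℝ) + 1) ≤ |q - z.1.2|} ∪
          {z : F | |u z.1.1 q - u z.1.1 p| ≤ n * |q - p|})) := by
      ext z
      simp only [hA, Set.mem_setOf_eq, Set.mem_iInter, Set.mem_union]
      refine forall_congr' fun p => forall_congr' fun q => ?_
      constructor
      · intro H
        by_contra hc
        push Not at hc
        exact absurd (H hc.1 hc.2.1) (not_le.2 hc.2.2)
      · intro H h1 h2
        rcases H with H | H | H
        · exact absurd h1 (not_lt.2 H)
        · exact absurd h2 (not_lt.2 H)
        · exact H
    rw [this]
    have hcu : ∀ q, Continuous (fun z : F => u z.1.1 q) := by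
      intro q
      rw [continuous_iff_continuousAt]
      intro z
      have h1 : ContinuousAt (fun t => u t q) z.1.1 := (h.eq z.1.1 (hFS z.1 z.2) q).continuousAt
      exact ContinuousAt.comp (f := fun z : F => z.1.1) h1 (by fun_prop)
    refine isClosed_iInter fun p => isClosed_iInter fun q => ?_
    refine (isClosed_le continuous_const (by fun_prop)).union
      ((isClosed_le continuous_const (by fun_prop)).union (isClosed_le ?_ continuous_const))
    exact ((hcu q).sub (hcu p)).abs
  have hAU : ⋃ n, A n = Set.univ := by
    rw [Set.eq_univ_iff_forall]
    intro z
    obtain ⟨K, hK0, hK⟩ := lip_of_C1 (h.diff z.1.1 (hFS z.1 z.2)) (z.1.2 - 1) (z.1.2 + 1)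
    obtain ⟨n, hn⟩ := exists_nat_ge K
    rw [Set.mem_iUnion]
    refine ⟨n, fun p q hp hq => ?_⟩
    have h1 : 1 / ((n:ℝ) + 1) ≤ 1 := by
      rw [div_le_one (by positivity)]
      have : (0:ℝ) ≤ n := Nat.cast_nonneg n
      linarith
    have hp' := abs_lt.1 (hp.trans_le h1)
    have hq' := abs_lt.1 (hq.trans_le h1)
    refine (hK p ⟨by linarith, by linarith⟩ q ⟨by linarith, by linarith⟩).trans ?_
    gcongr
  obtain ⟨n, z0, hz0⟩ := nonempty_interior_of_iUnion_of_closed hAc hAU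
  rw [mem_interior_iff_mem_nhds, Metric.mem_nhds_iff] at hz0
  obtain ⟨ε, hε, hball⟩ := hz0
  refine ⟨z0.1, z0.2, n, ε, hε, fun z hz h1 h2 => ?_⟩
  have hm : (⟨z, hz⟩ : F) ∈ A n := by
    apply hball
    rw [Metric.mem_ball, Subtype.dist_eq, Prod.dist_eq, max_lt_iff, Real.dist_eq, Real.dist_eq]
    exact ⟨h1, h2⟩
  exact hm

set_option maxHeartbeats 800000 in
lemma L1a {u f : ℝ → ℝ → ℝ} {C : ℝ} {L : ℝ → ℝ} {t1 t2 : ℝ}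
    (h : Sol u f (Set.Icc t1 t2) C L) :
    ∀ t0 ∈ Set.Icc t1 t2, ∀ x0, Reg u (Set.Icc t1 t2) t0 x0 := by
  by_contra hcon
  push Not at hcon
  obtain ⟨t', ht', x', hx'⟩ := hcon
  set F : Set (ℝ × ℝ) := {z | z.1 ∈ Set.Icc t1 t2 ∧ ¬ Reg u (Set.Icc t1 t2) z.1 z.2} with hFdef
  have hF : IsClosed F := by
    have h1 : IsClosed {z : ℝ × ℝ | z.1 ∈ Set.Icc t1 t2} := isClosed_Icc.preimage continuous_fst
    have h2 : IsOpen {z : ℝ × ℝ | Reg u (Set.Icc t1 t2) z.1 z.2} := by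
      rw [Metric.isOpen_iff]
      intro z hz
      obtain ⟨ε, hε, H⟩ := Reg.nearby hz
      refine ⟨ε, hε, fun y hy => ?_⟩
      rw [Metric.mem_ball, Prod.dist_eq, max_lt_iff, Real.dist_eq, Real.dist_eq] at hy
      exact H _ _ hy.1 hy.2
    exact h1.inter h2.isClosed_compl
  obtain ⟨⟨t0, x0⟩, hz0, n, ε, hε, hport⟩ := baire_portion h hF (fun z hz => hz.1)
    ⟨(t', x'), ht', hx'⟩
  have ht0 : t0 ∈ Set.Icc t1 t2 := hz0.1
  apply hz0.2
  show Reg u (Set.Icc t1 t2) t0 x0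
  simp only at hport
  -- the spatial window
  set η : ℝ := 1 / ((n:ℝ) + 1) with hη
  have hη0 : 0 < η := by positivity
  obtain ⟨r, hr0, hrε, hrη⟩ : ∃ r > 0, r < ε ∧ 2 * r < η := by
    refine ⟨min ε η / 3, by positivity, ?_, ?_⟩
    · have := min_le_left ε η; linarith
    · have := min_le_right ε η; linarith
  have hn0 : (0:ℝ) ≤ n := Nat.cast_nonneg n
  obtain ⟨M1, hM1, hM1'⟩ := exists_abs_bound (h.tcont (x0 - r/2))
  obtain ⟨M2, hM2, hM2'⟩ := exists_abs_bound (h.tcont (x0 + r/2))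
  set B1 := M1 + M2 + n * (2 * r) with hB1
  have hB10 : 0 ≤ B1 := by positivity
  set LB := L (B1 + 1) with hLB
  have hLB0 : 0 ≤ LB := h.Lnn _ (by linarith)
  set N0 : ℝ := n + LB + 1 with hN0
  have hN00 : 0 < N0 := by positivity
  obtain ⟨d1, hd1, hsmall⟩ := small_time hr0 h.Cnn hB10 hN00 hLB0
  set d := min d1 (ε / 2) with hd
  have hd0 : 0 < d := by positivity
  have hdd1 : d ≤ d1 := min_le_left _ _
  have hdε : d < ε := lt_of_le_of_lt (min_le_right _ _) (by linarith)
  -- the bad times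
  set Pi : Set ℝ := {t | ∃ x ∈ Set.Icc (x0 - r) (x0 + r), (t, x) ∈ F} with hPi
  have hPic : IsClosed Pi := by
    have : Pi = Prod.fst '' (F ∩ (Set.Icc t1 t2 ×ˢ Set.Icc (x0 - r) (x0 + r))) := by
      ext t
      constructor
      · rintro ⟨x, hx, hxF⟩
        exact ⟨(t, x), ⟨hxF, hxF.1, hx⟩, rfl⟩
      · rintro ⟨⟨s, x⟩, ⟨hxF, -, hx⟩, rfl⟩
        exact ⟨x, hx, hxF⟩
    rw [this]
    exact (((isCompact_Icc.prod isCompact_Icc).inter_left hF).image continuous_fst).isClosed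
  have ht0Pi : t0 ∈ Pi := ⟨x0, ⟨by linarith, by linarith⟩, hz0⟩
  have hPilip : ∀ t ∈ Pi, |t - t0| ≤ d → ∀ x ∈ Set.Icc (x0 - r) (x0 + r),
      ∀ y ∈ Set.Icc (x0 - r) (x0 + r), |u t y - u t x| ≤ n * |y - x| := by
    rintro t ⟨z, hz, hzF⟩ htd x hx y hy
    refine hport (t, z) hzF (by simpa using lt_of_le_of_lt htd hdε) ?_ x y ?_ ?_
    · simp only; rw [abs_lt]; constructor <;> linarith [hz.1, hz.2]
    · simp only; rw [abs_lt]; constructor <;> linarith [hz.1, hz.2, hx.1, hx.2]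
    · simp only; rw [abs_lt]; constructor <;> linarith [hz.1, hz.2, hy.1, hy.2]
  have hPiB : ∀ t ∈ Pi, |t - t0| ≤ d → ∀ x ∈ Set.Icc (x0 - r) (x0 + r), |u t x| ≤ B1 := by
    intro t ht htd x hx
    have htI : t ∈ Set.Icc t1 t2 := by obtain ⟨z, _, hzF⟩ := ht; exact hzF.1
    have h1 := hPilip t ht htd (x0 + r/2) ⟨by linarith, by linarith⟩ x hx
    have h2 := hM2' t htI
    have h3 := abs_sub_abs_le_abs_sub (u t x) (u t (x0 + r/2))
    have h4 : |x - (x0 + r/2)| ≤ 2 * r := by rw [abs_le]; constructor <;> linarith [hx.1, hx.2]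
    have h5 := mul_le_mul_of_nonneg_left h4 hn0
    linarith
  -- joint continuity away from bad times
  have hjc : ∀ J : Set ℝ, J ⊆ Set.Icc t1 t2 → (∀ t ∈ J, t ∉ Pi) →
      ContinuousOn (fun z : ℝ × ℝ => u z.1 z.2) (J ×ˢ Set.Icc (x0 - r) (x0 + r)) := by
    rintro J hJ hJP ⟨t, x⟩ ⟨ht, hx⟩
    simp only at ht hx
    have hreg : Reg u (Set.Icc t1 t2) t x := by
      by_contra hc
      exact hJP t ht ⟨x, hx, hJ ht, hc⟩
    exact (hreg.continuousWithinAt (h.tcont x t (hJ ht))).mono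
      (Set.prod_mono hJ (Set.subset_univ _))
  have main : ∀ t ∈ Set.Icc t1 t2, |t - t0| ≤ d → ∀ x ∈ Set.Icc (x0 - r/4) (x0 + r/4),
      ∀ y ∈ Set.Icc (x0 - r/4) (x0 + r/4), |u t y - u t x| ≤ 2 * N0 * |y - x| := by
    intro t ht htd
    by_cases htP : t ∈ Pi
    · intro x hx y hy
      have h1 := hPilip t htP htd x ⟨by linarith [hx.1], by linarith [hx.2]⟩ y
        ⟨by linarith [hy.1], by linarith [hy.2]⟩
      refine h1.trans ?_
      gcongr
      linarith
    · rcases lt_or_gt_of_ne (fun e => htP (e ▸ ht0Pi) : t ≠ t0) with hlt | hlt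
      · -- t < t0
        obtain ⟨a, ha⟩ := (isCompact_Icc (a := t) (b := t0)).inter_left hPic |>.exists_isLeast
          ⟨t0, ht0Pi, hlt.le, le_rfl⟩
        have haP : a ∈ Pi := ha.1.1
        have hat : t < a := lt_of_le_of_ne ha.1.2.1 (fun e => htP (e ▸ haP))
        have hat0 : a ≤ t0 := ha.1.2.2
        have haI : a ∈ Set.Icc t1 t2 := ⟨ht.1.trans hat.le, hat0.trans ht0.2⟩
        have htd2 := abs_le.1 htd
        have had : |a - t0| ≤ d := by rw [abs_le]; constructor <;> linarith
        have hsm := hsmall (a - t) (by linarith) (by linarith)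
        have hR := (h.rev).mono (J := Set.Icc (-a) (-t)) (fun s hs => by
          simp only [Set.mem_preimage, Set.mem_Icc]
          constructor <;> linarith [hs.1, hs.2, ht.1, haI.2])
        have e0 : -t - -a = a - t := by ring
        have hLL := LL (x0 := -x0) (r := r) (N := n) (B1 := B1) (by linarith : -a < -t) hr0 hn0 hB10
          hR ?_ ?_ ?_ ?_ ?_ (by rw [e0]; exact hsm.1) (by rw [e0]; exact hsm.2.1)
          (by rw [e0]; exact hsm.2.2)
        · intro x hx y hy
          have := hLL (-x) ⟨by linarith [hx.2], by linarith [hx.1]⟩ (-y)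
            ⟨by linarith [hy.2], by linarith [hy.1]⟩
          simp only [neg_neg] at this
          have e : |-y - -x| = |y - x| := by
            rw [← abs_neg]; congr 1; ring
          rw [e] at this
          exact this
        · have hj := hjc (Set.Ico t a) (fun s hs => ⟨ht.1.trans hs.1, hs.2.le.trans haI.2⟩)
            (fun s hs hsP => absurd (ha.2 ⟨hsP, hs.1, hs.2.le.trans hat0⟩) (not_le.2 hs.2))
          refine hj.comp (f := fun z : ℝ × ℝ => (-z.1, -z.2)) (by fun_prop) ?_
          rintro ⟨s, y⟩ ⟨hs, hy⟩
          simp only [Set.mem_Icc, Set.mem_Ioc] at hs hy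
          refine ⟨⟨?_, ?_⟩, ⟨?_, ?_⟩⟩ <;> simp only <;> linarith
        · intro x hx y hy
          have := hPilip a haP had (-x) ⟨by linarith [hx.2], by linarith [hx.1]⟩ (-y)
            ⟨by linarith [hy.2], by linarith [hy.1]⟩
          have e : |-y - -x| = |y - x| := by
            rw [← abs_neg]; congr 1; ring
          rw [e] at this
          simpa only [neg_neg] using this
        · intro x hx
          simp only [neg_neg]
          exact hPiB a haP had (-x) ⟨by linarith [hx.2], by linarith [hx.1]⟩
        · intro s hs
          have e : -(-x0 - r/2) = x0 + r/2 := by ring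
          simp only [e]
          have := hM2' (-s) ⟨by linarith [ht.1, hs.2], by linarith [haI.2, hs.1]⟩
          have : 0 ≤ n * (2 * r) := by positivity
          linarith
        · intro s hs
          have e : -(-x0 + r/2) = x0 - r/2 := by ring
          simp only [e]
          have := hM1' (-s) ⟨by linarith [ht.1, hs.2], by linarith [haI.2, hs.1]⟩
          have : 0 ≤ n * (2 * r) := by positivity
          linarith
      · -- t0 < t
        obtain ⟨a, ha⟩ := (isCompact_Icc (a := t0) (b := t)).inter_left hPic |>.exists_isGreatest
          ⟨t0, ht0Pi, le_rfl, le_of_lt hlt⟩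
        have haP : a ∈ Pi := ha.1.1
        have hat : a < t := lt_of_le_of_ne ha.1.2.2 (fun e => htP (e ▸ haP))
        have hat0 : t0 ≤ a := ha.1.2.1
        have haI : a ∈ Set.Icc t1 t2 := ⟨ht0.1.trans hat0, hat.le.trans ht.2⟩
        have htd2 := abs_le.1 htd
        have had : |a - t0| ≤ d := by rw [abs_le]; constructor <;> linarith
        have hsm := hsmall (t - a) (by linarith) (by linarith)
        refine LL (x0 := x0) (r := r) (N := n) (B1 := B1) hat hr0 hn0 hB10
          (h.mono (Set.Icc_subset_Icc haI.1 ht.2)) ?_ (hPilip a haP had) (hPiB a haP had) ?_ ?_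
          hsm.1 hsm.2.1 hsm.2.2
        · exact hjc (Set.Ioc a t) (fun s hs => ⟨haI.1.trans hs.1.le, hs.2.trans ht.2⟩)
            (fun s hs hsP => absurd (ha.2 ⟨hsP, hat0.trans hs.1.le, hs.2⟩) (not_le.2 hs.1))
        · intro s hs
          have := hM1' s ⟨haI.1.trans hs.1, hs.2.trans ht.2⟩
          have : 0 ≤ n * (2 * r) := by positivity
          linarith
        · intro s hs
          have := hM2' s ⟨haI.1.trans hs.1, hs.2.trans ht.2⟩
          have : 0 ≤ n * (2 * r) := by positivity
          linarith
  refine ⟨min d (r / 4), by positivity, 2 * N0, by positivity, fun t ht htd x y hx hy => ?_⟩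
  have hx' := abs_lt.1 (hx.trans_le (min_le_right _ _))
  have hy' := abs_lt.1 (hy.trans_le (min_le_right _ _))
  exact main t ht (htd.trans_le (min_le_left _ _)).le x ⟨by linarith, by linarith⟩ y
    ⟨by linarith, by linarith⟩

/-- consequences of regularity: joint continuity and uniform Lipschitz bounds on compact boxes -/
lemma L1a_cont {u f : ℝ → ℝ → ℝ} {C : ℝ} {L : ℝ → ℝ} {t1 t2 : ℝ}
    (h : Sol u f (Set.Icc t1 t2) C L) :
    ContinuousOn (fun z : ℝ × ℝ => u z.1 z.2) (Set.Icc t1 t2 ×ˢ Set.univ) := by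
  rintro ⟨t, x⟩ ⟨ht, -⟩
  exact (L1a h t ht x).continuousWithinAt (h.tcont x t ht)

lemma L1a_bound {u f : ℝ → ℝ → ℝ} {C : ℝ} {L : ℝ → ℝ} {t1 t2 : ℝ}
    (h : Sol u f (Set.Icc t1 t2) C L) (R : ℝ) :
    ∃ B, 0 ≤ B ∧ ∀ t ∈ Set.Icc t1 t2, ∀ x ∈ Set.Icc (-R) R, |u t x| ≤ B := by
  obtain ⟨M, hM⟩ := (isCompact_Icc.prod isCompact_Icc).exists_bound_of_continuousOn
    ((L1a_cont h).mono (Set.prod_mono subset_rfl (Set.subset_univ (Set.Icc (-R) R))))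
  exact ⟨max M 0, le_max_right _ _, fun t ht x hx =>
    (hM (t, x) ⟨ht, hx⟩).trans (le_max_left _ _)⟩

/-- uniform derivative bound on compact boxes -/
lemma L1a_deriv {u f : ℝ → ℝ → ℝ} {C : ℝ} {L : ℝ → ℝ} {t1 t2 : ℝ}
    (h : Sol u f (Set.Icc t1 t2) C L) (R : ℝ) :
    ∃ K, 0 ≤ K ∧ ∀ t ∈ Set.Icc t1 t2, ∀ x ∈ Set.Icc (-R) R, |deriv (u t) x| ≤ K := by
  have hloc : ∀ z ∈ Set.Icc t1 t2 ×ˢ Set.Icc (-R) R, ∃ V ∈ nhdsWithin z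
      (Set.Icc t1 t2 ×ˢ Set.Icc (-R) R), ∃ K, 0 ≤ K ∧ ∀ y ∈ V, |deriv (u y.1) y.2| ≤ K := by
    rintro ⟨t0, x0⟩ ⟨ht0, hx0⟩
    obtain ⟨δ, hδ, K, hK, H⟩ := L1a h t0 ht0 x0
    refine ⟨Metric.ball (t0, x0) δ ∩ (Set.Icc t1 t2 ×ˢ Set.Icc (-R) R),
      Filter.inter_mem (mem_nhdsWithin_of_mem_nhds (Metric.ball_mem_nhds _ hδ))
        self_mem_nhdsWithin, K, hK, ?_⟩
    rintro ⟨t, x⟩ ⟨hb, ht, hx⟩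
    rw [Metric.mem_ball, Prod.dist_eq, max_lt_iff, Real.dist_eq, Real.dist_eq] at hb
    simp only at hb ht ⊢
    have hd := h.hasDerivAt_x ht x
    have := hd.le_of_lip' hK (by
      have hop : ∀ᶠ y in nhds x, |y - x0| < δ :=
        (isOpen_lt (by fun_prop) continuous_const).mem_nhds hb.2
      filter_upwards [hop] with y hy
      exact H t ht hb.1 x y hb.2 hy)
    simpa using this
  refine (isCompact_Icc.prod isCompact_Icc).induction_on
    (p := fun V => ∃ K, 0 ≤ K ∧ ∀ y ∈ V, |deriv (u y.1) y.2| ≤ K)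
    ⟨0, le_rfl, by simp⟩ ?_ ?_ hloc |>.imp ?_
  · rintro s t hst ⟨K, hK, H⟩
    exact ⟨K, hK, fun y hy => H y (hst hy)⟩
  · rintro s t ⟨K, hK, H⟩ ⟨K', hK', H'⟩
    refine ⟨max K K', hK.trans (le_max_left _ _), ?_⟩
    rintro y (hy | hy)
    · exact (H y hy).trans (le_max_left _ _)
    · exact (H' y hy).trans (le_max_right _ _)
  · rintro K ⟨hK, H⟩
    exact ⟨hK, fun t ht x hx => H (t, x) ⟨ht, hx⟩⟩


/-! ### Level 1: cut-offs -/

/-- spatial cut-off -/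
def ph (a x : ℝ) : ℝ := th (1 - x ^ 2 / a ^ 4)

/-- derivative of the spatial cut-off -/
def phd (a x : ℝ) : ℝ := 2 * max (1 - x ^ 2 / a ^ 4) 0 * (-(2 * x / a ^ 4))

/-- truncation -/
def ec (a s : ℝ) : ℝ := s - max (s - a) 0 + max (-s - a) 0

/-- truncated square -/
def et (a s : ℝ) : ℝ := s ^ 2 - th (s - a) - th (-s - a)

/-- truncated flux -/
def qf (a s : ℝ) : ℝ := ∫ σ in (0:ℝ)..s, 2 * ec a σ * σ

lemma hasDerivAt_ph (a x : ℝ) : HasDerivAt (ph a) (phd a x) x := by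
  have h1 : HasDerivAt (fun y : ℝ => 1 - y ^ 2 / a ^ 4) (-(2 * x / a ^ 4)) x := by
    have := ((hasDerivAt_pow 2 x).div_const (a ^ 4)).const_sub 1
    simpa using this
  exact HasDerivAt.comp x (hasDerivAt_th (1 - x ^ 2 / a ^ 4)) h1

lemma continuous_ph (a : ℝ) : Continuous (ph a) :=
  continuous_iff_continuousAt.2 fun x => (hasDerivAt_ph a x).continuousAt

lemma continuous_phd (a : ℝ) : Continuous (phd a) := by
  unfold phd; fun_prop

lemma ph_nonneg (a x : ℝ) : 0 ≤ ph a x := th_nonneg _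

lemma ph_le_one {a : ℝ} (ha : 1 ≤ a) (x : ℝ) : ph a x ≤ 1 := by
  unfold ph th
  have h0 : 0 ≤ x ^ 2 / a ^ 4 := by positivity
  have h1 : max (1 - x ^ 2 / a ^ 4) 0 ≤ 1 := max_le (by linarith) (by norm_num)
  have h2 : 0 ≤ max (1 - x ^ 2 / a ^ 4) 0 := le_max_right _ _
  nlinarith

lemma ph_aux {a : ℝ} (ha : 1 ≤ a) {x : ℝ} (hx : a ^ 2 ≤ |x|) : 1 - x ^ 2 / a ^ 4 ≤ 0 := by
  have h4 : 0 < a ^ 4 := by positivity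
  rw [sub_nonpos, le_div_iff₀ h4, ← sq_abs x]
  have h2 : 0 ≤ a ^ 2 := by positivity
  nlinarith

lemma ph_zero {a : ℝ} (ha : 1 ≤ a) {x : ℝ} (hx : a ^ 2 ≤ |x|) : ph a x = 0 := 
  th_of_nonpos (ph_aux ha hx)

lemma phd_zero {a : ℝ} (ha : 1 ≤ a) {x : ℝ} (hx : a ^ 2 ≤ |x|) : phd a x = 0 := by
  unfold phd
  rw [max_eq_right (ph_aux ha hx)]; ring

lemma phd_abs_le {a : ℝ} (ha : 1 ≤ a) (x : ℝ) : |phd a x| ≤ 4 / a ^ 2 := by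
  rcases le_total (a ^ 2) |x| with hx | hx
  · rw [phd_zero ha hx, abs_zero]; positivity
  · unfold phd
    have h0 : 0 ≤ x ^ 2 / a ^ 4 := by positivity
    have h1 : max (1 - x ^ 2 / a ^ 4) 0 ≤ 1 := max_le (by linarith) (by norm_num)
    have h2 : 0 ≤ max (1 - x ^ 2 / a ^ 4) 0 := le_max_right _ _
    have ha0 : 0 < a := by linarith
    have h3 : |-(2 * x / a ^ 4)| ≤ 2 / a ^ 2 := by
      rw [abs_neg, abs_div, abs_mul, abs_of_pos (by norm_num : (0:ℝ) < 2),
        abs_of_pos (by positivity : 0 < a ^ 4), div_le_div_iff₀ (by positivity) (by positivity)]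
      have : 0 < a ^ 2 := by positivity
      nlinarith
    rw [abs_mul, abs_mul, abs_of_pos (by norm_num : (0:ℝ) < 2), abs_of_nonneg h2]
    have h5 : 0 ≤ 2 / a ^ 2 := by positivity
    calc 2 * max (1 - x ^ 2 / a ^ 4) 0 * |-(2 * x / a ^ 4)| ≤ 2 * 1 * (2 / a ^ 2) := by gcongr
      _ = 4 / a ^ 2 := by ring

lemma tendsto_na : Tendsto (fun n : ℕ => (n:ℝ) + 1) atTop atTop :=
  tendsto_atTop_add_const_right _ _ tendsto_natCast_atTop_atTop

lemma tendsto_ph (x : ℝ) : Tendsto (fun n : ℕ => ph ((n:ℝ) + 1) x) atTop (nhds 1) := by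
  have h1 : Tendsto (fun n : ℕ => 1 - x ^ 2 / ((n:ℝ) + 1) ^ 4) atTop (nhds (1 - 0)) :=
    tendsto_const_nhds.sub (Tendsto.const_div_atTop
      ((tendsto_pow_atTop (by norm_num : (4:ℕ) ≠ 0)).comp tendsto_na) _)
  have h2 := (continuous_th.tendsto (1 - 0)).comp h1
  have h3 : th (1 - 0) = 1 := by rw [th_of_nonneg (by norm_num)]; norm_num
  rw [h3] at h2
  exact h2

lemma tendsto_4a : Tendsto (fun n : ℕ => 4 / ((n:ℝ) + 1)) atTop (nhds 0) :=
  Tendsto.const_div_atTop tendsto_na _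

lemma phd_abs_le' (n : ℕ) (x : ℝ) : |phd ((n:ℝ) + 1) x| ≤ 4 / ((n:ℝ) + 1) := by
  have hn : (0:ℝ) ≤ n := Nat.cast_nonneg n
  refine (phd_abs_le (by linarith) x).trans ?_
  apply div_le_div_of_nonneg_left (by norm_num) (by positivity)
  nlinarith

lemma ec_le {a : ℝ} (ha : 0 ≤ a) (s : ℝ) : |ec a s| ≤ |s| := by
  unfold ec
  rcases max_cases (s - a) 0 with h | h <;> rcases max_cases (-s - a) 0 with h' | h' <;>
  rcases abs_cases s with h'' | h'' <;> rw [abs_le] <;> constructor <;> linarith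

lemma ec_le_a {a : ℝ} (ha : 0 ≤ a) (s : ℝ) : |ec a s| ≤ a := by
  unfold ec
  rcases max_cases (s - a) 0 with h | h <;> rcases max_cases (-s - a) 0 with h' | h' <;>
  rw [abs_le] <;> constructor <;> linarith

lemma ec_eq {a s : ℝ} (h : |s| ≤ a) : ec a s = s := by
  unfold ec
  rw [abs_le] at h
  rw [max_eq_right (by linarith), max_eq_right (by linarith)]; ring

lemma continuous_ec (a : ℝ) : Continuous (ec a) := by unfold ec; fun_prop

lemma hasDerivAt_et (a s : ℝ) : HasDerivAt (et a) (2 * ec a s) s := by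
  have i1 : HasDerivAt (fun s : ℝ => s - a) 1 s := (hasDerivAt_id s).sub_const a
  have i2 : HasDerivAt (fun s : ℝ => -s - a) (-1) s := (hasDerivAt_id s).neg.sub_const a
  have h1 : HasDerivAt (fun s : ℝ => th (s - a)) (2 * max (s - a) 0 * 1) s :=
    HasDerivAt.comp (h₂ := th) (h := fun s => s - a) s (hasDerivAt_th (s - a)) i1
  have h2 : HasDerivAt (fun s : ℝ => th (-s - a)) (2 * max (-s - a) 0 * (-1)) s :=
    HasDerivAt.comp (h₂ := th) (h := fun s => -s - a) s (hasDerivAt_th (-s - a)) i2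
  have h3 := ((hasDerivAt_pow 2 s).sub h1).sub h2
  refine h3.congr_deriv ?_
  unfold ec; simp; ring

lemma continuous_et (a : ℝ) : Continuous (et a) :=
  continuous_iff_continuousAt.2 fun x => (hasDerivAt_et a x).continuousAt

lemma et_eq {a s : ℝ} (h : |s| ≤ a) : et a s = s ^ 2 := by
  unfold et
  rw [abs_le] at h
  rw [th_of_nonpos (by linarith), th_of_nonpos (by linarith)]; ring

lemma et_le {a : ℝ} (ha : 0 ≤ a) (s : ℝ) : |et a s| ≤ s ^ 2 := by
  unfold et th
  rw [abs_le]
  rcases max_cases (s - a) 0 with h | h <;> rcases max_cases (-s - a) 0 with h' | h' <;>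
  rw [h.1, h'.1] <;> constructor <;> nlinarith

lemma hasDerivAt_qf (a s : ℝ) : HasDerivAt (qf a) (2 * ec a s * s) s := by
  have hc : Continuous (fun σ => 2 * ec a σ * σ) := by
    have := continuous_ec a
    fun_prop
  exact intervalIntegral.integral_hasDerivAt_right (hc.intervalIntegrable _ _)
    hc.stronglyMeasurable.stronglyMeasurableAtFilter hc.continuousAt

lemma qf_le {a : ℝ} (ha : 0 ≤ a) (s : ℝ) : |qf a s| ≤ 2 * a * s ^ 2 := by
  unfold qf
  have := intervalIntegral.norm_integral_le_of_norm_le_const (a := 0) (b := s)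
    (f := fun σ => 2 * ec a σ * σ) (C := 2 * a * |s|) (by
      intro σ hσ
      have h1 : |σ| ≤ |s| := by
        rw [Set.uIoc_eq_union] at hσ
        rcases hσ with h | h
        · rw [abs_of_pos h.1, abs_of_pos (h.1.trans_le h.2)]; exact h.2
        · rw [abs_of_nonpos h.2, abs_of_neg (h.1.trans_le h.2)]; linarith [h.1]
      rw [Real.norm_eq_abs, abs_mul, abs_mul, abs_of_pos (by norm_num : (0:ℝ) < 2)]
      have := ec_le_a ha σ
      gcongr)
  rw [Real.norm_eq_abs, sub_zero] at this
  calc _ ≤ _ := this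
    _ = 2 * a * |s| ^ 2 := by ring
    _ = _ := by rw [sq_abs]

lemma eventually_ec (s : ℝ) : ∀ᶠ n : ℕ in atTop, |s| ≤ (n:ℝ) + 1 :=
  tendsto_na.eventually_ge_atTop _

lemma FTClim {E e : ℕ → ℝ → ℝ} {t1 t2 K q1 q2 : ℝ} (h12 : t1 ≤ t2)
    (hc : ∀ n, ContinuousOn (E n) (Set.Icc t1 t2))
    (hd : ∀ n, ∀ t ∈ Set.Ioo t1 t2, HasDerivAt (E n) (e n t) t)
    (hK : ∀ n, ∀ t ∈ Set.Ioo t1 t2, |e n t| ≤ K)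
    (h0 : ∀ t ∈ Set.Ioo t1 t2, Tendsto (fun n => e n t) atTop (nhds 0))
    (h1 : Tendsto (fun n => E n t1) atTop (nhds q1))
    (h2 : Tendsto (fun n => E n t2) atTop (nhds q2)) : q1 = q2 := by
  have hae : ∀ᵐ t ∂(volume.restrict (Set.Ioc t1 t2)), t ∈ Set.Ioo t1 t2 := by
    rw [← restrict_Ioo_eq_restrict_Ioc]
    exact ae_restrict_mem measurableSet_Ioo
  have hintg : ∀ n, IntegrableOn (deriv (E n)) (Set.Ioc t1 t2) := by
    intro n
    refine Integrable.mono' (g := fun _ => K) (integrableOn_const (by simp)) 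
      (measurable_deriv (E n)).aestronglyMeasurable ?_
    filter_upwards [hae] with t ht
    rw [(hd n t ht).deriv]; exact hK n t ht
  have hF : ∀ n, ∫ t in t1..t2, deriv (E n) t = E n t2 - E n t1 := by
    intro n
    apply intervalIntegral.integral_eq_sub_of_hasDerivAt_of_le h12 (hc n)
    · intro t ht; rw [(hd n t ht).deriv]; exact hd n t ht
    · rw [intervalIntegrable_iff_integrableOn_Ioc_of_le h12]; exact hintg n
  have hl : Tendsto (fun n => ∫ t in t1..t2, deriv (E n) t) atTop (nhds 0) := by
    have : Tendsto (fun n => ∫ t in Set.Ioc t1 t2, deriv (E n) t) atTop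
        (nhds (∫ t in Set.Ioc t1 t2, (0:ℝ))) := by
      apply tendsto_integral_of_dominated_convergence (fun _ => K)
      · intro n; exact (measurable_deriv (E n)).aestronglyMeasurable
      · exact integrableOn_const (by simp)
      · intro n
        filter_upwards [hae] with t ht
        rw [(hd n t ht).deriv]; exact hK n t ht
      · filter_upwards [hae] with t ht
        refine (h0 t ht).congr fun n => ?_
        rw [(hd n t ht).deriv]
    simp only [intervalIntegral.integral_of_le h12]
    simpa using this
  simp only [hF] at hl
  have := tendsto_nhds_unique hl (h2.sub h1)
  linarith


/-! ### Level 1: the truncated energy, static part -/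

/-- cut-off profile -/
def wp (a : ℝ) (w : ℝ → ℝ) (x : ℝ) : ℝ := w x * ph a x

lemma continuous_wp {a : ℝ} {w : ℝ → ℝ} (hc : Continuous w) : Continuous (wp a w) :=
  hc.mul (continuous_ph a)

lemma wp_abs_le {a : ℝ} (ha : 1 ≤ a) (w : ℝ → ℝ) (x : ℝ) : |wp a w x| ≤ |w x| := by
  unfold wp
  rw [abs_mul, abs_of_nonneg (ph_nonneg a x)]
  exact mul_le_of_le_one_right (abs_nonneg _) (ph_le_one ha x)

lemma wp_sq_int {a : ℝ} (ha : 1 ≤ a) {w : ℝ → ℝ} (hc : Continuous w)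
    (h2 : Integrable (fun y => w y ^ 2)) : Integrable (fun y => wp a w y ^ 2) :=
  integrable_sq_of_le (continuous_wp hc) h2 fun x => by
    rw [← sq_abs (w x)]; exact sq_le_of_abs_le (wp_abs_le ha w x)

lemma bb_wp_le {a : ℝ} (ha : 1 ≤ a) {w : ℝ → ℝ} (hc : Continuous w)
    (h2 : Integrable (fun y => w y ^ 2)) (x : ℝ) : bb (wp a w) x ≤ bb w x := by
  unfold bb
  have := KP_mono (KI_abs_of_sq (by norm_num : (0:ℝ) < 2) (continuous_wp hc) (wp_sq_int ha hc h2))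
    (KI_abs_of_sq (by norm_num : (0:ℝ) < 2) hc h2) (wp_abs_le ha w) x
  linarith

lemma tendsto_wp (w : ℝ → ℝ) (x : ℝ) :
    Tendsto (fun n : ℕ => wp ((n:ℝ) + 1) w x) atTop (nhds (w x)) := by
  simpa [wp] using (tendsto_ph x).const_mul (w x)

lemma one_le_na (n : ℕ) : (1:ℝ) ≤ (n:ℝ) + 1 := by
  have : (0:ℝ) ≤ n := Nat.cast_nonneg n
  linarith

lemma tendsto_vv {w : ℝ → ℝ} (hc : Continuous w)
    (h2 : Integrable (fun y => w y ^ 2)) (x : ℝ) :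
    Tendsto (fun n : ℕ => vv (wp ((n:ℝ) + 1) w) x) atTop (nhds (vv w x)) := by
  unfold vv KP
  apply Tendsto.const_mul
  apply tendsto_integral_of_dominated_convergence (fun y => Real.exp (-(2 * |x - y|)) * |w y|)
  · intro n
    have := continuous_wp (a := (n:ℝ) + 1) hc
    exact Continuous.aestronglyMeasurable (by fun_prop)
  · exact KI_abs_of_sq (by norm_num : (0:ℝ) < 2) hc h2 x
  · intro n
    refine Eventually.of_forall fun y => ?_
    rw [Real.norm_eq_abs, abs_mul, Real.abs_exp]
    exact mul_le_mul_of_nonneg_left (wp_abs_le (one_le_na n) w y) (Real.exp_pos _).le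
  · exact Eventually.of_forall fun y => (tendsto_wp w y).const_mul _

lemma tendsto_vd {w : ℝ → ℝ} (hc : Continuous w)
    (h2 : Integrable (fun y => w y ^ 2)) (x : ℝ) :
    Tendsto (fun n : ℕ => vd (wp ((n:ℝ) + 1) w) x) atTop (nhds (vd w x)) := by
  unfold vd KD KA KB
  have hk := KI_abs_of_sq (by norm_num : (0:ℝ) < 2) hc h2
  apply Tendsto.const_mul
  apply Tendsto.const_mul
  apply Tendsto.sub
  · apply tendsto_integral_of_dominated_convergence (fun y => Real.exp (2 * (x - y)) * |w y|)
    · intro n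
      have := continuous_wp (a := (n:ℝ) + 1) hc
      exact Continuous.aestronglyMeasurable (by fun_prop)
    · exact hk.ioi x
    · intro n
      refine Eventually.of_forall fun y => ?_
      rw [Real.norm_eq_abs, abs_mul, Real.abs_exp]
      exact mul_le_mul_of_nonneg_left (wp_abs_le (one_le_na n) w y) (Real.exp_pos _).le
    · exact Eventually.of_forall fun y => (tendsto_wp w y).const_mul _
  · apply tendsto_integral_of_dominated_convergence (fun y => Real.exp (2 * (y - x)) * |w y|)
    · intro n
      have := continuous_wp (a := (n:ℝ) + 1) hc
      exact Continuous.aestronglyMeasurable (by fun_prop)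
    · exact hk.iic x
    · intro n
      refine Eventually.of_forall fun y => ?_
      rw [Real.norm_eq_abs, abs_mul, Real.abs_exp]
      exact mul_le_mul_of_nonneg_left (wp_abs_le (one_le_na n) w y) (Real.exp_pos _).le
    · exact Eventually.of_forall fun y => (tendsto_wp w y).const_mul _

/-- truncated energy -/
def En (a : ℝ) (w : ℝ → ℝ) : ℝ :=
  (∫ x, et a (w x) * ph a x) - 3 * ∫ x, wp a w x * vv (wp a w) x

/-- time derivative density of the truncated energy -/
def Dn (κ a : ℝ) (w : ℝ → ℝ) (x : ℝ) : ℝ :=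
  qf a (w x) * phd a x - 2 * ec a (w x) * ff κ w x * ph a x
    - 6 * ((w x ^ 2 / 2 + PP κ w x) * (phd a x * vv (wp a w) x + ph a x * vd (wp a w) x))

lemma vv_wp_le {a : ℝ} (ha : 1 ≤ a) {w : ℝ → ℝ} (hc : Continuous w)
    (h2 : Integrable (fun y => w y ^ 2)) (x : ℝ) : |vv (wp a w) x| ≤ bb w x :=
  (vv_abs_le _ x).trans (bb_wp_le ha hc h2 x)

lemma vd_wp_le {a : ℝ} (ha : 1 ≤ a) {w : ℝ → ℝ} (hc : Continuous w)
    (h2 : Integrable (fun y => w y ^ 2)) (x : ℝ) : |vd (wp a w) x| ≤ bb w x :=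
  (vd_abs_le (KI_of_sq (by norm_num) (continuous_wp hc) (wp_sq_int ha hc h2)) x).trans
    (bb_wp_le ha hc h2 x)

lemma tendsto_En {w : ℝ → ℝ} (hc : Continuous w)
    (h2 : Integrable (fun y => w y ^ 2)) :
    Tendsto (fun n : ℕ => En ((n:ℝ) + 1) w) atTop (nhds (QQ w)) := by
  unfold En QQ
  apply Tendsto.sub
  · apply tendsto_integral_of_dominated_convergence (fun y => w y ^ 2)
    · intro n
      have h1 := (continuous_et ((n:ℝ) + 1)).comp hc
      have h2 := continuous_ph ((n:ℝ) + 1)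
      exact (h1.mul h2).aestronglyMeasurable
    · exact h2
    · intro n
      refine Eventually.of_forall fun y => ?_
      have h1 := et_le (by linarith [one_le_na n]) (w y) (a := (n:ℝ) + 1)
      rw [Real.norm_eq_abs, abs_mul, abs_of_nonneg (ph_nonneg _ y)]
      exact (mul_le_of_le_one_right (abs_nonneg _) (ph_le_one (one_le_na n) y)).trans h1
    · refine Eventually.of_forall fun y => ?_
      have h1 : Tendsto (fun n : ℕ => et ((n:ℝ) + 1) (w y)) atTop (nhds (w y ^ 2)) := by
        apply tendsto_const_nhds.congr'
        filter_upwards [eventually_ec (w y)] with n hn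
        rw [et_eq hn]
      simpa using h1.mul (tendsto_ph y)
  · apply Tendsto.const_mul
    apply tendsto_integral_of_dominated_convergence (fun y => |w y| * bb w y)
    · intro n
      exact ((continuous_wp hc).mul (continuous_vv (continuous_wp hc) 
        (wp_sq_int (one_le_na n) hc h2))).aestronglyMeasurable
    · exact integrable_mul_of_sq hc.abs (continuous_bb hc h2) (by simpa using h2) (bb_sq_int hc h2)
    · intro n
      refine Eventually.of_forall fun y => ?_
      rw [Real.norm_eq_abs, abs_mul]
      exact mul_le_mul (wp_abs_le (one_le_na n) w y) (vv_wp_le (one_le_na n) hc h2 y)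
        (abs_nonneg _) (abs_nonneg _)
    · exact Eventually.of_forall fun y => (tendsto_wp w y).mul (tendsto_vv hc h2 y)

/-- dominating density -/
def dom (κ N : ℝ) (w : ℝ → ℝ) (x : ℝ) : ℝ :=
  (24 + 15 * N) * w x ^ 2 + 16 * ((1/2) * KP 1 (fun y => |gg κ w y|) x) ^ 2 + 15 * bb w x ^ 2

/-- bound for the truncated energy dissipation -/
def KK (κ N : ℝ) : ℝ := (24 + 15 * N) * N + 16 * (C2 κ N * N) + 15 * N

lemma dom_int {κ : ℝ} (hκ : 0 ≤ κ) {w : ℝ → ℝ} (hc : Continuous w)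
    (h2 : Integrable (fun y => w y ^ 2)) {N : ℝ} (hN : ∫ y, w y ^ 2 ≤ N) :
    Integrable (dom κ N w) ∧ ∫ x, dom κ N w x ≤ KK κ N := by
  obtain ⟨h3, h4⟩ := pi_sq_integral_le hκ hc h2 hN
  have h5 := bb_sq_int hc h2
  have h6 := bb_sq_integral_le hc h2
  have hN0 : 0 ≤ N := le_trans (integral_nonneg fun x => sq_nonneg _) hN
  have i1 : Integrable (fun x => (24 + 15 * N) * w x ^ 2) := h2.const_mul _
  have i2 : Integrable (fun x => 16 * ((1/2) * KP 1 (fun y => |gg κ w y|) x) ^ 2) := h3.const_mul _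
  have i3 : Integrable (fun x => 15 * bb w x ^ 2) := h5.const_mul _
  have i12 : Integrable (fun x => (24 + 15 * N) * w x ^ 2 
    + 16 * ((1/2) * KP 1 (fun y => |gg κ w y|) x) ^ 2) := i1.add i2
  refine ⟨i12.add i3, ?_⟩
  unfold dom KK
  rw [integral_add i12 i3, integral_add i1 i2, integral_const_mul, integral_const_mul,
    integral_const_mul]
  have : (24 + 15 * N) * ∫ y, w y ^ 2 ≤ (24 + 15 * N) * N :=
    mul_le_mul_of_nonneg_left hN (by positivity)
  linarith

lemma Dn_le {κ : ℝ} (hκ : 0 ≤ κ) {w : ℝ → ℝ} (hc : Continuous w)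
    (h2 : Integrable (fun y => w y ^ 2)) {N : ℝ} (hN : ∫ y, w y ^ 2 ≤ N) (n : ℕ) (x : ℝ) :
    |Dn κ ((n:ℝ) + 1) w x| ≤ dom κ N w x := by
  set a : ℝ := (n:ℝ) + 1 with ha'
  have ha : 1 ≤ a := one_le_na n
  have hN0 : 0 ≤ N := le_trans (integral_nonneg fun x => sq_nonneg _) hN
  have hv := vv_wp_le ha hc h2 x
  have hvd := vd_wp_le ha hc h2 x
  have hb1 := bb_le hc h2 hN x
  have hb0 := bb_nonneg w x
  have hP := PP_abs_le (κ := κ) w x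
  have hf := ff_abs_le (κ := κ) hc h2 x
  unfold Dn dom
  set p := (1/2) * KP 1 (fun y => |gg κ w y|) x with hp
  set b := bb w x
  have hp0 : 0 ≤ p := (abs_nonneg _).trans hP
  have hph0 := ph_nonneg a x
  have hph1 := ph_le_one ha x
  have hpd := phd_abs_le ha x
  have hpd4 : |phd a x| ≤ 4 := hpd.trans (by
    rw [div_le_iff₀ (by positivity)]; nlinarith)
  have e1 : |qf a (w x) * phd a x| ≤ 8 * w x ^ 2 := by
    rw [abs_mul]
    calc _ ≤ (2 * a * w x ^ 2) * (4 / a ^ 2) :=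
          mul_le_mul (qf_le (by linarith) _) hpd (abs_nonneg _) (by positivity)
      _ = 8 * w x ^ 2 / a := by field_simp; ring
      _ ≤ 8 * w x ^ 2 := div_le_self (by positivity) ha
  have e2 : |2 * ec a (w x) * ff κ w x * ph a x| ≤ w x ^ 2 + p ^ 2 := by
    rw [abs_mul, abs_mul, abs_mul, abs_of_nonneg hph0, abs_of_pos (by norm_num : (0:ℝ) < 2)]
    have := ec_le (by linarith : 0 ≤ a) (w x)
    calc _ ≤ 2 * |w x| * p * 1 := by gcongr
      _ ≤ |w x| ^ 2 + p ^ 2 := by nlinarith [sq_nonneg (|w x| - p)]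
      _ = _ := by rw [sq_abs]
  have e3 : |phd a x * vv (wp a w) x + ph a x * vd (wp a w) x| ≤ 5 * b := by
    calc _ ≤ |phd a x * vv (wp a w) x| + |ph a x * vd (wp a w) x| := abs_add_le _ _
      _ ≤ 4 * b + 1 * b := by
        rw [abs_mul, abs_mul, abs_of_nonneg hph0]; gcongr
      _ = 5 * b := by ring
  have e4 : |w x ^ 2 / 2 + PP κ w x| ≤ w x ^ 2 / 2 + p := by
    calc _ ≤ |w x ^ 2 / 2| + |PP κ w x| := abs_add_le _ _
      _ ≤ _ := by rw [abs_of_nonneg (by positivity)]; linarith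
  have e5 : |(w x ^ 2 / 2 + PP κ w x) * (phd a x * vv (wp a w) x + ph a x * vd (wp a w) x)| ≤
      (w x ^ 2 / 2 + p) * (5 * b) := by
    rw [abs_mul]; gcongr
  have e6 : (w x ^ 2 / 2 + p) * (5 * b) ≤ (5/2) * (1 + N) * w x ^ 2 + (5/2) * (p ^ 2 + b ^ 2) := by
    nlinarith [sq_nonneg (p - b), mul_le_mul_of_nonneg_left hb1 (sq_nonneg (w x))]
  rw [abs_le] at *
  constructor <;> nlinarith

lemma continuous_Dn {κ a : ℝ} (ha : 1 ≤ a) {w : ℝ → ℝ} (hc : Continuous w)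
    (h2 : Integrable (fun y => w y ^ 2)) : Continuous (Dn κ a w) := by
  have hq : Continuous (qf a) :=
    continuous_iff_continuousAt.2 fun x => (hasDerivAt_qf a x).continuousAt
  have c1 := hq.comp hc
  have c2 := (continuous_ec a).comp hc
  have c3 := continuous_ff (κ := κ) hc h2
  have c4 := continuous_PP (κ := κ) hc h2
  have c5 := continuous_vv (continuous_wp (a := a) hc) (wp_sq_int ha hc h2)
  have c6 := continuous_vd (continuous_wp (a := a) hc) (wp_sq_int ha hc h2)
  have c7 := continuous_ph a
  have c8 := continuous_phd a
  simp only [Function.comp_def] at c1 c2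
  unfold Dn
  fun_prop

lemma Dn_integral_le {κ : ℝ} (hκ : 0 ≤ κ) {w : ℝ → ℝ} (hc : Continuous w)
    (h2 : Integrable (fun y => w y ^ 2)) {N : ℝ} (hN : ∫ y, w y ^ 2 ≤ N) (n : ℕ) :
    |∫ x, Dn κ ((n:ℝ) + 1) w x| ≤ KK κ N := by
  obtain ⟨h3, h4⟩ := dom_int hκ hc h2 hN
  have := norm_integral_le_of_norm_le (f := Dn κ ((n:ℝ) + 1) w) h3 (Eventually.of_forall (Dn_le hκ hc h2 hN n))
  exact this.trans h4

lemma Dn_tendsto {κ : ℝ} (hκ : 0 ≤ κ) {w : ℝ → ℝ} (hc : Continuous w)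
    (h2 : Integrable (fun y => w y ^ 2)) {N : ℝ} (hN : ∫ y, w y ^ 2 ≤ N) :
    Tendsto (fun n : ℕ => ∫ x, Dn κ ((n:ℝ) + 1) w x) atTop (nhds 0) := by
  rw [← static_identity hκ hc h2]
  apply tendsto_integral_of_dominated_convergence (dom κ N w)
  · intro n; exact (continuous_Dn (one_le_na n) hc h2).aestronglyMeasurable
  · exact (dom_int hκ hc h2 hN).1
  · intro n; exact Eventually.of_forall (Dn_le hκ hc h2 hN n)
  · refine Eventually.of_forall fun x => ?_
    have hpd : Tendsto (fun n : ℕ => phd ((n:ℝ) + 1) x) atTop (nhds 0) :=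
      squeeze_zero_norm (fun n => phd_abs_le' n x) tendsto_4a
    have hq : Tendsto (fun n : ℕ => qf ((n:ℝ) + 1) (w x) * phd ((n:ℝ) + 1) x) atTop (nhds 0) := by
      apply squeeze_zero_norm (a := fun n : ℕ => 2 * w x ^ 2 * (4 / ((n:ℝ) + 1)))
      · intro n
        have ha := one_le_na n
        rw [Real.norm_eq_abs, abs_mul]
        calc _ ≤ (2 * ((n:ℝ) + 1) * w x ^ 2) * (4 / ((n:ℝ) + 1) ^ 2) :=
              mul_le_mul (qf_le (by linarith) _) (phd_abs_le ha x) (abs_nonneg _) (by positivity)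
          _ = _ := by field_simp
      · simpa using tendsto_4a.const_mul (2 * w x ^ 2)
    have he : Tendsto (fun n : ℕ => ec ((n:ℝ) + 1) (w x)) atTop (nhds (w x)) := by
      apply tendsto_const_nhds.congr'
      filter_upwards [eventually_ec (w x)] with n hn
      rw [ec_eq hn]
    have h3 := (hpd.mul (tendsto_vv hc h2 x)).add ((tendsto_ph x).mul (tendsto_vd hc h2 x))
    have h4 := (hq.sub (((he.const_mul 2).mul_const (ff κ w x)).mul (tendsto_ph x))).sub
      ((h3.const_mul (w x ^ 2 / 2 + PP κ w x)).const_mul 6)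
    have e : -(2 * (w x * ff κ w x)) - 6 * ((w x ^ 2 / 2 + PP κ w x) * vd w x) =
      0 - 2 * w x * ff κ w x * 1 -
        6 * ((w x ^ 2 / 2 + PP κ w x) * (0 * vv w x + 1 * vd w x)) := by ring
    rw [e]
    exact h4


/-! ### Level 1: dynamics of the truncated energy -/

/-- The solution bundle used below. -/
structure DPsol (κ : ℝ) (u : ℝ → ℝ → ℝ) : Prop where
  kpos : 0 < κ
  cd : ∀ t, 0 ≤ t → ContDiff ℝ 2 (u t)
  l2 : ∀ t, 0 ≤ t → Integrable (fun x => u t x ^ 2)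
  eq : ∀ t, 0 ≤ t → ∀ x, HasDerivAt (fun s => u s x)
    (-(u t x * deriv (u t) x) - ff κ (u t) x) t

lemma DPsol.of {κ : ℝ} (hκ : 0 < κ) {u : ℝ → ℝ → ℝ}
    (hreg : ∀ t ∈ Set.Ici (0:ℝ), ContDiff ℝ 2 (u t) ∧ MemLp (u t) 2 volume)
    (husol : IsDPSolution κ (Set.Ici 0) u) : DPsol κ u := by
  refine ⟨hκ, fun t ht => (hreg t ht).1, fun t ht => (hreg t ht).2.integrable_sq, ?_⟩
  intro t ht x
  have h1 := husol t ht x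
  rw [convol_pker_eq] at h1
  have hc := (hreg t ht).1
  have hd : HasDerivAt (u t) (deriv (u t) x) x :=
    ((hc.differentiable (by norm_num)) x).hasDerivAt
  have h2 : HasDerivAt (fun y => (1/2) * (u t y) ^ 2 + PP κ (u t) y)
      ((1/2) * (2 * u t x * deriv (u t) x) + ff κ (u t) x) x := by
    have := ((hd.pow 2).const_mul (1/2)).add
      (hasDerivAt_PP (κ := κ) hc.continuous (hreg t ht).2.integrable_sq x)
    refine this.congr_deriv ?_
    simp
  rw [h2.deriv] at h1
  refine h1.congr_deriv ?_
  ring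

lemma DPsol.sol {κ : ℝ} {u : ℝ → ℝ → ℝ} (h : DPsol κ u) {t1 t2 N : ℝ} (h1 : 0 ≤ t1)
    (hN0 : 0 ≤ N)
    (hN : ∀ t ∈ Set.Icc t1 t2, ∫ x, u t x ^ 2 ≤ N) :
    Sol u (fun t => ff κ (u t)) (Set.Icc t1 t2) (CC κ N)
      (fun B => CC κ N + ((3/2) * B ^ 2 + 2 * κ * B)) := by
  have hk := h.kpos
  have hCC := CC_nonneg hk.le hN0
  refine ⟨fun t ht => (h.cd t (h1.trans ht.1)).of_le (by norm_num), fun t ht x => 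
    h.eq t (h1.trans ht.1) x, fun t ht x => ?_, ?_, hCC, fun B hB => by positivity⟩
  · exact ff_bound hk.le (h.cd t (h1.trans ht.1)).continuous (h.l2 t (h1.trans ht.1)) (hN t ht) x
  · intro t ht B hB p q hpq hz
    have ht0 := h1.trans ht.1
    have hc := (h.cd t ht0).continuous
    have h2 := h.l2 t ht0
    have := (convex_Icc p q).norm_image_sub_le_of_norm_hasDerivWithin_le (f := ff κ (u t))
      (f' := fun z => PP κ (u t) z - gg κ (u t) z) (C := CC κ N + ((3/2) * B ^ 2 + 2 * κ * B))
      (fun z _ => (hasDerivAt_ff hc h2 z).hasDerivWithinAt) (fun z hzz => by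
        have e1 := PP_bound hk.le hc h2 (hN t ht) z
        have e2 := hz z hzz
        have e3 : u t z ^ 2 ≤ B ^ 2 := sq_le_of_abs_le e2
        have e4 : |gg κ (u t) z| ≤ (3/2) * B ^ 2 + 2 * κ * B := by
          unfold gg
          calc _ ≤ |(3/2) * u t z ^ 2| + |2 * κ * u t z| := abs_add_le _ _
            _ = (3/2) * u t z ^ 2 + 2 * κ * |u t z| := by
              rw [abs_of_nonneg (by positivity), abs_mul, abs_of_pos (by positivity : 0 < 2 * κ)]
            _ ≤ _ := by gcongr
        rw [Real.norm_eq_abs]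
        calc _ ≤ |PP κ (u t) z| + |gg κ (u t) z| := abs_sub _ _
          _ ≤ _ := by linarith)
      (Set.left_mem_Icc.2 hpq) (Set.right_mem_Icc.2 hpq)
    rwa [Real.norm_eq_abs, Real.norm_eq_abs, abs_of_nonneg (by linarith : 0 ≤ q - p)] at this

lemma PI1 {α : Type*} [MeasurableSpace α] {μ : Measure α} {F F' : ℝ → α → ℝ} {k : α → ℝ}
    {t1 t2 : ℝ}
    (hm : ∀ t ∈ Set.Icc t1 t2, AEStronglyMeasurable (F t) μ)
    (hm' : ∀ t ∈ Set.Icc t1 t2, AEStronglyMeasurable (F' t) μ)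
    (hk : Integrable k μ)
    (hb : ∀ t ∈ Set.Icc t1 t2, ∀ x, |F t x| ≤ k x)
    (hb' : ∀ t ∈ Set.Icc t1 t2, ∀ x, |F' t x| ≤ k x)
    (hd : ∀ t ∈ Set.Icc t1 t2, ∀ x, HasDerivAt (fun s => F s x) (F' t x) t) :
    ContinuousOn (fun t => ∫ x, F t x ∂μ) (Set.Icc t1 t2) ∧
    ∀ t ∈ Set.Ioo t1 t2, HasDerivAt (fun t => ∫ x, F t x ∂μ) (∫ x, F' t x ∂μ) t := by
  constructor
  · apply continuousOn_of_dominated hm (fun t ht => Eventually.of_forall (hb t ht)) hk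
    exact Eventually.of_forall fun x t ht => (hd t ht x).continuousAt.continuousWithinAt
  · intro t ht
    have hn : Set.Icc t1 t2 ∈ nhds t := Icc_mem_nhds ht.1 ht.2
    have ht' := Set.Ioo_subset_Icc_self ht
    refine (hasDerivAt_integral_of_dominated_loc_of_deriv_le hn ?_ ?_ (hm' t ht') ?_ hk ?_).2
    · filter_upwards [hn] with s hs using hm s hs
    · exact hk.mono' (hm t ht') (Eventually.of_forall (hb t ht'))
    · exact Eventually.of_forall fun x s hs => hb' s hs x
    · exact Eventually.of_forall fun x s hs => hd s hs x

lemma PI2 {W W' : ℝ → ℝ → ℝ} {k : ℝ → ℝ} {t1 t2 : ℝ}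
    (hm : ∀ t ∈ Set.Icc t1 t2, Continuous (W t))
    (hm' : ∀ t ∈ Set.Icc t1 t2, Continuous (W' t))
    (hk : Integrable k)
    (hb : ∀ t ∈ Set.Icc t1 t2, ∀ x, |W t x| ≤ k x)
    (hb' : ∀ t ∈ Set.Icc t1 t2, ∀ x, |W' t x| ≤ k x)
    (hd : ∀ t ∈ Set.Icc t1 t2, ∀ x, HasDerivAt (fun s => W s x) (W' t x) t) :
    ContinuousOn (fun t => ∫ x, W t x * vv (W t) x) (Set.Icc t1 t2) ∧
    ∀ t ∈ Set.Ioo t1 t2, HasDerivAt (fun t => ∫ x, W t x * vv (W t) x) 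
      (2 * ∫ x, W' t x * vv (W t) x) t := by
  set q : ℝ × ℝ → ℝ := fun z => Real.exp (-(2 * |z.1 - z.2|)) with hq
  have hqc : Continuous q := by rw [hq]; fun_prop
  have hq0 : ∀ z, 0 ≤ q z := fun z => (Real.exp_pos _).le
  have hq1 : ∀ z, q z ≤ 1 := fun z => ker_le_one (by norm_num) z.1 z.2
  have hk2 : Integrable (fun z : ℝ × ℝ => k z.1 * k z.2) (volume.prod volume) := hk.mul_prod hk
  have hcomb : ∀ {A B : ℝ → ℝ}, Continuous A → Continuous B → (∀ x, |A x| ≤ k x) →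
      (∀ x, |B x| ≤ k x) → Continuous (fun z : ℝ × ℝ => A z.1 * (q z * B z.2)) ∧
      (∀ z : ℝ × ℝ, |A z.1 * (q z * B z.2)| ≤ k z.1 * k z.2) ∧
      ∫ z : ℝ × ℝ, A z.1 * (q z * B z.2) ∂(volume.prod volume) = 4 * ∫ x, A x * vv B x := by
    intro A B hA hB hAk hBk
    have c : Continuous (fun z : ℝ × ℝ => A z.1 * (q z * B z.2)) := by fun_prop
    have b : ∀ z : ℝ × ℝ, |A z.1 * (q z * B z.2)| ≤ k z.1 * k z.2 := by
      intro z
      rw [abs_mul, abs_mul, abs_of_nonneg (hq0 z)]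
      refine mul_le_mul (hAk _) ?_ (mul_nonneg (hq0 z) (abs_nonneg _)) ((abs_nonneg _).trans (hAk _))
      calc q z * |B z.2| ≤ 1 * |B z.2| := mul_le_mul_of_nonneg_right (hq1 z) (abs_nonneg _)
        _ ≤ k z.2 := by rw [one_mul]; exact hBk _
    refine ⟨c, b, ?_⟩
    rw [integral_prod _ (hk2.mono' c.aestronglyMeasurable (Eventually.of_forall b)),
      ← integral_const_mul]
    congr 1; ext x
    simp only [hq]
    rw [integral_const_mul]
    unfold vv KP
    ring
  have main := PI1 (μ := (volume.prod volume : Measure (ℝ × ℝ))) (t1 := t1) (t2 := t2)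
    (F := fun t (z : ℝ × ℝ) => W t z.1 * (q z * W t z.2))
    (F' := fun t (z : ℝ × ℝ) => W' t z.1 * (q z * W t z.2) + W t z.1 * (q z * W' t z.2))
    (k := fun z => 2 * (k z.1 * k z.2))
    (fun t ht => (hcomb (hm t ht) (hm t ht) (hb t ht) (hb t ht)).1.aestronglyMeasurable)
    (fun t ht => ((hcomb (hm' t ht) (hm t ht) (hb' t ht) (hb t ht)).1.add 
      (hcomb (hm t ht) (hm' t ht) (hb t ht) (hb' t ht)).1).aestronglyMeasurable)
    (hk2.const_mul 2)
    (fun t ht z => by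
      have := (hcomb (hm t ht) (hm t ht) (hb t ht) (hb t ht)).2.1 z
      have := abs_nonneg (W t z.1 * (q z * W t z.2))
      linarith)
    (fun t ht z => by
      have e1 := (hcomb (hm' t ht) (hm t ht) (hb' t ht) (hb t ht)).2.1 z
      have e2 := (hcomb (hm t ht) (hm' t ht) (hb t ht) (hb' t ht)).2.1 z
      have := abs_add_le (W' t z.1 * (q z * W t z.2)) (W t z.1 * (q z * W' t z.2))
      linarith)
    (fun t ht z => (hd t ht z.1).mul ((hd t ht z.2).const_mul (q z)))
  have hE : ∀ t ∈ Set.Icc t1 t2, ∫ x, W t x * vv (W t) x =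
      (1/4) * ∫ z : ℝ × ℝ, W t z.1 * (q z * W t z.2) ∂(volume.prod volume) := by
    intro t ht
    rw [(hcomb (hm t ht) (hm t ht) (hb t ht) (hb t ht)).2.2]; ring
  constructor
  · exact (main.1.const_mul (1/4)).congr hE
  · intro t ht
    have ht' := Set.Ioo_subset_Icc_self ht
    have h1 := (main.2 t ht).const_mul (1/4)
    have h2 := h1.congr_of_eventuallyEq (f₁ := fun t => ∫ x, W t x * vv (W t) x) (by
      filter_upwards [Icc_mem_nhds ht.1 ht.2] with s hs using hE s hs)
    refine h2.congr_deriv ?_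
    obtain ⟨c1, b1, i1⟩ := hcomb (hm' t ht') (hm t ht') (hb' t ht') (hb t ht')
    obtain ⟨c2, b2, i2⟩ := hcomb (hm t ht') (hm' t ht') (hb t ht') (hb' t ht')
    rw [integral_add (hk2.mono' c1.aestronglyMeasurable (Eventually.of_forall b1))
      (hk2.mono' c2.aestronglyMeasurable (Eventually.of_forall b2)), i1]
    have hs : ∫ z : ℝ × ℝ, W t z.1 * (q z * W' t z.2) ∂(volume.prod volume) =
        ∫ z : ℝ × ℝ, W' t z.1 * (q z * W t z.2) ∂(volume.prod volume) := by
      rw [← integral_prod_swap]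
      congr 1; ext z
      simp only [hq, Prod.fst_swap, Prod.snd_swap]
      rw [abs_sub_comm]; ring
    rw [hs, i1]; ring

lemma cs_int {R : ℝ} {g : ℝ → ℝ} (hc : Continuous g) (h : ∀ x, R ≤ |x| → g x = 0) :
    Integrable g := by
  apply hc.integrable_of_hasCompactSupport
  apply HasCompactSupport.of_support_subset_isCompact (isCompact_Icc (a := -R) (b := R))
  intro x hx
  rw [Function.mem_support] at hx
  by_contra hh
  apply hx
  apply h
  by_contra h3
  push Not at h3
  rw [abs_lt] at h3
  exact hh ⟨h3.1.le, h3.2.le⟩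

lemma En_ibp {κ a : ℝ} (ha : 1 ≤ a) {w : ℝ → ℝ} (hc1 : ContDiff ℝ 1 w)
    (h2 : Integrable (fun y => w y ^ 2)) :
    (∫ x, 2 * ec a (w x) * (-(w x * deriv w x) - ff κ w x) * ph a x)
      - 3 * (2 * ∫ x, (-(w x * deriv w x) - ff κ w x) * ph a x * vv (wp a w) x)
      = ∫ x, Dn κ a w x := by
  have hc := hc1.continuous
  have hq : Continuous (qf a) :=
    continuous_iff_continuousAt.2 fun x => (hasDerivAt_qf a x).continuousAt
  have c1 := hq.comp hc
  have c2 := (continuous_ec a).comp hc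
  have c3 := continuous_ff (κ := κ) hc h2
  have c4 := continuous_PP (κ := κ) hc h2
  have c5 := continuous_vv (continuous_wp (a := a) hc) (wp_sq_int ha hc h2)
  have c6 := continuous_vd (continuous_wp (a := a) hc) (wp_sq_int ha hc h2)
  have c7 := continuous_ph a
  have c8 := continuous_phd a
  have c9 : Continuous (deriv w) := hc1.continuous_deriv (by norm_num)
  have cD := continuous_Dn (κ := κ) ha hc h2
  simp only [Function.comp_def] at c1 c2
  have iD : Integrable (Dn κ a w) := cs_int (R := a ^ 2) cD fun x hx => by
    unfold Dn; rw [ph_zero ha hx, phd_zero ha hx]; ring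
  set G : ℝ → ℝ := fun x => (-qf a (w x) + 6 * ((w x ^ 2 / 2 + PP κ w x) * vv (wp a w) x)) * ph a x
  set G' : ℝ → ℝ := fun x => (-(2 * ec a (w x) * w x * deriv w x) 
    + 6 * ((w x * deriv w x + ff κ w x) * vv (wp a w) x 
      + (w x ^ 2 / 2 + PP κ w x) * vd (wp a w) x)) * ph a x
    + (-qf a (w x) + 6 * ((w x ^ 2 / 2 + PP κ w x) * vv (wp a w) x)) * phd a x with hG'
  have hG : ∀ x, HasDerivAt G (G' x) x := by
    intro x
    have hw : HasDerivAt w (deriv w x) x :=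
      ((hc1.differentiable (by norm_num)) x).hasDerivAt
    have d1 : HasDerivAt (fun y => qf a (w y)) (2 * ec a (w x) * w x * deriv w x) x :=
      (hasDerivAt_qf a (w x)).comp x hw
    have d2 : HasDerivAt (fun y => w y ^ 2 / 2) (w x * deriv w x) x := by
      have := (hw.pow 2).div_const 2
      refine this.congr_deriv ?_
      simp only [Nat.cast_ofNat, Nat.add_one_sub_one, pow_one]; ring
    have d3 := (d2.add (hasDerivAt_PP (κ := κ) hc h2 x)).mul
      (hasDerivAt_vv (continuous_wp (a := a) hc) (wp_sq_int ha hc h2) x)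
    exact (d1.neg.add (d3.const_mul 6)).mul (hasDerivAt_ph a x)
  have cG : Continuous G := continuous_iff_continuousAt.2 fun x => (hG x).continuousAt
  have cG' : Continuous G' := by rw [hG']; fun_prop
  have iG : Integrable G := cs_int (R := a ^ 2) cG fun x hx => by
    simp only [G]; rw [ph_zero ha hx]; ring
  have iG' : Integrable G' := cs_int (R := a ^ 2) cG' fun x hx => by
    simp only [G']; rw [ph_zero ha hx, phd_zero ha hx]; ring
  have h0 := integral_eq_zero_of_hasDerivAt_of_integrable hG iG' iG
  have j1 : Integrable (fun x => 2 * ec a (w x) * (-(w x * deriv w x) - ff κ w x) * ph a x) :=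
    cs_int (R := a ^ 2) (by fun_prop) fun x hx => by rw [ph_zero ha hx]; ring
  have j2 : Integrable (fun x => (-(w x * deriv w x) - ff κ w x) * ph a x * vv (wp a w) x) :=
    cs_int (R := a ^ 2) (by fun_prop) fun x hx => by rw [ph_zero ha hx]; ring
  have e : ∫ x, (Dn κ a w x + G' x) = (∫ x, Dn κ a w x) + ∫ x, G' x := integral_add iD iG'
  rw [h0, add_zero] at e
  rw [← e, ← mul_assoc, ← integral_const_mul, ← integral_sub j1 (j2.const_mul _)]
  congr 1; ext x
  simp only [hG', Dn]
  ring

lemma DPsol.QQ_eq {κ : ℝ} {u : ℝ → ℝ → ℝ} (h : DPsol κ u) {t1 t2 N : ℝ} (h1 : 0 ≤ t1)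
    (h12 : t1 ≤ t2)
    (hN : ∀ t ∈ Set.Icc t1 t2, ∫ x, u t x ^ 2 ≤ N) : QQ (u t1) = QQ (u t2) := by
  have hN0 : 0 ≤ N := le_trans (integral_nonneg fun x => sq_nonneg _) (hN t1 ⟨le_rfl, h12⟩)
  have hS := h.sol h1 hN0 hN
  have hk := h.kpos.le
  have ht0 : ∀ t ∈ Set.Icc t1 t2, 0 ≤ t := fun t ht => h1.trans ht.1
  have hc : ∀ t ∈ Set.Icc t1 t2, Continuous (u t) := fun t ht => (h.cd t (ht0 t ht)).continuous
  have hl : ∀ t ∈ Set.Icc t1 t2, Integrable (fun x => u t x ^ 2) := fun t ht => h.l2 t (ht0 t ht)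
  have m1 : t1 ∈ Set.Icc t1 t2 := ⟨le_rfl, h12⟩
  have m2 : t2 ∈ Set.Icc t1 t2 := ⟨h12, le_rfl⟩
  have key : ∀ n : ℕ, ContinuousOn (fun t => En ((n:ℝ) + 1) (u t)) (Set.Icc t1 t2) ∧
      ∀ t ∈ Set.Ioo t1 t2, HasDerivAt (fun t => En ((n:ℝ) + 1) (u t))
        (∫ x, Dn κ ((n:ℝ) + 1) (u t) x) t := by
    intro n
    set a : ℝ := (n:ℝ) + 1
    have ha : 1 ≤ a := one_le_na n
    obtain ⟨B, hB0, hB⟩ := L1a_bound hS (a ^ 2)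
    obtain ⟨K, hK0, hK⟩ := L1a_deriv hS (a ^ 2)
    have hC := hS.Cnn
    set M : ℝ := B ^ 2 + B + (B * K + CC κ N) * (2 * a + 1) with hM
    set k : ℝ → ℝ := Set.indicator (Set.Icc (-a ^ 2) (a ^ 2)) (fun _ => M) with hk'
    have hki : Integrable k := by
      rw [hk', integrable_indicator_iff measurableSet_Icc]
      exact integrableOn_const (by simp)
    have hkk : ∀ {g : ℝ → ℝ}, (∀ x, a ^ 2 ≤ |x| → g x = 0) →
        (∀ x ∈ Set.Icc (-a ^ 2) (a ^ 2), |g x| ≤ M) → ∀ x, |g x| ≤ k x := by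
      intro g g0 g1 x
      by_cases hx : x ∈ Set.Icc (-a ^ 2) (a ^ 2)
      · rw [hk', Set.indicator_of_mem hx]; exact g1 x hx
      · rw [hk', Set.indicator_of_notMem hx, g0 x, abs_zero]
        by_contra h3
        push Not at h3
        rw [abs_lt] at h3
        exact hx ⟨h3.1.le, h3.2.le⟩
    have hut : ∀ t ∈ Set.Icc t1 t2, ∀ x ∈ Set.Icc (-a ^ 2) (a ^ 2),
        |-(u t x * deriv (u t) x) - ff κ (u t) x| ≤ B * K + CC κ N := by
      intro t ht x hx
      have e1 := hB t ht x hx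
      have e2 := hK t ht x hx
      have e3 := hS.fb t ht x
      calc _ ≤ |-(u t x * deriv (u t) x)| + |ff κ (u t) x| := abs_sub _ _
        _ ≤ B * K + CC κ N := by
          rw [abs_neg, abs_mul]
          have := mul_le_mul e1 e2 (abs_nonneg _) hB0
          linarith
    have hcd : ∀ t ∈ Set.Icc t1 t2, Continuous (deriv (u t)) := fun t ht =>
      (h.cd t (ht0 t ht)).continuous_deriv (by norm_num)
    have hutc : ∀ t ∈ Set.Icc t1 t2, Continuous 
        (fun x => -(u t x * deriv (u t) x) - ff κ (u t) x) := fun t ht => by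
      have := hc t ht
      have := hcd t ht
      have := continuous_ff (κ := κ) (hc t ht) (hl t ht)
      fun_prop
    have hBK : 0 ≤ B * K + CC κ N := by positivity
    have hph : ∀ x, |ph a x| ≤ 1 := fun x => by
      rw [abs_of_nonneg (ph_nonneg a x)]; exact ph_le_one ha x
    have A1 := PI1 (μ := volume) (t1 := t1) (t2 := t2) (k := k)
      (F := fun t x => et a (u t x) * ph a x)
      (F' := fun t x => 2 * ec a (u t x) * (-(u t x * deriv (u t) x) - ff κ (u t) x) * ph a x)
      (fun t ht => (((continuous_et a).comp (hc t ht)).mul (continuous_ph a)).aestronglyMeasurable)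
      (fun t ht => (((((continuous_ec a).comp (hc t ht)).const_mul 2).mul 
        (hutc t ht)).mul (continuous_ph a)).aestronglyMeasurable) hki
      (fun t ht => hkk (fun x hx => by rw [ph_zero ha hx]; ring) (fun x hx => by
        rw [abs_mul]
        have e1 := et_le (by linarith : 0 ≤ a) (u t x)
        have e2 := sq_le_of_abs_le (hB t ht x hx)
        have e3 := mul_le_mul (e1.trans e2) (hph x) (abs_nonneg _) (sq_nonneg B)
        have : 0 ≤ (B * K + CC κ N) * (2 * a + 1) := by positivity
        linarith))
      (fun t ht => hkk (fun x hx => by rw [ph_zero ha hx]; ring) (fun x hx => by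
        rw [abs_mul, abs_mul, abs_mul, abs_of_pos (by norm_num : (0:ℝ) < 2)]
        have e1 := ec_le_a (by linarith : 0 ≤ a) (u t x)
        have e2 := hut t ht x hx
        calc _ ≤ 2 * a * (B * K + CC κ N) * 1 := by gcongr; exact hph x
          _ ≤ M := by rw [hM]; nlinarith))
      (fun t ht x => by
        have d := h.eq t (ht0 t ht) x
        exact ((hasDerivAt_et a (u t x)).comp t d).mul_const (ph a x))
    have A2 := PI2 (t1 := t1) (t2 := t2) (k := k)
      (W := fun t => wp a (u t))
      (W' := fun t x => (-(u t x * deriv (u t) x) - ff κ (u t) x) * ph a x)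
      (fun t ht => continuous_wp (hc t ht))
      (fun t ht => (hutc t ht).mul (continuous_ph a)) hki
      (fun t ht => hkk (fun x hx => by unfold wp; rw [ph_zero ha hx]; ring) (fun x hx => by
        have e1 := wp_abs_le ha (u t) x
        have e2 := hB t ht x hx
        have : 0 ≤ (B * K + CC κ N) * (2 * a + 1) := by positivity
        nlinarith))
      (fun t ht => hkk (fun x hx => by rw [ph_zero ha hx]; ring) (fun x hx => by
        rw [abs_mul]
        have e2 := hut t ht x hx
        calc _ ≤ (B * K + CC κ N) * 1 := by gcongr; exact hph x
          _ ≤ M := by rw [hM]; nlinarith))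
      (fun t ht x => by
        have d := h.eq t (ht0 t ht) x
        exact d.mul_const (ph a x))
    refine ⟨A1.1.sub (A2.1.const_mul 3), fun t ht => ?_⟩
    have ht' := Set.Ioo_subset_Icc_self ht
    have := (A1.2 t ht).sub ((A2.2 t ht).const_mul 3)
    rw [← En_ibp ha ((h.cd t (ht0 t ht')).of_le (by norm_num)) (hl t ht')]
    exact this
  exact FTClim h12 (fun n => (key n).1) (fun n => (key n).2)
    (fun n t ht => Dn_integral_le hk (hc t (Set.Ioo_subset_Icc_self ht))
      (hl t (Set.Ioo_subset_Icc_self ht)) (hN t (Set.Ioo_subset_Icc_self ht)) n)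
    (fun t ht => Dn_tendsto hk (hc t (Set.Ioo_subset_Icc_self ht))
      (hl t (Set.Ioo_subset_Icc_self ht)) (hN t (Set.Ioo_subset_Icc_self ht)))
    (tendsto_En (hc t1 m1) (hl t1 m1)) (tendsto_En (hc t2 m2) (hl t2 m2))


/-! ### Level 2: propagation of the energy bound -/

lemma L2abs {e Q : ℝ → ℝ} (hcl : ∀ N : ℝ, IsClosed {t : ℝ | 0 ≤ t ∧ e t ≤ N})
    (hQ : ∀ t1 t2 N : ℝ, 0 ≤ t1 → t1 ≤ t2 → (∀ t ∈ Set.Icc t1 t2, e t ≤ N) → Q t1 = Q t2)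
    (hle : ∀ t, 0 ≤ t → Q t ≤ e t) (hge : ∀ t, 0 ≤ t → e t ≤ 4 * Q t) :
    ∀ t, 0 ≤ t → Q t = Q 0 := by
  set G : Set ℝ := {t | ∃ N : ℝ, ∀ᶠ s in nhds t, 0 ≤ s → e s ≤ N} with hG
  have hGo : IsOpen G := by
    rw [isOpen_iff_mem_nhds]
    rintro t ⟨N, hN⟩
    filter_upwards [eventually_eventually_nhds.2 hN] with s hs
    exact ⟨N, hs⟩
  have H1 : ∀ p q : ℝ, 0 ≤ p → p ≤ q → Set.Icc p q ⊆ G → Q p = Q q := by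
    intro p q hp hpq hsub
    have : ∃ N : ℝ, ∀ s ∈ Set.Icc p q, 0 ≤ s → e s ≤ N := by
      refine isCompact_Icc.induction_on (p := fun S => ∃ N : ℝ, ∀ s ∈ S, 0 ≤ s → e s ≤ N)
        ⟨0, by simp⟩ ?_ ?_ ?_
      · rintro S T hST ⟨N, hN⟩
        exact ⟨N, fun s hs => hN s (hST hs)⟩
      · rintro S T ⟨N, hN⟩ ⟨M, hM⟩
        refine ⟨max N M, ?_⟩
        rintro s (hs | hs) h0
        · exact (hN s hs h0).trans (le_max_left _ _)
        · exact (hM s hs h0).trans (le_max_right _ _)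
      · intro t ht
        obtain ⟨N, hN⟩ := hsub ht
        exact ⟨_, mem_nhdsWithin_of_mem_nhds hN, N, fun s hs => hs⟩
    obtain ⟨N, hN⟩ := this
    exact hQ p q N hp hpq fun t ht => hN t ht (hp.trans ht.1)
  suffices hall : ∀ t, 0 ≤ t → t ∈ G by
    intro t ht
    exact (H1 0 t le_rfl ht fun s hs => hall s hs.1).symm
  by_contra hcon
  push Not at hcon
  obtain ⟨tb, htb0, htb⟩ := hcon
  set F : Set ℝ := Set.Ici 0 ∩ Gᶜ with hF
  have hFc : IsClosed F := isClosed_Ici.inter hGo.isClosed_compl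
  have : CompleteSpace F := hFc.completeSpace_coe
  have : Nonempty F := ⟨⟨tb, htb0, htb⟩⟩
  obtain ⟨n, hn⟩ := nonempty_interior_of_iUnion_of_closed
    (f := fun n : ℕ => {t : F | (0:ℝ) ≤ t.1 ∧ e t.1 ≤ n})
    (fun n => (hcl n).preimage continuous_subtype_val) (by
      rw [Set.eq_univ_iff_forall]
      intro t
      obtain ⟨n, hn⟩ := exists_nat_ge (e t.1)
      exact Set.mem_iUnion.2 ⟨n, t.2.1, hn⟩)
  obtain ⟨⟨t0, ht0⟩, hintg⟩ := hn
  rw [mem_interior_iff_mem_nhds, Metric.mem_nhds_iff] at hintg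
  obtain ⟨δ, hδ, hball⟩ := hintg
  have hFN : ∀ t ∈ F, |t - t0| < δ → e t ≤ n := by
    intro t ht htd
    have : (⟨t, ht⟩ : F) ∈ Metric.ball (⟨t0, ht0⟩ : F) δ := by
      rw [Metric.mem_ball, Subtype.dist_eq, Real.dist_eq]; exact htd
    exact (hball this).2
  have hn0 : (0:ℝ) ≤ n := Nat.cast_nonneg n
  -- bounds with one end in F
  apply ht0.2
  refine ⟨4 * n, ?_⟩
  filter_upwards [Metric.ball_mem_nhds t0 hδ] with s hs hs0
  rw [Metric.mem_ball, Real.dist_eq] at hs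
  by_cases hsF : s ∈ F
  · have := hFN s hsF hs
    linarith
  rcases lt_trichotomy s t0 with hlt | heq | hgt
  · obtain ⟨a, ⟨haF, ha1⟩, ha2⟩ := (isCompact_Icc.inter_left hFc).exists_isLeast 
      (⟨t0, ht0, hlt.le, le_rfl⟩ : (F ∩ Set.Icc s t0).Nonempty)
    have hsa : s < a := lt_of_le_of_ne ha1.1 (fun hh => hsF (hh ▸ haF))
    have hea : e a ≤ n := hFN a haF (by
      rw [abs_lt] at *; constructor <;> linarith [ha1.1, ha1.2])
    have hin : ∀ t, s ≤ t → t < a → t ∈ G := by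
      intro t h1 h2
      by_contra h3
      have : t ∈ F ∩ Set.Icc s t0 := ⟨⟨hs0.trans h1, h3⟩, h1, h2.le.trans ha1.2⟩
      exact absurd (ha2 this) (not_le.2 h2)
    have hbd : ∀ t ∈ Set.Icc s a, e t ≤ max (4 * Q s) n := by
      intro t ht
      rcases eq_or_lt_of_le ht.2 with h | h
      · rw [h]; exact hea.trans (le_max_right _ _)
      · have := H1 s t hs0 ht.1 fun r hr => hin r hr.1 (hr.2.trans_lt h)
        rw [this]
        exact (hge t (hs0.trans ht.1)).trans (le_max_left _ _)
    have h1 := hQ s a _ hs0 hsa.le hbd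
    have h2 := hle a (hs0.trans hsa.le)
    have h3 := hge s hs0
    linarith
  · exact absurd (heq ▸ ht0) hsF
  · obtain ⟨a, ⟨haF, ha1⟩, ha2⟩ := (isCompact_Icc.inter_left hFc).exists_isGreatest
      (⟨t0, ht0, le_rfl, hgt.le⟩ : (F ∩ Set.Icc t0 s).Nonempty)
    have hsa : a < s := lt_of_le_of_ne ha1.2 (fun hh => hsF (hh ▸ haF))
    have ha0 : 0 ≤ a := haF.1
    have hea : e a ≤ n := hFN a haF (by
      rw [abs_lt] at *; constructor <;> linarith [ha1.1, ha1.2])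
    have hin : ∀ t, a < t → t ≤ s → t ∈ G := by
      intro t h1 h2
      by_contra h3
      have : t ∈ F ∩ Set.Icc t0 s := ⟨⟨ha0.trans h1.le, h3⟩, ha1.1.trans h1.le, h2⟩
      exact absurd (ha2 this) (not_le.2 h1)
    have hbd : ∀ t ∈ Set.Icc a s, e t ≤ max (4 * Q s) n := by
      intro t ht
      rcases eq_or_lt_of_le ht.1 with h | h
      · rw [← h]; exact hea.trans (le_max_right _ _)
      · have := H1 t s (ha0.trans ht.1) ht.2 fun r hr => hin r (h.trans_le hr.1) hr.2
        rw [← this]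
        exact (hge t (ha0.trans ht.1)).trans (le_max_left _ _)
    have h1 := hQ a s _ ha0 hsa.le hbd
    have h2 := hle a ha0
    have h3 := hge s hs0
    linarith

lemma DPsol.closed {κ : ℝ} {u : ℝ → ℝ → ℝ} (h : DPsol κ u) (N : ℝ) :
    IsClosed {t : ℝ | 0 ≤ t ∧ ∫ x, u t x ^ 2 ≤ N} := by
  apply IsSeqClosed.isClosed
  intro s t hs hst
  have ht0 : 0 ≤ t := ge_of_tendsto' hst fun n => (hs n).1
  refine ⟨ht0, ?_⟩
  have hN0 : 0 ≤ N := le_trans (integral_nonneg fun x => sq_nonneg _) (hs 0).2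
  have h1 : ∀ r, 0 ≤ r → ENNReal.ofReal (∫ x, u r x ^ 2) = ∫⁻ x, ENNReal.ofReal (u r x ^ 2) :=
    fun r hr => ofReal_integral_eq_lintegral_ofReal (h.l2 r hr)
      (Eventually.of_forall fun x => sq_nonneg _)
  have h2 : ∫⁻ x, ENNReal.ofReal (u t x ^ 2) ≤ ENNReal.ofReal N := by
    calc ∫⁻ x, ENNReal.ofReal (u t x ^ 2)
        = ∫⁻ x, liminf (fun n => ENNReal.ofReal (u (s n) x ^ 2)) atTop := by
          congr 1; ext x
          have hc : ContinuousAt (fun r => u r x) t := (h.eq t ht0 x).continuousAt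
          have : Tendsto (fun n => ENNReal.ofReal (u (s n) x ^ 2)) atTop
              (nhds (ENNReal.ofReal (u t x ^ 2))) :=
            (ENNReal.continuous_ofReal.tendsto _).comp ((hc.tendsto.comp hst).pow 2)
          exact this.liminf_eq.symm
      _ ≤ liminf (fun n => ∫⁻ x, ENNReal.ofReal (u (s n) x ^ 2)) atTop := by
          apply lintegral_liminf_le
          intro n
          exact ENNReal.measurable_ofReal.comp
            (((h.cd (s n) (hs n).1).continuous.pow 2).measurable)
      _ ≤ liminf (fun _ : ℕ => ENNReal.ofReal N) atTop := by
          refine liminf_le_liminf ?_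
          exact Eventually.of_forall fun n => by
            rw [← h1 (s n) (hs n).1]; exact ENNReal.ofReal_le_ofReal (hs n).2
      _ = ENNReal.ofReal N := by simp
  rw [← h1 t ht0] at h2
  exact (ENNReal.ofReal_le_ofReal_iff hN0).1 h2

lemma DPsol.energy {κ : ℝ} {u : ℝ → ℝ → ℝ} (h : DPsol κ u) (t : ℝ) (ht : 0 ≤ t) :
    ∫ x, u t x ^ 2 ≤ 4 * ∫ x, u 0 x ^ 2 := by
  have hle : ∀ t, 0 ≤ t → QQ (u t) ≤ ∫ x, u t x ^ 2 := fun t ht =>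
    QQ_le (h.cd t ht).continuous (h.l2 t ht)
  have hge : ∀ t, 0 ≤ t → ∫ x, u t x ^ 2 ≤ 4 * QQ (u t) := fun t ht =>
    QQ_ge (h.cd t ht).continuous (h.l2 t ht)
  have := L2abs (e := fun t => ∫ x, u t x ^ 2) (Q := fun t => QQ (u t)) h.closed
    (fun t1 t2 N h1 h12 hN => h.QQ_eq h1 h12 hN) hle hge t ht
  have h1 := hge t ht
  have h2 := hle 0 le_rfl
  linarith


/-! ### Level 3: continuity in time of the nonlocal terms -/

lemma gg_abs_le {κ : ℝ} (hκ : 0 ≤ κ) (w : ℝ → ℝ) (y : ℝ) :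
    |gg κ w y| ≤ (3/2 + κ) * w y ^ 2 + κ := by
  unfold gg
  have h1 : 2 * |w y| ≤ w y ^ 2 + 1 := by
    rw [← sq_abs (w y)]; nlinarith [sq_nonneg (|w y| - 1)]
  calc _ ≤ |(3/2) * w y ^ 2| + |2 * κ * w y| := abs_add_le _ _
    _ = (3/2) * w y ^ 2 + κ * (2 * |w y|) := by
      rw [abs_of_nonneg (by positivity), abs_mul, abs_of_nonneg (by positivity : 0 ≤ 2 * κ)]; ring
    _ ≤ (3/2) * w y ^ 2 + κ * (w y ^ 2 + 1) := by gcongr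
    _ = _ := by ring

lemma tcont_gen {κ : ℝ} {u : ℝ → ℝ → ℝ} (h : DPsol κ u) {t1 t2 N : ℝ} (h1 : 0 ≤ t1)
    (hN : ∀ t ∈ Set.Icc t1 t2, ∫ x, u t x ^ 2 ≤ N) (x : ℝ) {K : ℝ → ℝ} (hKm : Measurable K)
    (hK : ∀ y, |K y| ≤ Real.exp (-(1 * |x - y|))) :
    ContinuousOn (fun t => ∫ y, K y * gg κ (u t) y) (Set.Icc t1 t2) := by
  rcases lt_or_ge t2 t1 with hlt | h12
  · rw [Set.Icc_eq_empty (not_le.2 hlt)]; exact continuousOn_empty _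
  have hk := h.kpos.le
  have hN0 : 0 ≤ N := le_trans (integral_nonneg fun x => sq_nonneg _) (hN t1 ⟨le_rfl, h12⟩)
  have hS := h.sol h1 hN0 hN
  have ht0 : ∀ t ∈ Set.Icc t1 t2, 0 ≤ t := fun t ht => h1.trans ht.1
  have hc : ∀ t ∈ Set.Icc t1 t2, Continuous (u t) := fun t ht => (h.cd t (ht0 t ht)).continuous
  have hl : ∀ t ∈ Set.Icc t1 t2, Integrable (fun x => u t x ^ 2) := fun t ht => h.l2 t (ht0 t ht)
  have hm : ∀ t ∈ Set.Icc t1 t2, Measurable (fun y => K y * gg κ (u t) y) := fun t ht =>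
    hKm.mul (continuous_gg (hc t ht)).measurable
  have hi : ∀ t ∈ Set.Icc t1 t2, Integrable (fun y => K y * gg κ (u t) y) := fun t ht => by
    refine ((KI_gg (κ := κ) (hc t ht) (hl t ht)).abs x).mono' (hm t ht).aestronglyMeasurable
      (Eventually.of_forall fun y => ?_)
    rw [Real.norm_eq_abs, abs_mul]
    exact mul_le_mul_of_nonneg_right (hK y) (abs_nonneg _)
  set S : ℕ → Set ℝ := fun n => Set.Icc (-(n:ℝ)) n with hSdef
  have hun : TendstoUniformlyOn (fun (n : ℕ) t => ∫ y in S n, K y * gg κ (u t) y)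
      (fun t => ∫ y, K y * gg κ (u t) y) atTop (Set.Icc t1 t2) := by
    set M : ℝ := (3/2 + κ) * N + κ * 4 with hM
    have hM0 : 0 ≤ M := by positivity
    have hlim : Tendsto (fun n : ℕ => Real.exp (-((1/2) * ((n:ℝ) - |x|))) * M) atTop (nhds 0) := by
      have : Tendsto (fun n : ℕ => Real.exp (-((1/2) * ((n:ℝ) - |x|)))) atTop (nhds 0) := by
        apply Real.tendsto_exp_neg_atTop_nhds_zero.comp
        apply Tendsto.const_mul_atTop (by norm_num)
        exact tendsto_atTop_add_const_right _ _ tendsto_natCast_atTop_atTop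
      simpa using this.mul_const M
    rw [Metric.tendstoUniformlyOn_iff]
    intro ε hε
    filter_upwards [(hlim.eventually (gt_mem_nhds hε))] with n hn t ht
    refine lt_of_le_of_lt ?_ hn
    rw [Real.dist_eq]
    have hsplit := integral_add_compl (s := S n) measurableSet_Icc (hi t ht)
    rw [← hsplit, add_sub_cancel_left]
    have hb1 : Integrable (fun y => Real.exp (-((1/2) * |x - y|)) * ((3/2 + κ) * u t y ^ 2)) :=
      (KI_of_integrable (by norm_num : (0:ℝ) < 1/2) ((hl t ht).const_mul _)) x
    have hb2 : Integrable (fun y => Real.exp (-((1/2) * |x - y|)) * (κ * 1)) :=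
      ((KI_one (by norm_num : (0:ℝ) < 1/2)).const_mul κ) x
    set c := Real.exp (-((1/2) * ((n:ℝ) - |x|))) with hcdef
    have hc0 : 0 < c := Real.exp_pos _
    have hb : Integrable (fun y => c * (Real.exp (-((1/2) * |x - y|)) * ((3/2 + κ) * u t y ^ 2) + 
      Real.exp (-((1/2) * |x - y|)) * (κ * 1))) := (hb1.add hb2).const_mul c
    have hpos : ∀ y, 0 ≤ c * (Real.exp (-((1/2) * |x - y|)) * ((3/2 + κ) * u t y ^ 2) + 
      Real.exp (-((1/2) * |x - y|)) * (κ * 1)) := fun y => by positivity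
    calc |∫ y in (S n)ᶜ, K y * gg κ (u t) y| ≤ ∫ y in (S n)ᶜ, 
          c * (Real.exp (-((1/2) * |x - y|)) * ((3/2 + κ) * u t y ^ 2) + 
            Real.exp (-((1/2) * |x - y|)) * (κ * 1)) := by
          rw [← Real.norm_eq_abs]
          apply norm_integral_le_of_norm_le hb.integrableOn
          filter_upwards [ae_restrict_mem measurableSet_Icc.compl] with y hy
          have hny : (n:ℝ) ≤ |y| := by
            by_contra hh
            push Not at hh
            rw [abs_lt] at hh
            exact hy ⟨hh.1.le, hh.2.le⟩
          have e1 : Real.exp (-(1 * |x - y|)) ≤ c * Real.exp (-((1/2) * |x - y|)) := by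
            rw [hcdef, ← Real.exp_add]
            apply Real.exp_le_exp.2
            have : |y| - |x| ≤ |x - y| := by rw [abs_sub_comm]; exact abs_sub_abs_le_abs_sub _ _
            linarith
          rw [Real.norm_eq_abs, abs_mul]
          calc |K y| * |gg κ (u t) y| ≤ (c * Real.exp (-((1/2) * |x - y|))) *
              ((3/2 + κ) * u t y ^ 2 + κ) :=
                mul_le_mul ((hK y).trans e1) (gg_abs_le hk _ _) (abs_nonneg _) (by positivity)
            _ = _ := by ring
      _ ≤ ∫ y, c * (Real.exp (-((1/2) * |x - y|)) * ((3/2 + κ) * u t y ^ 2) + 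
            Real.exp (-((1/2) * |x - y|)) * (κ * 1)) :=
          setIntegral_le_integral hb (Eventually.of_forall hpos)
      _ = c * (KP (1/2) (fun y => (3/2 + κ) * u t y ^ 2) x + KP (1/2) (fun _ => κ * 1) x) := by
          rw [integral_const_mul, integral_add hb1 hb2]; rfl
      _ ≤ c * M := by
          have e0 : KP (1/2) (fun _ => κ * 1) x = κ * 4 := by
            have := KP_const_mul (l := 1/2) (h := fun _ => 1) κ x
            rw [KP_one (by norm_num)] at this
            rw [this]; norm_num
          rw [e0]
          apply mul_le_mul_of_nonneg_left _ hc0.le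
          have e2 := KP_le_integral (by norm_num : (0:ℝ) < 1/2) ((hl t ht).const_mul (3/2 + κ))
            (fun y => by positivity) x
          rw [integral_const_mul] at e2
          have e3 : (3/2 + κ) * ∫ y, u t y ^ 2 ≤ (3/2 + κ) * N :=
            mul_le_mul_of_nonneg_left (hN t ht) (by positivity)
          rw [hM]; linarith
  apply hun.continuousOn
  refine (Eventually.of_forall fun n => ?_).frequently
  obtain ⟨B, hB0, hB⟩ := L1a_bound hS n
  apply continuousOn_of_dominated (bound := fun _ => (3/2 + κ) * B ^ 2 + κ)
  · intro t ht; exact (hm t ht).aestronglyMeasurable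
  · intro t ht
    filter_upwards [ae_restrict_mem measurableSet_Icc] with y hy
    rw [Real.norm_eq_abs, abs_mul]
    have e1 : |K y| ≤ 1 := (hK y).trans (ker_le_one (by norm_num) x y)
    have e2 := gg_abs_le hk (u t) y
    have e3 : u t y ^ 2 ≤ B ^ 2 := sq_le_of_abs_le (hB t ht y hy)
    calc |K y| * |gg κ (u t) y| ≤ 1 * ((3/2 + κ) * B ^ 2 + κ) := by
          apply mul_le_mul e1 _ (abs_nonneg _) zero_le_one
          refine e2.trans ?_
          gcongr
      _ = _ := one_mul _
  · exact integrableOn_const (by simp [hSdef])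
  · refine Eventually.of_forall fun y t ht => ?_
    have : ContinuousAt (fun s => u s y) t := (h.eq t (ht0 t ht) y).continuousAt
    apply ContinuousAt.continuousWithinAt
    unfold gg
    fun_prop

lemma tcont_PP {κ : ℝ} {u : ℝ → ℝ → ℝ} (h : DPsol κ u) {t1 t2 N : ℝ} (h1 : 0 ≤ t1)
    (hN : ∀ t ∈ Set.Icc t1 t2, ∫ x, u t x ^ 2 ≤ N) (x : ℝ) :
    ContinuousOn (fun t => PP κ (u t) x) (Set.Icc t1 t2) := by
  have := tcont_gen h h1 hN x (K := fun y => Real.exp (-(1 * |x - y|)))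
    (Continuous.measurable (by fun_prop)) (fun y => by rw [Real.abs_exp])
  exact this.const_mul (1/2)

lemma tcont_ff {κ : ℝ} {u : ℝ → ℝ → ℝ} (h : DPsol κ u) {t1 t2 N : ℝ} (h1 : 0 ≤ t1)
    (hN : ∀ t ∈ Set.Icc t1 t2, ∫ x, u t x ^ 2 ≤ N) (x : ℝ) :
    ContinuousOn (fun t => ff κ (u t) x) (Set.Icc t1 t2) := by
  have hA := tcont_gen h h1 hN x 
    (K := Set.indicator (Set.Iic x) (fun y => Real.exp (1 * (y - x))))
    (Measurable.indicator (Continuous.measurable (by fun_prop)) measurableSet_Iic) (fun y => by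
      by_cases hy : y ∈ Set.Iic x
      · rw [Set.indicator_of_mem hy, Real.abs_exp, abs_of_nonneg (sub_nonneg.2 hy)]
        apply le_of_eq; congr 1; ring
      · rw [Set.indicator_of_notMem hy, abs_zero]; exact (Real.exp_pos _).le)
  have hB := tcont_gen h h1 hN x 
    (K := Set.indicator (Set.Ioi x) (fun y => Real.exp (1 * (x - y))))
    (Measurable.indicator (Continuous.measurable (by fun_prop)) measurableSet_Ioi) (fun y => by
      by_cases hy : y ∈ Set.Ioi x
      · rw [Set.indicator_of_mem hy, Real.abs_exp, abs_of_nonpos (sub_nonpos.2 (le_of_lt hy))]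
        apply le_of_eq; congr 1; ring
      · rw [Set.indicator_of_notMem hy, abs_zero]; exact (Real.exp_pos _).le)
  have := (hB.sub hA).const_mul (1/2)
  refine this.congr fun t ht => ?_
  unfold ff KD KA KB
  rw [← integral_indicator measurableSet_Iic, ← integral_indicator measurableSet_Ioi, one_mul]
  congr 2
  · congr 1; ext y
    by_cases hy : y ∈ Set.Ioi x
    · simp only [Set.indicator_of_mem hy]
    · simp only [Set.indicator_of_notMem hy, zero_mul]
  · congr 1; ext y
    by_cases hy : y ∈ Set.Iic x
    · simp only [Set.indicator_of_mem hy]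
    · simp only [Set.indicator_of_notMem hy, zero_mul]

lemma comp_cont {F : ℝ → ℝ → ℝ} {I : Set ℝ} {D : Set ℝ} {L : ℝ}
    (hF : ∀ x, ContinuousOn (fun t => F t x) I)
    (hL : ∀ t ∈ I, ∀ x ∈ D, ∀ y ∈ D, |F t x - F t y| ≤ L * |x - y|)
    {X : ℝ → ℝ} (hX : ContinuousOn X I) (hm : ∀ s ∈ I, X s ∈ D) :
    ContinuousOn (fun s => F s (X s)) I := by
  intro s hs
  have h1 : Tendsto (fun r => F r (X r) - F r (X s)) (nhdsWithin s I) (nhds 0) := by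
    apply squeeze_zero_norm' (a := fun r => L * |X r - X s|)
    · filter_upwards [self_mem_nhdsWithin] with r hr
      exact hL r hr _ (hm r hr) _ (hm s hs)
    · have : Tendsto (fun r => L * |X r - X s|) (nhdsWithin s I) (nhds (L * |X s - X s|)) :=
        ((hX s hs).sub_const (X s)).abs.const_mul L
      simpa using this
  have h2 := h1.add (hF (X s) s hs)
  simpa [ContinuousWithinAt] using h2


/-! ### Level 3: calculus along characteristics -/

lemma FTClim2 {E e : ℕ → ℝ → ℝ} {q e0 : ℝ → ℝ} {t1 t2 K : ℝ}
    (hc : ∀ n, ContinuousOn (E n) (Set.Icc t1 t2))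
    (hd : ∀ n, ∀ t ∈ Set.Ioo t1 t2, HasDerivAt (E n) (e n t) t)
    (hK : ∀ n, ∀ t ∈ Set.Ioo t1 t2, |e n t| ≤ K)
    (h0 : ∀ t ∈ Set.Ioo t1 t2, Tendsto (fun n => e n t) atTop (nhds (e0 t)))
    (hq : ∀ t ∈ Set.Icc t1 t2, Tendsto (fun n => E n t) atTop (nhds (q t))) :
    ∀ s ∈ Set.Icc t1 t2, ∀ t ∈ Set.Icc t1 t2, s ≤ t → q t - q s = ∫ r in s..t, e0 r := by
  intro s hs t ht hst
  have hsub : Set.Ioo s t ⊆ Set.Ioo t1 t2 := Set.Ioo_subset_Ioo hs.1 ht.2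
  have hae : ∀ᵐ r ∂(volume.restrict (Set.Ioc s t)), r ∈ Set.Ioo t1 t2 := by
    rw [← restrict_Ioo_eq_restrict_Ioc]
    filter_upwards [ae_restrict_mem measurableSet_Ioo] with r hr using hsub hr
  have hintg : ∀ n, IntegrableOn (deriv (E n)) (Set.Ioc s t) := by
    intro n
    refine Integrable.mono' (g := fun _ => K) (integrableOn_const (by simp)) 
      (measurable_deriv (E n)).aestronglyMeasurable ?_
    filter_upwards [hae] with t ht
    rw [(hd n t ht).deriv]; exact hK n t ht
  have hF : ∀ n, ∫ r in s..t, deriv (E n) r = E n t - E n s := by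
    intro n
    apply intervalIntegral.integral_eq_sub_of_hasDerivAt_of_le hst
      ((hc n).mono (Set.Icc_subset_Icc hs.1 ht.2))
    · intro r hr; rw [(hd n r (hsub hr)).deriv]; exact hd n r (hsub hr)
    · rw [intervalIntegrable_iff_integrableOn_Ioc_of_le hst]; exact hintg n
  have hl : Tendsto (fun n => ∫ r in s..t, deriv (E n) r) atTop (nhds (∫ r in s..t, e0 r)) := by
    have : Tendsto (fun n => ∫ r in Set.Ioc s t, deriv (E n) r) atTop
        (nhds (∫ r in Set.Ioc s t, e0 r)) := by
      apply tendsto_integral_of_dominated_convergence (fun _ => K)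
      · intro n; exact (measurable_deriv (E n)).aestronglyMeasurable
      · exact integrableOn_const (by simp)
      · intro n
        filter_upwards [hae] with t ht
        rw [(hd n t ht).deriv]; exact hK n t ht
      · filter_upwards [hae] with t ht
        refine (h0 t ht).congr fun n => ?_
        rw [(hd n t ht).deriv]
    simp only [intervalIntegral.integral_of_le hst]
    exact this
  simp only [hF] at hl
  exact (tendsto_nhds_unique hl ((hq t ht).sub (hq s hs))).symm

lemma FTClim2_cont {E e : ℕ → ℝ → ℝ} {q : ℝ → ℝ} {t1 t2 K : ℝ}
    (hc : ∀ n, ContinuousOn (E n) (Set.Icc t1 t2))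
    (hd : ∀ n, ∀ t ∈ Set.Ioo t1 t2, HasDerivAt (E n) (e n t) t)
    (hK : ∀ n, ∀ t ∈ Set.Ioo t1 t2, |e n t| ≤ K)
    (hq : ∀ t ∈ Set.Icc t1 t2, Tendsto (fun n => E n t) atTop (nhds (q t))) :
    ContinuousOn q (Set.Icc t1 t2) := by
  rcases le_or_gt t2 t1 with h12 | h12
  · have : (Set.Icc t1 t2).Subsingleton := Set.subsingleton_Icc_of_ge h12
    exact this.continuousOn _
  have hK0 : 0 ≤ K := (abs_nonneg _).trans (hK 0 ((t1 + t2)/2) ⟨by linarith, by linarith⟩)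
  have key : ∀ n, ∀ s ∈ Set.Icc t1 t2, ∀ t ∈ Set.Icc t1 t2, s < t → |E n t - E n s| ≤ K * |t - s| := by
    intro n s hs t ht hst
    have hsub : Set.Ioo s t ⊆ Set.Ioo t1 t2 := Set.Ioo_subset_Ioo hs.1 ht.2
    obtain ⟨r, hr, he⟩ := exists_hasDerivAt_eq_slope (E n) (e n) hst
      ((hc n).mono (Set.Icc_subset_Icc hs.1 ht.2)) (fun r hr => hd n r (hsub hr))
    have h1 := hK n r (hsub hr)
    have h2 : 0 < t - s := sub_pos.2 hst
    rw [he, abs_div, div_le_iff₀ (abs_pos.2 h2.ne')] at h1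
    exact h1
  have key2 : ∀ n, ∀ s ∈ Set.Icc t1 t2, ∀ t ∈ Set.Icc t1 t2, |E n t - E n s| ≤ K * |t - s| := by
    intro n s hs t ht
    rcases lt_trichotomy s t with h | h | h
    · exact key n s hs t ht h
    · subst h; simp
    · rw [abs_sub_comm, abs_sub_comm t s]; exact key n t ht s hs h
  have key3 : ∀ s ∈ Set.Icc t1 t2, ∀ t ∈ Set.Icc t1 t2, |q t - q s| ≤ K * |t - s| := by
    intro s hs t ht
    exact le_of_tendsto ((hq t ht).sub (hq s hs)).abs (Eventually.of_forall fun n => key2 n s hs t ht)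
  have : LipschitzOnWith ⟨K, hK0⟩ q (Set.Icc t1 t2) := by
    apply LipschitzOnWith.of_dist_le_mul
    intro x hx y hy
    rw [Real.dist_eq, Real.dist_eq]
    exact key3 y hy x hx
  exact this.continuousOn

lemma FTClim2_deriv {E e : ℕ → ℝ → ℝ} {q e0 : ℝ → ℝ} {t1 t2 K : ℝ}
    (hc : ∀ n, ContinuousOn (E n) (Set.Icc t1 t2))
    (hd : ∀ n, ∀ t ∈ Set.Ioo t1 t2, HasDerivAt (E n) (e n t) t)
    (hK : ∀ n, ∀ t ∈ Set.Ioo t1 t2, |e n t| ≤ K)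
    (h0 : ∀ t ∈ Set.Ioo t1 t2, Tendsto (fun n => e n t) atTop (nhds (e0 t)))
    (hq : ∀ t ∈ Set.Icc t1 t2, Tendsto (fun n => E n t) atTop (nhds (q t)))
    (he : ContinuousOn e0 (Set.Icc t1 t2)) :
    ∀ t ∈ Set.Ioo t1 t2, HasDerivAt q (e0 t) t := by
  intro t ht
  have h12 : t1 ≤ t2 := ht.1.le.trans ht.2.le
  have hm := Set.left_mem_Icc.2 h12
  have hF := FTClim2 hc hd hK h0 hq t1 hm
  have hn : Set.Icc t1 t2 ∈ nhds t := Icc_mem_nhds ht.1 ht.2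
  have h1 : HasDerivAt (fun r => ∫ x in t1..r, e0 x) (e0 t) t := by
    apply intervalIntegral.integral_hasDerivAt_right
    · apply ContinuousOn.intervalIntegrable_of_Icc ht.1.le
      exact he.mono (Set.Icc_subset_Icc le_rfl ht.2.le)
    · exact (he.mono Set.Ioo_subset_Icc_self).stronglyMeasurableAtFilter isOpen_Ioo t ht
    · exact he.continuousAt hn
  have h2 := h1.add_const (q t1)
  refine h2.congr_of_eventuallyEq ?_
  filter_upwards [hn] with r hr
  have := hF r hr hr.1
  linarith

lemma chain2 {H H1 H2 : ℝ → ℝ → ℝ} {X : ℝ → ℝ} {x' t : ℝ}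
    (h1 : ∀ᶠ z : ℝ × ℝ in nhds (t, X t), HasDerivAt (fun s => H s z.2) (H1 z.1 z.2) z.1)
    (h2 : ∀ᶠ z : ℝ × ℝ in nhds (t, X t), HasDerivAt (H z.1) (H2 z.1 z.2) z.2)
    (c1 : ContinuousAt (fun z : ℝ × ℝ => H1 z.1 z.2) (t, X t))
    (c2 : ContinuousAt (fun z : ℝ × ℝ => H2 z.1 z.2) (t, X t))
    (hX : HasDerivAt X x' t) :
    HasDerivAt (fun s => H s (X s)) (H1 t (X t) + H2 t (X t) * x') t := by
  have k := hasStrictFDerivAt_uncurry_coprod (𝕜 := ℝ) (u := (t, X t)) (f := H)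
    (f₁ := fun a b => ContinuousLinearMap.toSpanSingleton ℝ (H1 a b))
    (f₂ := fun a b => ContinuousLinearMap.toSpanSingleton ℝ (H2 a b))
    (h1.mono fun z hz => hz.hasFDerivAt) (h2.mono fun z hz => hz.hasFDerivAt)
    ((ContinuousLinearMap.toSpanSingletonCLE (𝕜 := ℝ) (E := ℝ)).continuous.continuousAt.comp c1)
    ((ContinuousLinearMap.toSpanSingletonCLE (𝕜 := ℝ) (E := ℝ)).continuous.continuousAt.comp c2)
  have k2 : HasDerivAt (fun s => (s, X s)) ((1:ℝ), x') t := (hasDerivAt_id t).prodMk hX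
  have k3 := HasFDerivAt.comp_hasDerivAt t k.hasFDerivAt k2
  refine (k3.congr_deriv ?_)
  simp [Function.HasUncurry.uncurry]
  ring

/-- uniform bounds on a space-time box -/
structure Box (κ : ℝ) (u : ℝ → ℝ → ℝ) (T R M : ℝ) : Prop where
  sol : DPsol κ u
  Tpos : 0 ≤ T
  Mnn : 0 ≤ M
  uu : ∀ t ∈ Set.Icc 0 T, ∀ x ∈ Set.Icc (-R) R, |u t x| ≤ M
  ux : ∀ t ∈ Set.Icc 0 T, ∀ x ∈ Set.Icc (-R) R, |deriv (u t) x| ≤ M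
  qq : ∀ t ∈ Set.Icc 0 T, ∀ x ∈ Set.Icc (-R) R, |PP κ (u t) x - gg κ (u t) x| ≤ M
  zz : ∀ t ∈ Set.Icc 0 T, ∀ x ∈ Set.Icc (-R) R,
    |ff κ (u t) x - (3 * u t x + 2 * κ) * deriv (u t) x| ≤ M
  fb : ∀ t ∈ Set.Icc 0 T, ∀ x, |ff κ (u t) x| ≤ M
  tP : ∀ x, ContinuousOn (fun t => PP κ (u t) x) (Set.Icc 0 T)
  tF : ∀ x, ContinuousOn (fun t => ff κ (u t) x) (Set.Icc 0 T)
  jc : ContinuousOn (fun z : ℝ × ℝ => u z.1 z.2) (Set.Icc 0 T ×ˢ Set.univ)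

lemma Box.exists {κ : ℝ} {u : ℝ → ℝ → ℝ} (h : DPsol κ u) {T : ℝ} (hT : 0 ≤ T) (R : ℝ) :
    ∃ M, Box κ u T R M := by
  set N := 4 * ∫ x, u 0 x ^ 2 with hNdef
  have hN : ∀ t ∈ Set.Icc 0 T, ∫ x, u t x ^ 2 ≤ N := fun t ht => h.energy t ht.1
  have hN0 : 0 ≤ N := mul_nonneg (by norm_num) (integral_nonneg fun x => sq_nonneg _)
  have hS := h.sol le_rfl hN0 hN
  obtain ⟨B, hB0, hB⟩ := L1a_bound hS R
  obtain ⟨K, hK0, hK⟩ := L1a_deriv hS R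
  have hk := h.kpos
  have hC0 : 0 ≤ CC κ N := CC_nonneg hk.le hN0
  have hfb : ∀ t ∈ Set.Icc 0 T, ∀ x, |ff κ (u t) x| ≤ CC κ N := fun t ht x =>
    ff_bound hk.le (h.cd t ht.1).continuous (h.l2 t ht.1) (hN t ht) x
  have hpb : ∀ t ∈ Set.Icc 0 T, ∀ x, |PP κ (u t) x| ≤ CC κ N := fun t ht x =>
    PP_bound hk.le (h.cd t ht.1).continuous (h.l2 t ht.1) (hN t ht) x
  have p1 : 0 ≤ (3/2 + κ) * B ^ 2 + κ := by positivity
  have p2 : 0 ≤ (3 * B + 2 * κ) * K := by positivity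
  refine ⟨B + K + CC κ N + ((3/2 + κ) * B ^ 2 + κ) + (3 * B + 2 * κ) * K, h, hT, by positivity,
    ?_, ?_, ?_, ?_, ?_, tcont_PP h le_rfl hN, tcont_ff h le_rfl hN, L1a_cont hS⟩
  · intro t ht x hx; linarith [hB t ht x hx]
  · intro t ht x hx; linarith [hK t ht x hx]
  · intro t ht x hx
    have e1 := hpb t ht x
    have e2 := gg_abs_le hk.le (u t) x
    have e3 : u t x ^ 2 ≤ B ^ 2 := sq_le_of_abs_le (hB t ht x hx)
    have e4 : (3/2 + κ) * u t x ^ 2 ≤ (3/2 + κ) * B ^ 2 := by gcongr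
    have := abs_sub (PP κ (u t) x) (gg κ (u t) x)
    linarith
  · intro t ht x hx
    have e1 := hfb t ht x
    have e2 : |(3 * u t x + 2 * κ) * deriv (u t) x| ≤ (3 * B + 2 * κ) * K := by
      rw [abs_mul]
      apply mul_le_mul _ (hK t ht x hx) (abs_nonneg _) (by positivity)
      refine (abs_add_le _ _).trans ?_
      rw [abs_mul, abs_of_pos (by positivity : 0 < 2 * κ), abs_of_pos (by norm_num : (0:ℝ) < 3)]
      linarith [hB t ht x hx]
    have := abs_sub (ff κ (u t) x) ((3 * u t x + 2 * κ) * deriv (u t) x)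
    linarith
  · intro t ht x; linarith [hfb t ht x]

lemma lip_of_bound {F F' : ℝ → ℝ} {D : Set ℝ} (hD : Convex ℝ D) {M : ℝ}
    (hd : ∀ x, HasDerivAt F (F' x) x) (hb : ∀ x ∈ D, |F' x| ≤ M) :
    ∀ x ∈ D, ∀ y ∈ D, |F x - F y| ≤ M * |x - y| := by
  intro x hx y hy
  exact hD.norm_image_sub_le_of_norm_hasDerivWithin_le (fun z _ => (hd z).hasDerivWithinAt) 
    hb hy hx

lemma joint_cont {F : ℝ → ℝ → ℝ} {I : Set ℝ} {L : ℝ} 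
    (hF : ∀ x, ContinuousOn (fun t => F t x) I)
    (hL : ∀ t ∈ I, ∀ x y, |F t x - F t y| ≤ L * |x - y|) :
    ContinuousOn (fun z : ℝ × ℝ => F z.1 z.2) (I ×ˢ Set.univ) := by
  rintro ⟨t, x⟩ ⟨ht, -⟩
  have h1 : Tendsto (fun z : ℝ × ℝ => F z.1 z.2 - F z.1 x) (nhdsWithin (t, x) (I ×ˢ Set.univ))
      (nhds 0) := by
    apply squeeze_zero_norm' (a := fun z => L * |z.2 - x|)
    · filter_upwards [self_mem_nhdsWithin] with r hr
      exact hL r.1 hr.1 _ _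
    · have : Continuous (fun z : ℝ × ℝ => L * |z.2 - x|) := by fun_prop
      have := this.continuousWithinAt (s := I ×ˢ Set.univ) (x := (t, x))
      simpa [ContinuousWithinAt] using this
  have h2 : Tendsto (fun z : ℝ × ℝ => F z.1 x) (nhdsWithin (t, x) (I ×ˢ Set.univ))
      (nhds (F t x)) := by
    have := hF x t ht
    refine Tendsto.comp this ?_
    exact (continuous_fst.continuousWithinAt.tendsto_nhdsWithin (fun z hz => hz.1))
  have h3 := h1.add h2
  simpa [ContinuousWithinAt] using h3


/-! ### Level 3: transport of `u`, `u_x`, `u_xx` along characteristics -/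

lemma slope_seq {F : ℝ → ℝ} {F' x : ℝ} (hF : HasDerivAt F F' x) {y : ℕ → ℝ}
    (hy : Tendsto y atTop (nhds x)) (hne : ∀ n, y n ≠ x) :
    Tendsto (fun n => (F (y n) - F x) / (y n - x)) atTop (nhds F') := by
  have h1 := hasDerivAt_iff_tendsto_slope.1 hF
  have h2 : Tendsto y atTop (nhdsWithin x {x}ᶜ) :=
    tendsto_nhdsWithin_iff.2 ⟨hy, Eventually.of_forall hne⟩
  refine (h1.comp h2).congr fun n => ?_
  simp only [Function.comp, slope_def_field]

lemma GR1 {y y' : ℝ → ℝ} {T K L : ℝ} (hK : 0 ≤ K)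
    (hc : ContinuousOn y (Set.Icc 0 T)) (hd : ∀ s ∈ Set.Ioo 0 T, HasDerivAt y (y' s) s)
    (hb : ∀ s ∈ Set.Ioo 0 T, |y' s| ≤ K * |y s| + L) :
    ∀ s ∈ Set.Icc 0 T, y s ^ 2 ≤ (y T ^ 2 + L ^ 2) * Real.exp ((2 * K + 1) * T) := by
  intro s hs
  have hT : 0 ≤ T := hs.1.trans hs.2
  have hmono : MonotoneOn (fun s => (y s ^ 2 + L ^ 2) * Real.exp ((2 * K + 1) * s))
      (Set.Icc 0 T) := by
    have hd2 : ∀ s ∈ Set.Ioo 0 T, HasDerivAt 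
        (fun s => (y s ^ 2 + L ^ 2) * Real.exp ((2 * K + 1) * s))
        ((2 * y s * y' s + (2 * K + 1) * (y s ^ 2 + L ^ 2)) * Real.exp ((2 * K + 1) * s)) s := by
      intro s hs
      have e1 : HasDerivAt (fun s => Real.exp ((2 * K + 1) * s))
          (Real.exp ((2 * K + 1) * s) * ((2 * K + 1) * 1)) s :=
        ((hasDerivAt_id s).const_mul (2 * K + 1)).exp
      have e2 := (((hd s hs).pow 2).add_const (L ^ 2)).mul e1
      refine e2.congr_deriv ?_
      simp; ring
    apply monotoneOn_of_deriv_nonneg (convex_Icc 0 T)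
    · fun_prop
    · rw [interior_Icc]
      intro s hs; exact (hd2 s hs).differentiableAt.differentiableWithinAt
    · rw [interior_Icc]
      intro s hs
      rw [(hd2 s hs).deriv]
      apply mul_nonneg _ (Real.exp_pos _).le
      have e1 := hb s hs
      have e2 : |2 * y s * y' s| ≤ 2 * |y s| * (K * |y s| + L) := by
        rw [abs_mul, abs_mul, abs_two]
        gcongr
      have e3 := neg_abs_le (2 * y s * y' s)
      have e4 := sq_abs (y s)
      nlinarith [sq_nonneg (|y s| - L), mul_nonneg hK (sq_nonneg L)]
  have h1 := hmono hs (Set.right_mem_Icc.2 hT) hs.2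
  simp only at h1
  have h2 : (1:ℝ) ≤ Real.exp ((2 * K + 1) * s) := by
    apply Real.one_le_exp
    have := hs.1
    positivity
  nlinarith [sq_nonneg (y s), sq_nonneg L]

lemma GR2 {y y' : ℝ → ℝ} {T K : ℝ}
    (hc : ContinuousOn y (Set.Icc 0 T)) (hd : ∀ s ∈ Set.Ioo 0 T, HasDerivAt y (y' s) s)
    (hb : ∀ s ∈ Set.Ioo 0 T, |y' s| ≤ K * |y s|) (hyT : y T ≠ 0) :
    ∀ s ∈ Set.Icc 0 T, y s ≠ 0 := by
  intro s hs hys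
  have hT : 0 ≤ T := hs.1.trans hs.2
  have hanti : AntitoneOn (fun s => y s ^ 2 * Real.exp (-(2 * K) * s)) (Set.Icc 0 T) := by
    have hd2 : ∀ s ∈ Set.Ioo 0 T, HasDerivAt 
        (fun s => y s ^ 2 * Real.exp (-(2 * K) * s))
        ((2 * y s * y' s - (2 * K) * y s ^ 2) * Real.exp (-(2 * K) * s)) s := by
      intro s hs
      have e1 : HasDerivAt (fun s => Real.exp (-(2 * K) * s))
          (Real.exp (-(2 * K) * s) * (-(2 * K) * 1)) s :=
        ((hasDerivAt_id s).const_mul (-(2 * K))).exp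
      have e2 := ((hd s hs).pow 2).mul e1
      refine e2.congr_deriv ?_
      simp; ring
    apply antitoneOn_of_deriv_nonpos (convex_Icc 0 T)
    · fun_prop
    · rw [interior_Icc]
      intro s hs; exact (hd2 s hs).differentiableAt.differentiableWithinAt
    · rw [interior_Icc]
      intro s hs
      rw [(hd2 s hs).deriv]
      apply mul_nonpos_of_nonpos_of_nonneg _ (Real.exp_pos _).le
      have e1 := hb s hs
      have e2 : |2 * y s * y' s| ≤ 2 * |y s| * (K * |y s|) := by
        rw [abs_mul, abs_mul, abs_two]
        gcongr
      have e3 := le_abs_self (2 * y s * y' s)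
      have e4 : 2 * |y s| * (K * |y s|) = 2 * K * y s ^ 2 := by rw [← sq_abs (y s)]; ring
      linarith
  have h1 := hanti hs (Set.right_mem_Icc.2 hT) hs.2
  simp only [hys] at h1
  have h2 : 0 < y T ^ 2 * Real.exp (-(2 * K) * T) := by positivity
  rw [zero_pow two_ne_zero, zero_mul] at h1
  linarith

/-- a characteristic staying well inside the box -/
structure Chr (u : ℝ → ℝ → ℝ) (T R : ℝ) (X : ℝ → ℝ) : Prop where
  cont : ContinuousOn X (Set.Icc 0 T)
  der : ∀ s ∈ Set.Ioo 0 T, HasDerivAt X (u s (X s)) s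
  mem : ∀ s ∈ Set.Icc 0 T, |X s| ≤ R - 1

section Charac
variable {κ : ℝ} {u : ℝ → ℝ → ℝ} {T R M : ℝ}

lemma Box.ulip (h : Box κ u T R M) : ∀ t ∈ Set.Icc 0 T, ∀ x ∈ Set.Icc (-R) R,
    ∀ y ∈ Set.Icc (-R) R, |u t x - u t y| ≤ M * |x - y| := fun t ht =>
  lip_of_bound (convex_Icc _ _) (F' := deriv (u t))
    (fun x => (((h.sol.cd t ht.1).differentiable (by norm_num)) x).hasDerivAt) (h.ux t ht)

lemma Box.plip (h : Box κ u T R M) : ∀ t ∈ Set.Icc 0 T, ∀ x y,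
    |PP κ (u t) x - PP κ (u t) y| ≤ M * |x - y| := fun t ht x y =>
  lip_of_bound convex_univ (F' := ff κ (u t))
    (fun x => hasDerivAt_PP (h.sol.cd t ht.1).continuous (h.sol.l2 t ht.1) x)
    (fun x _ => h.fb t ht x) x trivial y trivial

lemma Box.flip (h : Box κ u T R M) : ∀ t ∈ Set.Icc 0 T, ∀ x ∈ Set.Icc (-R) R,
    ∀ y ∈ Set.Icc (-R) R, |ff κ (u t) x - ff κ (u t) y| ≤ M * |x - y| := fun t ht =>
  lip_of_bound (convex_Icc _ _) (F' := fun x => PP κ (u t) x - gg κ (u t) x)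
    (fun x => hasDerivAt_ff (h.sol.cd t ht.1).continuous (h.sol.l2 t ht.1) x) (h.qq t ht)

lemma DPsol.hasDerivAt_u (h : DPsol κ u) {t : ℝ} (ht : 0 ≤ t) (x : ℝ) :
    HasDerivAt (u t) (deriv (u t) x) x :=
  (((h.cd t ht).differentiable (by norm_num)) x).hasDerivAt

lemma DPsol.contDiff_ux (h : DPsol κ u) {t : ℝ} (ht : 0 ≤ t) : ContDiff ℝ 1 (deriv (u t)) := by
  have h1 : ContDiff ℝ (1 + 1) (u t) := by
    have := h.cd t ht
    rwa [show (1:WithTop ℕ∞) + 1 = 2 by norm_num]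
  exact (contDiff_succ_iff_deriv.1 h1).2.2

lemma DPsol.hasDerivAt_ux (h : DPsol κ u) {t : ℝ} (ht : 0 ≤ t) (x : ℝ) :
    HasDerivAt (deriv (u t)) (deriv (deriv (u t)) x) x :=
  (((h.contDiff_ux ht).differentiable (by norm_num)) x).hasDerivAt

lemma DPsol.hasDerivAt_q (h : DPsol κ u) {t : ℝ} (ht : 0 ≤ t) (x : ℝ) :
    HasDerivAt (fun x => PP κ (u t) x - gg κ (u t) x)
      (ff κ (u t) x - (3 * u t x + 2 * κ) * deriv (u t) x) x := by
  have h1 := hasDerivAt_PP (κ := κ) (h.cd t ht).continuous (h.l2 t ht) x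
  have hu := h.hasDerivAt_u ht x
  have h2 : HasDerivAt (fun x => gg κ (u t) x) ((3 * u t x + 2 * κ) * deriv (u t) x) x := by
    have := ((hu.pow 2).const_mul (3/2)).add (hu.const_mul (2 * κ))
    refine this.congr_deriv ?_
    simp; ring
  exact h1.sub h2

lemma Box.qlip (h : Box κ u T R M) : ∀ t ∈ Set.Icc 0 T, ∀ x ∈ Set.Icc (-R) R,
    ∀ y ∈ Set.Icc (-R) R, |(PP κ (u t) x - gg κ (u t) x) - (PP κ (u t) y - gg κ (u t) y)|
      ≤ M * |x - y| := fun t ht =>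
  lip_of_bound (convex_Icc _ _) (F := fun x => PP κ (u t) x - gg κ (u t) x)
    (F' := fun x => ff κ (u t) x - (3 * u t x + 2 * κ) * deriv (u t) x)
    (fun x => h.sol.hasDerivAt_q ht.1 x) (h.zz t ht)

lemma H_bound (h : DPsol κ u) (hT : 0 ≤ T) (x : ℝ) :
    ∃ M, 0 ≤ M ∧ ∀ t ∈ Set.Icc 0 T, ∀ y ∈ Set.uIoc 0 x, |u t y| ≤ M ∧
      |-(u t y * deriv (u t) y) - ff κ (u t) y| ≤ M := by
  obtain ⟨M, hM⟩ := Box.exists h hT |x|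
  have hm := hM.Mnn
  refine ⟨M + M * M, by positivity, fun t ht y hy => ?_⟩
  have hy' : y ∈ Set.Icc (-|x|) |x| := by
    have h1 := Set.uIoc_subset_uIcc hy
    rw [Set.mem_uIcc] at h1
    have h2 := neg_abs_le x
    have h3 := le_abs_self x
    have h4 := abs_nonneg x
    rcases h1 with h1 | h1 <;> exact ⟨by linarith [h1.1], by linarith [h1.2]⟩
  have e1 := hM.uu t ht y hy'
  have e2 := hM.ux t ht y hy'
  have e3 := hM.fb t ht y
  refine ⟨by nlinarith, ?_⟩
  refine (abs_sub _ _).trans ?_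
  rw [abs_neg, abs_mul]
  have := mul_le_mul e1 e2 (abs_nonneg _) hm
  linarith

lemma H_cont (h : DPsol κ u) (hT : 0 ≤ T) (x : ℝ) :
    ContinuousOn (fun s => ∫ y in (0:ℝ)..x, u s y) (Set.Icc 0 T) := by
  obtain ⟨M, hM, hb⟩ := H_bound h hT x
  intro t ht
  apply intervalIntegral.continuousWithinAt_of_dominated_interval (bound := fun _ => M)
  · filter_upwards [self_mem_nhdsWithin] with s hs
    exact (h.cd s hs.1).continuous.aestronglyMeasurable
  · filter_upwards [self_mem_nhdsWithin] with s hs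
    exact Eventually.of_forall fun y hy => (hb s hs y hy).1
  · exact intervalIntegrable_const
  · exact Eventually.of_forall fun y _ => (h.eq t ht.1 y).continuousAt.continuousWithinAt

lemma H_deriv (h : DPsol κ u) {t : ℝ} (ht : t ∈ Set.Ioo 0 T) (x : ℝ) :
    HasDerivAt (fun s => ∫ y in (0:ℝ)..x, u s y)
      (((1/2) * u t 0 ^ 2 + PP κ (u t) 0) - ((1/2) * u t x ^ 2 + PP κ (u t) x)) t := by
  have hT : 0 ≤ T := ht.1.le.trans ht.2.le
  obtain ⟨M, hM, hb⟩ := H_bound h hT x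
  have hc := (h.cd t ht.1.le).continuous
  have hcont : Continuous (fun y => -(u t y * deriv (u t) y) - ff κ (u t) y) :=
    (hc.mul (h.contDiff_ux ht.1.le).continuous).neg.sub (continuous_ff hc (h.l2 t ht.1.le))
  have h1 := (intervalIntegral.hasDerivAt_integral_of_dominated_loc_of_deriv_le
    (μ := volume) (a := 0) (b := x)
    (F := u) (F' := fun t y => -(u t y * deriv (u t) y) - ff κ (u t) y) (x₀ := t)
    (bound := fun _ => M) (s := Set.Ioo 0 T)
    (Ioo_mem_nhds ht.1 ht.2) (by
      filter_upwards [Ioo_mem_nhds ht.1 ht.2] with s hs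
      exact (h.cd s hs.1.le).continuous.aestronglyMeasurable) (hc.intervalIntegrable _ _)
      hcont.aestronglyMeasurable
      (Eventually.of_forall fun y hy s hs => (hb s (Set.Ioo_subset_Icc_self hs) y hy).2)
      intervalIntegrable_const
      (Eventually.of_forall fun y hy s hs => h.eq s hs.1.le y)).2
  refine h1.congr_deriv ?_
  have h2 : ∀ y ∈ Set.uIcc 0 x, HasDerivAt (fun y => -((1/2) * u t y ^ 2 + PP κ (u t) y)) 
      (-(u t y * deriv (u t) y) - ff κ (u t) y) y := by
    intro y _
    have := ((((h.hasDerivAt_u ht.1.le y).pow 2).const_mul (1/2)).add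
      (hasDerivAt_PP (κ := κ) hc (h.l2 t ht.1.le) y)).neg
    refine this.congr_deriv ?_
    simp; ring
  rw [intervalIntegral.integral_eq_sub_of_hasDerivAt h2 (hcont.intervalIntegrable _ _)]
  ring

lemma H_x (h : DPsol κ u) {t : ℝ} (ht : 0 ≤ t) (x : ℝ) :
    HasDerivAt (fun x => ∫ y in (0:ℝ)..x, u t y) (u t x) x :=
  (h.cd t ht).continuous.integral_hasStrictDerivAt 0 x |>.hasDerivAt

lemma H_chain (h : Box κ u T R M) {X : ℝ → ℝ} {x' t : ℝ} (ht : t ∈ Set.Ioo 0 T)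
    (hX : HasDerivAt X x' t) :
    HasDerivAt (fun s => ∫ y in (0:ℝ)..(X s), u s y)
      ((((1/2) * u t 0 ^ 2 + PP κ (u t) 0) - ((1/2) * u t (X t) ^ 2 + PP κ (u t) (X t)))
        + u t (X t) * x') t := by
  have hn : Set.Icc 0 T ×ˢ Set.univ ∈ nhds (t, X t) := 
    prod_mem_nhds (Icc_mem_nhds ht.1 ht.2) univ_mem
  have hn' : Set.Ioo 0 T ×ˢ Set.univ ∈ nhds (t, X t) := 
    prod_mem_nhds (Ioo_mem_nhds ht.1 ht.2) univ_mem
  have hP := (joint_cont h.tP h.plip)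
  have hjc := h.jc.continuousAt hn
  have hjP := hP.continuousAt hn
  have hu0 : ContinuousAt (fun z : ℝ × ℝ => u z.1 0) (t, X t) :=
    ContinuousAt.comp (f := Prod.fst) (g := fun s => u s 0)
      (h.sol.eq t ht.1.le 0).continuousAt continuousAt_fst
  have hP0 : ContinuousAt (fun z : ℝ × ℝ => PP κ (u z.1) 0) (t, X t) :=
    ContinuousAt.comp (f := Prod.fst) (g := fun s => PP κ (u s) 0)
      ((h.tP 0).continuousAt (Icc_mem_nhds ht.1 ht.2)) continuousAt_fst
  apply chain2 (H := fun s x => ∫ y in (0:ℝ)..x, u s y)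
    (H1 := fun t x => (((1/2) * u t 0 ^ 2 + PP κ (u t) 0) - ((1/2) * u t x ^ 2 + PP κ (u t) x)))
    (H2 := u) _ _ _ hjc hX
  · filter_upwards [hn'] with z hz using H_deriv h.sol hz.1 z.2
  · filter_upwards [hn'] with z hz using H_x h.sol hz.1.1.le z.2
  · exact (((hu0.pow 2).const_mul (1/2)).add hP0).sub (((hjc.pow 2).const_mul (1/2)).add hjP)
end Charac


section Charac2
variable {κ : ℝ} {u : ℝ → ℝ → ℝ} {T R M : ℝ} {X : ℝ → ℝ}

lemma Chr.memD' (hX : Chr u T R X) {s ε : ℝ} (hs : s ∈ Set.Icc 0 T) (h0 : 0 ≤ ε) (h1 : ε ≤ 1) :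
    X s + ε ∈ Set.Icc (-R) R := by
  have := abs_le.1 (hX.mem s hs)
  exact ⟨by linarith [this.1], by linarith [this.2]⟩

lemma Chr.memD (hX : Chr u T R X) {s : ℝ} (hs : s ∈ Set.Icc 0 T) : X s ∈ Set.Icc (-R) R := by
  simpa using hX.memD' hs le_rfl zero_le_one

lemma eps_pos (n : ℕ) : (0:ℝ) < 1 / ((n:ℝ) + 1) := by positivity

lemma eps_le (n : ℕ) : 1 / ((n:ℝ) + 1) ≤ 1 := by
  rw [div_le_one (by positivity)]
  have : (0:ℝ) ≤ n := Nat.cast_nonneg n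
  linarith

lemma eps_tendsto : Tendsto (fun n : ℕ => 1 / ((n:ℝ) + 1)) atTop (nhds 0) :=
  tendsto_one_div_add_atTop_nhds_zero_nat

lemma Chr.ucont (h : Box κ u T R M) (hX : Chr u T R X) :
    ContinuousOn (fun s => u s (X s)) (Set.Icc 0 T) :=
  comp_cont (fun x t ht => (h.sol.eq t ht.1 x).continuousAt.continuousWithinAt) h.ulip hX.cont
    (fun s hs => hX.memD hs)

lemma Chr.fcont (h : Box κ u T R M) (hX : Chr u T R X) :
    ContinuousOn (fun s => ff κ (u s) (X s)) (Set.Icc 0 T) :=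
  comp_cont h.tF h.flip hX.cont (fun s hs => hX.memD hs)

lemma Chr.qcont (h : Box κ u T R M) (hX : Chr u T R X) :
    ContinuousOn (fun s => PP κ (u s) (X s) - gg κ (u s) (X s)) (Set.Icc 0 T) := by
  refine comp_cont (F := fun s x => PP κ (u s) x - gg κ (u s) x) (fun x => ?_)
    h.qlip hX.cont (fun s hs => hX.memD hs)
  have hu : ContinuousOn (fun s => u s x) (Set.Icc 0 T) := 
    fun t ht => (h.sol.eq t ht.1 x).continuousAt.continuousWithinAt
  have hP := h.tP x
  unfold gg
  exact hP.sub (((hu.pow 2).const_mul _).add (hu.const_mul _))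

lemma stepU (h : Box κ u T R M) (hX : Chr u T R X) :
    ∀ s ∈ Set.Ioo 0 T, HasDerivAt (fun s => u s (X s)) (-ff κ (u s) (X s)) s := by
  have hM := h.Mnn
  set ε : ℕ → ℝ := fun n => 1 / ((n:ℝ) + 1) with hε
  have hp : ∀ n, 0 < ε n := eps_pos
  have hle : ∀ n, ε n ≤ 1 := eps_le
  have ht : Tendsto ε atTop (nhds 0) := eps_tendsto
  have hty : ∀ s, Tendsto (fun n => X s + ε n) atTop (nhds (X s)) := fun s => by
    simpa using ht.const_add (X s)
  have hne : ∀ s n, X s + ε n ≠ X s := fun s n => by linarith [hp n] |> fun (h : X s < X s + ε n) => h.ne'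
  set H : ℝ → ℝ → ℝ := fun s x => ∫ y in (0:ℝ)..x, u s y with hH
  have hlipH : ∀ t ∈ Set.Icc 0 T, ∀ x ∈ Set.Icc (-R) R,
      ∀ y ∈ Set.Icc (-R) R, |H t x - H t y| ≤ M * |x - y| := fun t ht =>
    lip_of_bound (convex_Icc _ _) (fun x => H_x h.sol ht.1 x) (h.uu t ht)
  apply FTClim2_deriv (E := fun n s => (H s (X s + ε n) - H s (X s)) / ε n)
    (e := fun n s => (-(1/2) * (u s (X s + ε n) - u s (X s)) ^ 2
      - (PP κ (u s) (X s + ε n) - PP κ (u s) (X s))) / ε n) (K := M ^ 2 + M)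
  · intro n
    refine ContinuousOn.div_const (ContinuousOn.sub ?_ ?_) _
    · exact comp_cont (X := fun s => X s + ε n) (H_cont h.sol h.Tpos) hlipH (hX.cont.add_const _)
        (fun s hs => hX.memD' hs (hp n).le (hle n))
    · exact comp_cont (H_cont h.sol h.Tpos) hlipH hX.cont (fun s hs => hX.memD hs)
  · intro n s hs
    have h1 := H_chain h hs ((hX.der s hs).add_const (ε n))
    have h2 := H_chain h hs (hX.der s hs)
    refine ((h1.sub h2).div_const (ε n)).congr_deriv ?_
    congr 1; ring
  · intro n s hs
    have hs' := Set.Ioo_subset_Icc_self hs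
    rw [abs_div, abs_of_pos (hp n), div_le_iff₀ (hp n)]
    have e1 := h.ulip s hs' _ (hX.memD' hs' (hp n).le (hle n)) _ (hX.memD hs')
    have e2 := h.plip s hs' (X s + ε n) (X s)
    rw [add_sub_cancel_left, abs_of_pos (hp n)] at e1 e2
    have e3 := sq_le_of_abs_le e1
    have e4 : (M * ε n) ^ 2 ≤ M ^ 2 * ε n := by
      have := hle n; have := hp n
      have : ε n * ε n ≤ ε n := by nlinarith
      calc (M * ε n) ^ 2 = M ^ 2 * (ε n * ε n) := by ring
        _ ≤ _ := by gcongr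
    refine (abs_sub _ _).trans ?_
    rw [abs_mul, abs_neg, abs_of_pos (by norm_num : (0:ℝ) < 1/2),
      abs_of_nonneg (sq_nonneg (u s (X s + ε n) - u s (X s)))]
    nlinarith [sq_nonneg (u s (X s + ε n) - u s (X s))]
  · intro s hs
    have hs' := Set.Ioo_subset_Icc_self hs
    have h1 := slope_seq (hasDerivAt_PP (κ := κ) (h.sol.cd s hs'.1).continuous (h.sol.l2 s hs'.1) (X s))
      (hty s) (hne s)
    have h2 := slope_seq (h.sol.hasDerivAt_u hs'.1 (X s)) (hty s) (hne s)
    have h3 := ((h2.mul (h2.mul ht)).const_mul (-(1/2))).sub h1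
    simp only [mul_zero, zero_sub] at h3
    refine h3.congr fun n => ?_
    have := (hp n).ne'
    simp only [add_sub_cancel_left]
    field_simp
  · intro s hs
    have := slope_seq (H_x h.sol hs.1 (X s)) (hty s) (hne s)
    refine this.congr fun n => ?_
    rw [add_sub_cancel_left]
  · exact (hX.fcont h).neg

/-- family of approximating characteristics -/
structure Apx (u : ℝ → ℝ → ℝ) (T R : ℝ) (X : ℝ → ℝ) (Y : ℕ → ℝ → ℝ) : Prop where
  chr : ∀ n, Chr u T R (Y n)
  ne : ∀ n, ∀ s ∈ Set.Icc 0 T, Y n s ≠ X s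
  lim : ∀ s ∈ Set.Icc 0 T, Tendsto (fun n => Y n s) atTop (nhds (X s))

variable {Y : ℕ → ℝ → ℝ}

lemma stepV_gen (h : Box κ u T R M) (hX : Chr u T R X) (hY : Apx u T R X Y) :
    ContinuousOn (fun s => deriv (u s) (X s)) (Set.Icc 0 T) ∧
    ∀ s ∈ Set.Ioo 0 T, HasDerivAt (fun s => deriv (u s) (X s))
      (-(deriv (u s) (X s)) ^ 2 - (PP κ (u s) (X s) - gg κ (u s) (X s))) s := by
  have hM := h.Mnn
  have hne : ∀ n, ∀ s ∈ Set.Icc 0 T, Y n s - X s ≠ 0 := fun n s hs => sub_ne_zero.2 (hY.ne n s hs)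
  have hD : ∀ n, ∀ s ∈ Set.Icc 0 T, |(u s (Y n s) - u s (X s)) / (Y n s - X s)| ≤ M := by
    intro n s hs
    rw [abs_div, div_le_iff₀ (abs_pos.2 (hne n s hs))]
    exact h.ulip s hs _ ((hY.chr n).memD hs) _ (hX.memD hs)
  have hFf : ∀ n, ∀ s ∈ Set.Icc 0 T, |(ff κ (u s) (Y n s) - ff κ (u s) (X s)) / (Y n s - X s)| ≤ M := by
    intro n s hs
    rw [abs_div, div_le_iff₀ (abs_pos.2 (hne n s hs))]
    exact h.flip s hs _ ((hY.chr n).memD hs) _ (hX.memD hs)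
  set E : ℕ → ℝ → ℝ := fun n s => (u s (Y n s) - u s (X s)) / (Y n s - X s) with hE
  set e : ℕ → ℝ → ℝ := fun n s => -(E n s) ^ 2
    - (ff κ (u s) (Y n s) - ff κ (u s) (X s)) / (Y n s - X s) with he
  have hc : ∀ n, ContinuousOn (E n) (Set.Icc 0 T) := fun n =>
    (((hY.chr n).ucont h).sub (hX.ucont h)).div ((hY.chr n).cont.sub hX.cont) (hne n)
  have hd : ∀ n, ∀ t ∈ Set.Ioo 0 T, HasDerivAt (E n) (e n t) t := by
    intro n s hs
    have hs' := Set.Ioo_subset_Icc_self hs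
    have h0 := hne n s hs'
    refine (((stepU h (hY.chr n) s hs).sub (stepU h hX s hs)).div
      (((hY.chr n).der s hs).sub (hX.der s hs)) h0).congr_deriv ?_
    simp only [he, hE, Pi.sub_apply]
    field_simp
    ring
  have hK : ∀ n, ∀ t ∈ Set.Ioo 0 T, |e n t| ≤ M ^ 2 + M := by
    intro n s hs
    have hs' := Set.Ioo_subset_Icc_self hs
    refine (abs_sub _ _).trans ?_
    rw [abs_neg, abs_of_nonneg (sq_nonneg _)]
    exact add_le_add (sq_le_of_abs_le (hD n s hs')) (hFf n s hs')
  have hq : ∀ t ∈ Set.Icc 0 T, Tendsto (fun n => E n t) atTop (nhds (deriv (u t) (X t))) :=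
    fun t ht => slope_seq (h.sol.hasDerivAt_u ht.1 (X t)) (hY.lim t ht) (fun n => hY.ne n t ht)
  have hcont := FTClim2_cont hc hd hK hq
  refine ⟨hcont, FTClim2_deriv hc hd hK ?_ hq ((hcont.pow 2).neg.sub (hX.qcont h))⟩
  intro s hs
  have hs' := Set.Ioo_subset_Icc_self hs
  exact ((hq s hs').pow 2).neg.sub (slope_seq (hasDerivAt_ff (κ := κ) (h.sol.cd s hs'.1).continuous
    (h.sol.l2 s hs'.1) (X s)) (hY.lim s hs') (fun n => hY.ne n s hs'))

lemma stepR (h : Box κ u T R M) (hX : Chr u T R X) (hY : Apx u T R X Y)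
    (hYY : ∀ n, ∃ Z, Apx u T R (Y n) Z) :
    ContinuousOn (fun s => deriv (deriv (u s)) (X s)) (Set.Icc 0 T) ∧
    ∀ s ∈ Set.Ioo 0 T, HasDerivAt (fun s => deriv (deriv (u s)) (X s))
      (-3 * deriv (u s) (X s) * deriv (deriv (u s)) (X s) - 
        (ff κ (u s) (X s) - (3 * u s (X s) + 2 * κ) * deriv (u s) (X s))) s := by
  have hM := h.Mnn
  have hTm := Set.right_mem_Icc.2 h.Tpos
  have hne : ∀ n, ∀ s ∈ Set.Icc 0 T, Y n s - X s ≠ 0 := fun n s hs => sub_ne_zero.2 (hY.ne n s hs)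
  have hvX := stepV_gen h hX hY
  have hvY : ∀ n, _ := fun n => stepV_gen h (hY.chr n) (hYY n).choose_spec
  set D : ℕ → ℝ → ℝ := fun n s => (u s (Y n s) - u s (X s)) / (Y n s - X s) with hDdef
  set Q : ℕ → ℝ → ℝ := fun n s => ((PP κ (u s) (Y n s) - gg κ (u s) (Y n s)) -
    (PP κ (u s) (X s) - gg κ (u s) (X s))) / (Y n s - X s) with hQdef
  have hD : ∀ n, ∀ s ∈ Set.Icc 0 T, |D n s| ≤ M := by
    intro n s hs
    simp only [hDdef]
    rw [abs_div, div_le_iff₀ (abs_pos.2 (hne n s hs))]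
    exact h.ulip s hs _ ((hY.chr n).memD hs) _ (hX.memD hs)
  have hQ : ∀ n, ∀ s ∈ Set.Icc 0 T, |Q n s| ≤ M := by
    intro n s hs
    simp only [hQdef]
    rw [abs_div, div_le_iff₀ (abs_pos.2 (hne n s hs))]
    exact h.qlip s hs _ ((hY.chr n).memD hs) _ (hX.memD hs)
  set E : ℕ → ℝ → ℝ := fun n s => (deriv (u s) (Y n s) - deriv (u s) (X s)) / (Y n s - X s) with hE
  set e : ℕ → ℝ → ℝ := fun n s => 
    -(deriv (u s) (Y n s) + deriv (u s) (X s) + D n s) * E n s - Q n s with he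
  have hc : ∀ n, ContinuousOn (E n) (Set.Icc 0 T) := fun n =>
    ((hvY n).1.sub hvX.1).div ((hY.chr n).cont.sub hX.cont) (hne n)
  have hd : ∀ n, ∀ t ∈ Set.Ioo 0 T, HasDerivAt (E n) (e n t) t := by
    intro n s hs
    have hs' := Set.Ioo_subset_Icc_self hs
    have h0 := hne n s hs'
    refine (((hvY n).2 s hs).sub (hvX.2 s hs) |>.div
      (((hY.chr n).der s hs).sub (hX.der s hs)) h0).congr_deriv ?_
    simp only [he, hE, hDdef, hQdef, Pi.sub_apply]
    field_simp
    ring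
  have hb : ∀ n, ∀ s ∈ Set.Ioo 0 T, |e n s| ≤ 3 * M * |E n s| + M := by
    intro n s hs
    have hs' := Set.Ioo_subset_Icc_self hs
    refine (abs_sub _ _).trans (add_le_add ?_ (hQ n s hs'))
    rw [abs_mul, abs_neg]
    apply mul_le_mul_of_nonneg_right _ (abs_nonneg _)
    refine (abs_add_three _ _ _).trans ?_
    linarith [h.ux s hs' _ ((hY.chr n).memD hs'), h.ux s hs' _ (hX.memD hs'), hD n s hs']
  have hq : ∀ t ∈ Set.Icc 0 T, Tendsto (fun n => E n t) atTop (nhds (deriv (deriv (u t)) (X t))) :=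
    fun t ht => slope_seq (h.sol.hasDerivAt_ux ht.1 (X t)) (hY.lim t ht) (fun n => hY.ne n t ht)
  obtain ⟨A, hA⟩ := ((hq T hTm).pow 2).bddAbove_range
  have hA' : ∀ n, E n T ^ 2 ≤ A := fun n => hA ⟨n, rfl⟩
  have hA0 : 0 ≤ A := (sq_nonneg _).trans (hA' 0)
  set G := (A + M ^ 2) * Real.exp ((2 * (3 * M) + 1) * T) with hG
  have hG0 : 0 ≤ G := by positivity
  have hEb : ∀ n, ∀ s ∈ Set.Icc 0 T, |E n s| ≤ G + 1 := by
    intro n s hs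
    have h1 := GR1 (by positivity : 0 ≤ 3 * M) (hc n) (hd n) (hb n) s hs
    have h2 : (E n T ^ 2 + M ^ 2) * Real.exp ((2 * (3 * M) + 1) * T) ≤ G := by
      rw [hG]; gcongr; exact hA' n
    have h3 := sq_abs (E n s)
    nlinarith [sq_nonneg (|E n s| - 1)]
  have hK : ∀ n, ∀ t ∈ Set.Ioo 0 T, |e n t| ≤ 3 * M * (G + 1) + M := by
    intro n s hs
    refine (hb n s hs).trans ?_
    gcongr
    exact hEb n s (Set.Ioo_subset_Icc_self hs)
  have hcont := FTClim2_cont hc hd hK hq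
  refine ⟨hcont, FTClim2_deriv hc hd hK ?_ hq ?_⟩
  · intro s hs
    have hs' := Set.Ioo_subset_Icc_self hs
    have l1 : Tendsto (fun n => deriv (u s) (Y n s)) atTop (nhds (deriv (u s) (X s))) :=
      ((h.sol.contDiff_ux hs'.1).continuous.tendsto (X s)).comp (hY.lim s hs')
    have l2 : Tendsto (fun n => D n s) atTop (nhds (deriv (u s) (X s))) :=
      slope_seq (h.sol.hasDerivAt_u hs'.1 (X s)) (hY.lim s hs') (fun n => hY.ne n s hs')
    have l3 : Tendsto (fun n => Q n s) atTop (nhds _) :=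
      slope_seq (h.sol.hasDerivAt_q hs'.1 (X s)) (hY.lim s hs') (fun n => hY.ne n s hs')
    have l4 := ((((l1.add_const (deriv (u s) (X s))).add l2).neg).mul (hq s hs')).sub l3
    convert l4 using 2
    ring
  · have a1 := hvX.1
    have a2 := hX.fcont h
    have a3 := hX.ucont h
    exact ((a1.const_mul (-3)).mul hcont).sub 
      (a2.sub (((a3.const_mul 3).add_const (2 * κ)).mul a1))

lemma w_sign (h : Box κ u T R M) (hX : Chr u T R X) (hY : Apx u T R X Y)
    (hYY : ∀ n, ∃ Z, Apx u T R (Y n) Z)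
    (hw0 : ∀ x : ℝ, 0 ≤ u 0 x - deriv (deriv (u 0)) x + (2/3)*κ) :
    0 ≤ u T (X T) - deriv (deriv (u T)) (X T) + (2/3)*κ := by
  have hv := stepV_gen h hX hY
  have hr := stepR h hX hY hYY
  set w : ℝ → ℝ := fun s => u s (X s) - deriv (deriv (u s)) (X s) + (2/3)*κ with hw
  have hc : ContinuousOn w (Set.Icc 0 T) := ((hX.ucont h).sub hr.1).add_const _
  have hd : ∀ s ∈ Set.Ioo 0 T, HasDerivAt w (-3 * deriv (u s) (X s) * w s) s := by
    intro s hs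
    refine (((stepU h hX s hs).sub (hr.2 s hs)).add_const ((2/3)*κ)).congr_deriv ?_
    simp only [hw]; ring
  by_contra hcon
  push Not at hcon
  have h1 := GR2 (K := 3 * M) hc hd (fun s hs => by
    rw [abs_mul, abs_mul]
    apply mul_le_mul_of_nonneg_right _ (abs_nonneg _)
    have hs' := Set.Ioo_subset_Icc_self hs
    rw [abs_neg, abs_of_pos (by norm_num : (0:ℝ) < 3)]
    linarith [h.ux s hs' _ (hX.memD hs')]) hcon.ne
  obtain ⟨s, hs, hs0⟩ := intermediate_value_Icc' h.Tpos hc ⟨hcon.le, hw0 (X 0)⟩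
  exact h1 s hs hs0
end Charac2


/-! ### Level 3: existence of characteristics -/

lemma mvt_abs {F F' : ℝ → ℝ} {a b K : ℝ} (hab : a ≤ b) (hc : ContinuousOn F (Set.Icc a b))
    (hd : ∀ s ∈ Set.Ioo a b, HasDerivAt F (F' s) s) (hK : ∀ s ∈ Set.Ioo a b, |F' s| ≤ K) :
    |F b - F a| ≤ K * (b - a) := by
  rcases hab.eq_or_lt with rfl | h
  · simp
  obtain ⟨r, hr, he⟩ := exists_hasDerivAt_eq_slope F F' h hc hd
  have h1 := hK r hr
  rw [he, abs_div, abs_of_pos (sub_pos.2 h), div_le_iff₀ (sub_pos.2 h)] at h1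
  exact h1

lemma DPsol.shift {κ : ℝ} {u : ℝ → ℝ → ℝ} (h : DPsol κ u) {σ : ℝ} (hσ : 0 ≤ σ) :
    DPsol κ (fun t => u (t + σ)) := by
  refine ⟨h.kpos, fun t ht => h.cd _ (by linarith), fun t ht => h.l2 _ (by linarith), ?_⟩
  intro t ht x
  exact (h.eq (t + σ) (by linarith) x).comp_add_const t σ

lemma clamp_lip (R x y : ℝ) : |max (-R) (min R x) - max (-R) (min R y)| ≤ |x - y| := by
  refine (abs_max_sub_max_le_max _ _ _ _).trans ?_
  rw [sub_self, abs_zero]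
  refine max_le (abs_nonneg _) ?_
  refine (abs_min_sub_min_le_max _ _ _ _).trans ?_
  rw [sub_self, abs_zero]
  exact max_le (abs_nonneg _) le_rfl

lemma clamp_mem {R : ℝ} (hR : 0 ≤ R) (x : ℝ) : max (-R) (min R x) ∈ Set.Icc (-R) R :=
  ⟨le_max_left _ _, max_le (by linarith) (min_le_left _ _)⟩

lemma clamp_eq {R x : ℝ} (h : |x| ≤ R) : max (-R) (min R x) = x := by
  have := abs_le.1 h
  rw [min_eq_right this.2, max_eq_right this.1]

lemma char_exists_clamp {κ : ℝ} {u : ℝ → ℝ → ℝ} {T R M : ℝ} (h : Box κ u T R M) (hR : 0 ≤ R)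
    (ξ : ℝ) : ∃ X : ℝ → ℝ, X T = ξ ∧ ContinuousOn X (Set.Icc 0 T) ∧
      ∀ s ∈ Set.Ioo 0 T, HasDerivAt X (u s (max (-R) (min R (X s)))) s := by
  have hT := h.Tpos
  have hM := h.Mnn
  have hPL : IsPicardLindelof (fun s y => u s (max (-R) (min R y))) 
      (⟨T, Set.right_mem_Icc.2 hT⟩ : Set.Icc (0:ℝ) T) ξ ⟨M * T, mul_nonneg hM hT⟩ 0 ⟨M, hM⟩ ⟨M, hM⟩ := by
    refine ⟨?_, ?_, ?_, ?_⟩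
    · intro t ht
      apply LipschitzOnWith.of_dist_le_mul
      intro x _ y _
      rw [Real.dist_eq, Real.dist_eq]
      refine (h.ulip t ht _ (clamp_mem hR x) _ (clamp_mem hR y)).trans ?_
      exact mul_le_mul_of_nonneg_left (clamp_lip R x y) hM
    · intro x _ t ht
      exact (h.sol.eq t ht.1 _).continuousAt.continuousWithinAt
    · intro t ht x _
      exact h.uu t ht _ (clamp_mem hR x)
    · simp [hT]
      exact le_rfl
  obtain ⟨X, hX0, hX⟩ := hPL.exists_eq_forall_mem_Icc_hasDerivWithinAt₀
  refine ⟨X, hX0, fun s hs => (hX s hs).continuousWithinAt, fun s hs => ?_⟩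
  exact (hX s (Set.Ioo_subset_Icc_self hs)).hasDerivAt (Icc_mem_nhds hs.1 hs.2)

lemma char_exists {κ : ℝ} {u : ℝ → ℝ → ℝ} (h : DPsol κ u) {T : ℝ} (hT : 0 ≤ T) (x : ℝ) :
    ∃ R M, Box κ u T R M ∧ ∀ ξ, |ξ - x| ≤ 2 → ∃ X, Chr u T R X ∧ X T = ξ := by
  obtain ⟨C, hC⟩ := Box.exists h hT 0
  have hC0 := hC.Mnn
  obtain ⟨M0, hM0⟩ := Box.exists h hT (|x| + 2)
  have hM00 := hM0.Mnn
  set B0 := M0 + C * T with hB0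
  have hB00 : 0 ≤ B0 := by positivity
  set R0 := B0 * T + 1 with hR0
  have hR00 : 0 < R0 := by positivity
  set R := |x| + 2 + R0 + 1 with hR
  have hRp : 0 ≤ R := by positivity
  obtain ⟨M, hM⟩ := Box.exists h hT R
  refine ⟨R, M, hM, fun ξ hξ => ?_⟩
  have hξ' : |ξ| ≤ |x| + 2 := by
    have := abs_sub_abs_le_abs_sub ξ x; linarith
  obtain ⟨X, hXT, hXc, hXd⟩ := char_exists_clamp hM hRp ξ
  have himp : ∀ s, |X s - ξ| ≤ R0 → |X s| ≤ R - 1 := by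
    intro s hs
    have := abs_sub_abs_le_abs_sub (X s) ξ; linarith
  have key : ∀ s ∈ Set.Icc 0 T, |X s - ξ| ≤ R0 := by
    by_contra hcon
    push Not at hcon
    obtain ⟨s1, hs1, hs1'⟩ := hcon
    set S : Set ℝ := Set.Icc 0 T ∩ (fun s => |X s - ξ|) ⁻¹' (Set.Ici R0) with hS
    have hSc : IsCompact S := by
      apply isCompact_Icc.of_isClosed_subset _ Set.inter_subset_left
      exact ContinuousOn.preimage_isClosed_of_isClosed (hXc.sub continuousOn_const |>.abs) isClosed_Icc isClosed_Ici
    obtain ⟨σ, hσ, hσm⟩ := hSc.exists_isGreatest ⟨s1, hs1, hs1'.le⟩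
    have hσT : σ < T := by
      refine lt_of_le_of_ne hσ.1.2 ?_
      rintro rfl
      have := hσ.2
      simp only [Set.mem_preimage, hXT, sub_self, abs_zero, Set.mem_Ici] at this
      linarith
    have hlt : ∀ s ∈ Set.Ioc σ T, |X s - ξ| < R0 := by
      intro s hs
      by_contra hc
      push Not at hc
      have : s ≤ σ := hσm ⟨⟨hσ.1.1.trans hs.1.le, hs.2⟩, hc⟩
      linarith [hs.1]
    have hσle : |X σ - ξ| ≤ R0 := by
      have hsub : Set.Ioc σ T ⊆ Set.Icc 0 T := fun s hs => ⟨hσ.1.1.trans hs.1.le, hs.2⟩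
      have h1 : Tendsto (fun s => |X s - ξ|) (nhdsWithin σ (Set.Ioc σ T)) (nhds |X σ - ξ|) :=
        (((hXc.sub continuousOn_const).abs) σ hσ.1).mono_left (nhdsWithin_mono _ hsub)
      have : (nhdsWithin σ (Set.Ioc σ T)).NeBot := by
        rw [nhdsWithin_Ioc_eq_nhdsGT hσT]; infer_instance
      refine le_of_tendsto h1 ?_
      filter_upwards [self_mem_nhdsWithin] with s hs using (hlt s hs).le
    have hle : ∀ s ∈ Set.Icc σ T, |X s - ξ| ≤ R0 := by
      intro s hs
      rcases hs.1.eq_or_lt with rfl | h'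
      · exact hσle
      · exact (hlt s ⟨h', hs.2⟩).le
    have hσ0 := hσ.1.1
    have hT' : 0 ≤ T - σ := by linarith
    have hsh := h.shift hσ0
    obtain ⟨M', hM'⟩ := Box.exists hsh hT' R
    have hder : ∀ s ∈ Set.Ioo 0 (T - σ), HasDerivAt (fun s => X (s + σ)) (u (s + σ) (X (s + σ))) s := by
      intro s hs
      have h1 := hXd (s + σ) ⟨by linarith [hs.1], by linarith [hs.2]⟩
      rw [clamp_eq ((himp _ (hle (s + σ) ⟨by linarith [hs.1], by linarith [hs.2]⟩)).trans
        (by linarith))] at h1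
      exact h1.comp_add_const s σ
    have hcont : ContinuousOn (fun s => X (s + σ)) (Set.Icc 0 (T - σ)) := by
      refine ContinuousOn.comp (t := Set.Icc 0 T) hXc (by fun_prop) ?_
      intro s hs
      exact ⟨by linarith [hs.1], by linarith [hs.2]⟩
    have hchr : Chr (fun t => u (t + σ)) (T - σ) R (fun s => X (s + σ)) :=
      ⟨hcont, hder, fun s hs => himp _ (hle _ ⟨by linarith [hs.1], by linarith [hs.2]⟩)⟩
    have hU := stepU hM' hchr
    have hUc := hchr.ucont hM'
    have hUb : ∀ s ∈ Set.Icc 0 (T - σ), |u (s + σ) (X (s + σ))| ≤ B0 := by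
      intro s hs
      have h1 := mvt_abs (K := C) hs.2 (hUc.mono (Set.Icc_subset_Icc hs.1 le_rfl))
        (fun r hr => hU r ⟨hs.1.trans_lt hr.1, hr.2⟩) (fun r hr => by
          rw [abs_neg]
          exact hC.fb _ ⟨by linarith [hr.1, hs.1], by linarith [hr.2]⟩ _)
      simp only [sub_add_cancel, hXT] at h1
      have h2 := hM0.uu T ⟨hT, le_rfl⟩ ξ (abs_le.1 hξ')
      have h3 : C * (T - σ - s) ≤ C * T := by
        apply mul_le_mul_of_nonneg_left _ hC0; linarith [hs.1]
      have h4 := abs_sub_abs_le_abs_sub (u (s + σ) (X (s + σ))) (u T ξ)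
      rw [abs_sub_comm] at h4
      linarith
    have h5 := mvt_abs (K := B0) hT' hcont hder (fun s hs => hUb s (Set.Ioo_subset_Icc_self hs))
    simp only [sub_add_cancel, zero_add, hXT, sub_zero] at h5
    have h6 : R0 ≤ |X σ - ξ| := hσ.2
    rw [abs_sub_comm] at h6
    have h7 : B0 * (T - σ) ≤ B0 * T := by
      apply mul_le_mul_of_nonneg_left _ hB00; linarith
    linarith
  refine ⟨X, ⟨hXc, fun s hs => ?_, fun s hs => himp s (key s hs)⟩, hXT⟩
  have h1 := hXd s hs
  rwa [clamp_eq ((himp s (key s (Set.Ioo_subset_Icc_self hs))).trans (by linarith))] at h1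

lemma apx_of {κ : ℝ} {u : ℝ → ℝ → ℝ} {T R M : ℝ} (h : Box κ u T R M) {X : ℝ → ℝ}
    {Y : ℕ → ℝ → ℝ} (hX : Chr u T R X) (hY : ∀ n, Chr u T R (Y n))
    (hT : ∀ n, Y n T = X T + 1 / ((n:ℝ) + 1)) : Apx u T R X Y := by
  have hM := h.Mnn
  have hc : ∀ n, ContinuousOn (fun s => Y n s - X s) (Set.Icc 0 T) := fun n =>
    (hY n).cont.sub hX.cont
  have hd : ∀ n, ∀ s ∈ Set.Ioo 0 T, HasDerivAt (fun s => Y n s - X s) 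
      (u s (Y n s) - u s (X s)) s := fun n s hs => ((hY n).der s hs).sub (hX.der s hs)
  have hb : ∀ n, ∀ s ∈ Set.Ioo 0 T, |u s (Y n s) - u s (X s)| ≤ M * |Y n s - X s| := by
    intro n s hs
    have hs' := Set.Ioo_subset_Icc_self hs
    exact h.ulip s hs' _ ((hY n).memD hs') _ (hX.memD hs')
  have heT : ∀ n, Y n T - X T = 1 / ((n:ℝ) + 1) := fun n => by rw [hT]; ring
  refine ⟨hY, fun n s hs => ?_, fun s hs => ?_⟩
  · have := GR2 (hc n) (hd n) (hb n) (by simp only [heT]; exact (eps_pos n).ne') s hs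
    exact sub_ne_zero.1 this
  · have h1 : ∀ n, (Y n s - X s) ^ 2 ≤ (1 / ((n:ℝ) + 1)) ^ 2 * Real.exp ((2 * M + 1) * T) := by
      intro n
      have := GR1 (L := 0) hM (hc n) (hd n) (fun s hs => by simpa using hb n s hs) s hs
      simp only [heT] at this
      simpa using this
    have h2 : Tendsto (fun n : ℕ => (1 / ((n:ℝ) + 1)) ^ 2 * Real.exp ((2 * M + 1) * T)) atTop
        (nhds 0) := by
      have := (eps_tendsto.pow 2).mul_const (Real.exp ((2 * M + 1) * T))
      simpa using this
    have h3 : Tendsto (fun n => (Y n s - X s) ^ 2) atTop (nhds 0) :=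
      squeeze_zero (fun n => sq_nonneg _) h1 h2
    have h4 : Tendsto (fun n => |Y n s - X s|) atTop (nhds 0) := by
      have := (Real.continuous_sqrt.tendsto 0).comp h3
      rw [Real.sqrt_zero] at this
      refine this.congr fun n => ?_
      simp [Real.sqrt_sq_eq_abs]
    have h5 := (tendsto_zero_iff_abs_tendsto_zero _).2 h4
    have h6 := h5.add_const (X s)
    simpa using h6

lemma w_nonneg {κ : ℝ} {u : ℝ → ℝ → ℝ} (h : DPsol κ u)
    (hw0 : ∀ x : ℝ, 0 ≤ u 0 x - deriv (deriv (u 0)) x + (2/3)*κ) {T : ℝ} (hT : 0 ≤ T) (x : ℝ) :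
    0 ≤ u T x - deriv (deriv (u T)) x + (2/3)*κ := by
  obtain ⟨R, M, hB, hex⟩ := char_exists h hT x
  obtain ⟨X, hX, hXT⟩ := hex x (by simp)
  have hex1 : ∀ n : ℕ, ∃ Y, Chr u T R Y ∧ Y T = x + 1 / ((n:ℝ) + 1) := fun n => hex _ (by
    rw [add_sub_cancel_left, abs_of_pos (eps_pos n)]; linarith [eps_le n])
  choose Y hY hYT using hex1
  have hA : Apx u T R X Y := apx_of hB hX hY (fun n => by rw [hYT, hXT])
  have hAA : ∀ n, ∃ Z, Apx u T R (Y n) Z := by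
    intro n
    have hex2 : ∀ m : ℕ, ∃ Z, Chr u T R Z ∧ Z T = x + 1 / ((n:ℝ) + 1) + 1 / ((m:ℝ) + 1) :=
      fun m => hex _ (by
        rw [add_assoc, add_sub_cancel_left, abs_of_pos (add_pos (eps_pos n) (eps_pos m))]
        linarith [eps_le n, eps_le m])
    choose Z hZ hZT using hex2
    exact ⟨Z, apx_of hB (hY n) hZ (fun m => by rw [hZT, hYT])⟩
  have := w_sign hB hX hA hAA hw0
  rwa [hXT] at this


/-! ### Final step: static consequences of a signed momentum density -/

lemma not_le_neg_one {v : ℝ → ℝ} (h2 : Integrable (fun x => v x ^ 2)) {a : ℝ}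
    (h : ∀ x, a ≤ x → v x ≤ -1) : False := by
  have h1 := h2.measure_norm_ge_lt_top (ε := 1) one_pos
  have h3 : Set.Ici a ⊆ {x | 1 ≤ ‖v x ^ 2‖} := by
    intro x hx
    have := h x hx
    simp only [Set.mem_setOf_eq, Real.norm_eq_abs]
    rw [abs_of_nonneg (sq_nonneg _)]
    nlinarith
  have h4 := lt_of_le_of_lt (measure_mono h3) h1
  rw [Real.volume_Ici] at h4
  exact lt_irrefl _ h4

lemma add_deriv_nonneg {c : ℝ} {v : ℝ → ℝ} (hc : ContDiff ℝ 2 v)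
    (h2 : Integrable (fun x => v x ^ 2)) (hw : ∀ x, 0 ≤ v x - deriv (deriv v) x + c) (x0 : ℝ) :
    0 ≤ (v x0 + c) + deriv v x0 := by
  by_contra hcon
  push Not at hcon
  have hd1 : ∀ x, HasDerivAt v (deriv v x) x := fun x =>
    ((hc.differentiable (by norm_num)) x).hasDerivAt
  have hc1 : ContDiff ℝ 1 (deriv v) := by
    have h1 : ContDiff ℝ (1 + 1) v := by
      rwa [show (1:WithTop ℕ∞) + 1 = 2 by norm_num]
    exact (contDiff_succ_iff_deriv.1 h1).2.2
  have hd2 : ∀ x, HasDerivAt (deriv v) (deriv (deriv v) x) x := fun x =>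
    ((hc1.differentiable (by norm_num)) x).hasDerivAt
  have hen : ∀ x : ℝ, HasDerivAt (fun x : ℝ => Real.exp (-x)) (-Real.exp (-x)) x := fun x => by
    simpa using (hasDerivAt_neg x).exp
  have hφ : ∀ x, HasDerivAt (fun x => Real.exp (-x) * ((v x + c) + deriv v x))
      (-(Real.exp (-x) * (v x - deriv (deriv v) x + c))) x := fun x => by
    refine ((hen x).mul (((hd1 x).add_const c).add (hd2 x))).congr_deriv ?_
    simp only [Pi.add_apply]
    ring
  have hanti : Antitone (fun x => Real.exp (-x) * ((v x + c) + deriv v x)) := by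
    apply antitone_of_deriv_nonpos (fun x => (hφ x).differentiableAt)
    intro x
    rw [(hφ x).deriv]
    exact neg_nonpos.2 (mul_nonneg (Real.exp_pos _).le (hw x))
  set δ := -(Real.exp (-x0) * ((v x0 + c) + deriv v x0)) with hδ
  have hδ0 : 0 < δ := by
    rw [hδ, neg_pos]; exact mul_neg_of_pos_of_neg (Real.exp_pos _) hcon
  have hub : ∀ x, x0 ≤ x → (v x + c) + deriv v x ≤ -δ * Real.exp x := by
    intro x hx
    have h1 := hanti hx
    simp only at h1
    have h3 : Real.exp x * (Real.exp (-x) * ((v x + c) + deriv v x)) ≤ Real.exp x * (-δ) := by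
      apply mul_le_mul_of_nonneg_left _ (Real.exp_pos _).le
      rw [hδ, neg_neg]; exact h1
    rw [← mul_assoc, ← Real.exp_add, add_neg_cancel, Real.exp_zero, one_mul] at h3
    linarith
  have hψ : ∀ x, HasDerivAt (fun x => Real.exp x * (v x + c) + (δ/2) * (Real.exp x * Real.exp x))
      (Real.exp x * ((v x + c) + deriv v x) + δ * (Real.exp x * Real.exp x)) x := fun x => by
    refine (((Real.hasDerivAt_exp x).mul ((hd1 x).add_const c)).add
      (((Real.hasDerivAt_exp x).mul (Real.hasDerivAt_exp x)).const_mul (δ/2))).congr_deriv ?_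
    ring
  have hanti2 : AntitoneOn (fun x => Real.exp x * (v x + c) + (δ/2) * (Real.exp x * Real.exp x))
      (Set.Ici x0) := by
    apply antitoneOn_of_deriv_nonpos (convex_Ici x0)
    · exact fun x _ => (hψ x).continuousAt.continuousWithinAt
    · exact fun x _ => (hψ x).differentiableAt.differentiableWithinAt
    · intro x hx
      rw [interior_Ici] at hx
      rw [(hψ x).deriv]
      have := mul_le_mul_of_nonneg_left (hub x (le_of_lt hx)) (Real.exp_pos x).le
      linarith
  set A := Real.exp x0 * (v x0 + c) + (δ/2) * (Real.exp x0 * Real.exp x0) with hA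
  have hub2 : ∀ x, x0 ≤ x → 0 ≤ x → v x + c ≤ |A| - (δ/2) * Real.exp x := by
    intro x hx hx0
    have h1 : Real.exp x * (v x + c) + (δ/2) * (Real.exp x * Real.exp x) ≤ A :=
      hanti2 Set.self_mem_Ici hx hx
    have h3 : A ≤ |A| * Real.exp x := by
      have e1 := le_abs_self A
      have e2 := abs_nonneg A
      have e3 := Real.one_le_exp hx0
      nlinarith
    have h4 : Real.exp x * (v x + c) ≤ Real.exp x * (|A| - (δ/2) * Real.exp x) := by
      linarith
    exact le_of_mul_le_mul_left h4 (Real.exp_pos x)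
  set B := (2/δ) * (|A| + |c| + 1) with hB
  apply not_le_neg_one h2 (a := max (max x0 0) B)
  intro x hx
  have e1 : x0 ≤ x := (le_max_left _ _).trans ((le_max_left _ _).trans hx)
  have e2 : 0 ≤ x := (le_max_right _ _).trans ((le_max_left _ _).trans hx)
  have e3 : B ≤ x := (le_max_right _ _).trans hx
  have e4 := hub2 x e1 e2
  have e5 : B ≤ Real.exp x := by linarith [Real.add_one_le_exp x]
  have e6 : (δ/2) * B ≤ (δ/2) * Real.exp x := mul_le_mul_of_nonneg_left e5 (by positivity)
  have e7 : (δ/2) * B = |A| + |c| + 1 := by rw [hB]; field_simp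
  have e8 := neg_abs_le c
  linarith

lemma abs_deriv_le {c : ℝ} {v : ℝ → ℝ} (hc : ContDiff ℝ 2 v)
    (h2 : Integrable (fun x => v x ^ 2)) (hw : ∀ x, 0 ≤ v x - deriv (deriv v) x + c) (x : ℝ) :
    |deriv v x| ≤ v x + c := by
  have h1 := add_deriv_nonneg hc h2 hw x
  have hd : deriv (fun x => v (-x)) = fun x => -deriv v (-x) := by
    ext y; exact deriv_comp_neg v y
  have hdd : ∀ y, deriv (deriv (fun x => v (-x))) y = deriv (deriv v) (-y) := by
    intro y
    rw [hd, deriv.fun_neg, deriv_comp_neg (deriv v) y, neg_neg]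
  have h3 := add_deriv_nonneg (c := c) (v := fun x => v (-x)) (hc.comp contDiff_neg) h2.comp_neg
    (fun y => by rw [hdd]; exact hw (-y)) (-x)
  rw [hd] at h3
  simp only [neg_neg] at h3
  rw [abs_le]
  constructor <;> linarith

lemma lower_bd {c : ℝ} {v : ℝ → ℝ} (hd : ∀ x, HasDerivAt v (deriv v x) x)
    (hb : ∀ x, |deriv v x| ≤ v x + c) (x y : ℝ) :
    (v x + c) * (1 - |y - x|) ≤ v y + c := by
  have hm : ∀ x, 0 ≤ v x + c := fun x => (abs_nonneg _).trans (hb x)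
  have key : (v x + c) * Real.exp (-|y - x|) ≤ v y + c := by
    rcases le_total x y with hxy | hxy
    · have hψ : ∀ x, HasDerivAt (fun x => Real.exp x * (v x + c))
          (Real.exp x * ((v x + c) + deriv v x)) x := fun x => by
        refine ((Real.hasDerivAt_exp x).mul ((hd x).add_const c)).congr_deriv ?_
        ring
      have hmono : Monotone (fun x => Real.exp x * (v x + c)) := by
        apply monotone_of_deriv_nonneg (fun x => (hψ x).differentiableAt)
        intro x
        rw [(hψ x).deriv]
        have := abs_le.1 (hb x)
        exact mul_nonneg (Real.exp_pos _).le (by linarith [this.1])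
      have h1 := hmono hxy
      simp only at h1
      rw [abs_of_nonneg (sub_nonneg.2 hxy)]
      have h3 := mul_le_mul_of_nonneg_left h1 (Real.exp_pos (-y)).le
      rw [← mul_assoc, ← mul_assoc, ← Real.exp_add, ← Real.exp_add, neg_add_cancel, Real.exp_zero,
        one_mul] at h3
      rw [show -(y - x) = -y + x by ring]
      linarith
    · have hψ : ∀ x, HasDerivAt (fun x => Real.exp (-x) * (v x + c))
          (Real.exp (-x) * (deriv v x - (v x + c))) x := fun x => by
        have hen : HasDerivAt (fun x : ℝ => Real.exp (-x)) (-Real.exp (-x)) x := by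
          simpa using (hasDerivAt_neg x).exp
        refine (hen.mul ((hd x).add_const c)).congr_deriv ?_
        ring
      have hanti : Antitone (fun x => Real.exp (-x) * (v x + c)) := by
        apply antitone_of_deriv_nonpos (fun x => (hψ x).differentiableAt)
        intro x
        rw [(hψ x).deriv]
        have := abs_le.1 (hb x)
        exact mul_nonpos_of_nonneg_of_nonpos (Real.exp_pos _).le (by linarith [this.2])
      have h1 := hanti hxy
      simp only at h1
      rw [abs_of_nonpos (sub_nonpos.2 hxy)]
      have h3 := mul_le_mul_of_nonneg_left h1 (Real.exp_pos y).le
      rw [← mul_assoc, ← mul_assoc, ← Real.exp_add, ← Real.exp_add, add_neg_cancel, Real.exp_zero,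
        one_mul] at h3
      rw [show - -(y - x) = y + -x by ring]
      linarith
  refine le_trans (mul_le_mul_of_nonneg_left ?_ (hm x)) key
  linarith [Real.add_one_le_exp (-|y - x|)]

lemma sup_bd {c : ℝ} (hc0 : 0 ≤ c) {v : ℝ → ℝ} (h2 : Integrable (fun x => v x ^ 2))
    (hd : ∀ x, HasDerivAt v (deriv v x) x)
    (hb : ∀ x, |deriv v x| ≤ v x + c) (x : ℝ) (hx : 2 * c ≤ v x) :
    (25/128) * v x ^ 2 ≤ ∫ y, v y ^ 2 := by
  have h0 : 0 ≤ v x := by linarith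
  have h1 : ∀ y ∈ Set.Icc (x - 1/4) (x + 1/4), (25/64) * v x ^ 2 ≤ v y ^ 2 := by
    intro y hy
    have e1 := lower_bd hd hb x y
    have e2 : |y - x| ≤ 1/4 := abs_le.2 ⟨by linarith [hy.1], by linarith [hy.2]⟩
    have e3 : (5/8) * v x ≤ v y := by nlinarith
    calc (25/64) * v x ^ 2 = ((5/8) * v x) ^ 2 := by ring
      _ ≤ _ := by gcongr
  have h3 : ∫ y in Set.Icc (x - 1/4) (x + 1/4), (25/64) * v x ^ 2 ≤
      ∫ y in Set.Icc (x - 1/4) (x + 1/4), v y ^ 2 :=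
    setIntegral_mono_on (integrableOn_const (by simp)) h2.integrableOn measurableSet_Icc h1
  have h4 := setIntegral_le_integral (s := Set.Icc (x - 1/4) (x + 1/4)) h2
    (Eventually.of_forall fun y => sq_nonneg (v y))
  have h5 : ∫ y in Set.Icc (x - 1/4) (x + 1/4), (25/64) * v x ^ 2 = (25/128) * v x ^ 2 := by
    rw [setIntegral_const]
    simp only [Measure.real, Real.volume_Icc, smul_eq_mul]
    rw [ENNReal.toReal_ofReal (by linarith)]
    ring
  linarith

lemma int_sq_eq {v : ℝ → ℝ} (h : MemLp v 2 volume) :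
    ∫ y, v y ^ 2 = (eLpNorm v 2 volume).toReal ^ 2 := by
  rw [MemLp.eLpNorm_eq_integral_rpow_norm two_ne_zero ENNReal.ofNat_ne_top h]
  have h0 : 0 ≤ ∫ y, v y ^ 2 := integral_nonneg fun y => sq_nonneg _
  simp only [ENNReal.toReal_ofNat, Real.norm_eq_abs, Real.rpow_two, sq_abs]
  rw [ENNReal.toReal_ofReal (Real.rpow_nonneg h0 _), ← Real.rpow_natCast, ← Real.rpow_mul h0]
  norm_num



/-- global a priori bounds for strong solutions of the DP equation
whose initial momentum density `u₀ - u₀'' + (2/3)κ` is nonnegative: the gradient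
bound `|∂ₓu| ≤ |u + (2/3)κ|` and the uniform bound
`‖u(t)‖_{L^∞} ≤ 2(1+√2)‖u₀‖_{L²} + (4/3)κ`. -/
theorem stmt_19 (κ : ℝ) (hκ : 0 < κ) (u : ℝ → ℝ → ℝ)
    (hreg : ∀ t ∈ Set.Ici (0:ℝ), ContDiff ℝ 2 (u t) ∧ MemLp (u t) 2 volume)
    (husol : IsDPSolution κ (Set.Ici 0) u)
    (hw0 : ∀ x : ℝ, 0 ≤ u 0 x - deriv (deriv (u 0)) x + (2/3)*κ) :
    (∀ t ∈ Set.Ici (0:ℝ), ∀ x : ℝ, |deriv (u t) x| ≤ |u t x + (2/3)*κ|) ∧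
    (∀ t ∈ Set.Ici (0:ℝ), ∀ x : ℝ,
      |u t x| ≤ 2*(1 + Real.sqrt 2) * (eLpNorm (u 0) 2 volume).toReal + (4/3)*κ) := by
  have h := DPsol.of hκ hreg husol
  have hw := fun t (ht : t ∈ Set.Ici (0:ℝ)) x => w_nonneg h hw0 (T := t) ht x
  have hb : ∀ t ∈ Set.Ici (0:ℝ), ∀ x, |deriv (u t) x| ≤ u t x + (2/3)*κ := fun t ht x =>
    abs_deriv_le (h.cd t ht) (h.l2 t ht) (hw t ht) x
  refine ⟨fun t ht x => (hb t ht x).trans (le_abs_self _), fun t ht x => ?_⟩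
  have hlow : -((2/3)*κ) ≤ u t x := by linarith [(abs_nonneg _).trans (hb t ht x)]
  set n := (eLpNorm (u 0) 2 volume).toReal with hn
  have hn0 : 0 ≤ n := ENNReal.toReal_nonneg
  have hs2 : (1.4:ℝ) ≤ Real.sqrt 2 := Real.le_sqrt_of_sq_le (by norm_num)
  have hbig : 4.8 * n ≤ 2*(1 + Real.sqrt 2) * n := by
    apply mul_le_mul_of_nonneg_right _ hn0; linarith
  rw [abs_le]
  refine ⟨by nlinarith, ?_⟩
  rcases le_total (u t x) (2 * ((2/3)*κ)) with hle | hge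
  · nlinarith
  · have h1 := sup_bd (by positivity) (h.l2 t ht) (fun x => h.hasDerivAt_u ht x) (hb t ht) x hge
    have h2 := h.energy t ht
    rw [int_sq_eq (hreg 0 Set.self_mem_Ici).2] at h2
    have h3 : u t x ^ 2 ≤ (4.8 * n) ^ 2 := by nlinarith [sq_nonneg n]
    have h4 := abs_le_of_sq_le_sq h3 (by positivity)
    linarith [le_abs_self (u t x)]
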